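/- For all integers k ≥ 0 and m ≥ 1, the resonant variety R_k^m(A) is the union of an arrangement of subspaces: there exist finitely many ℂ-linear subspaces V₁, …, V_r of ℂ^N such that R_k^m(A) = V₁ ∪ ⋯ ∪ V_r. -/

import Mathlib

namespace OSDisc

/-- Hyperplane index set: pairs (i,j) with 1 ≤ i < j, ℓ+1 ≤ j ≤ n. -/
def Idx (ℓ n : ℕ) : Type :=
  {p : ℕ × ℕ // 1 ≤ p.1 ∧ p.1 < p.2 ∧ ℓ + 1 ≤ p.2 ∧ p.2 ≤ n}

/-- The exterior algebra E over ℂ on the vector space with basis e_{i,j}. -/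
abbrev E (ℓ n : ℕ) : Type := ExteriorAlgebra ℂ (Idx ℓ n →₀ ℂ)

/-- The generators e_{i,j} of E (junk value 0 for invalid indices). -/
noncomputable def gen (ℓ n : ℕ) (i j : ℕ) : E ℓ n :=
  if h : 1 ≤ i ∧ i < j ∧ ℓ + 1 ≤ j ∧ j ≤ n then
    ExteriorAlgebra.ι ℂ (Finsupp.single (⟨(i, j), h⟩ : Idx ℓ n) (1 : ℂ))
  else 0

/-- Relations generating the Orlik-Solomon ideal. -/
def rel (ℓ n : ℕ) : E ℓ n → E ℓ n → Prop := fun x y =>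
  y = 0 ∧
    ((∃ i j k, 1 ≤ i ∧ i < j ∧ j < k ∧ k ≤ n ∧ ℓ + 1 ≤ j ∧
        x = gen ℓ n i j * gen ℓ n i k - gen ℓ n i j * gen ℓ n j k
            + gen ℓ n i k * gen ℓ n j k) ∨
      (∃ i j k, 1 ≤ i ∧ i < j ∧ j ≤ ℓ ∧ ℓ < k ∧ k ≤ n ∧
        x = gen ℓ n i k * gen ℓ n j k))

/-- The Orlik-Solomon algebra A = E/I of the discriminantal arrangement A_{n,ℓ}. -/
abbrev A (ℓ n : ℕ) : Type := RingQuot (rel ℓ n)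

/-- The quotient map E → A. -/
noncomputable def projA (ℓ n : ℕ) : E ℓ n →ₐ[ℂ] A ℓ n := RingQuot.mkAlgHom ℂ (rel ℓ n)

/-- The generators a_{i,j} of A. -/
noncomputable def a (ℓ n : ℕ) (i j : ℕ) : A ℓ n := projA ℓ n (gen ℓ n i j)

/-- The degree-q component E^q of the exterior algebra. -/
noncomputable def Edeg (ℓ n : ℕ) (q : ℕ) : Submodule ℂ (E ℓ n) :=
  (LinearMap.range (ExteriorAlgebra.ι ℂ : (Idx ℓ n →₀ ℂ) →ₗ[ℂ] E ℓ n)) ^ q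

/-- A^q: the image in A of the degree-q component of E. -/
noncomputable def Adeg (ℓ n : ℕ) (q : ℕ) : Submodule ℂ (A ℓ n) :=
  (Edeg ℓ n q).map (projA ℓ n).toLinearMap

/-- The element a_{I,J}: the product of a_{f j, j} over j ∈ J in increasing order. -/
noncomputable def aIJ (ℓ n : ℕ) (J : Finset ℕ) (f : ℕ → ℕ) : A ℓ n :=
  ((J.sort (· ≤ ·)).map fun j => a ℓ n (f j) j).prod

/-- ω_λ ∈ A¹. -/
noncomputable def omega (ℓ n : ℕ) (lam : ℕ × ℕ → ℂ) : A ℓ n :=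
  ∑ j ∈ Finset.Icc (ℓ + 1) n, ∑ i ∈ Finset.Ico 1 j, lam (i, j) • a ℓ n i j

/-- ω_{k,λ} = Σ_{i=1}^{k−1} λ_{i,k}·a_{i,k}. -/
noncomputable def omegaK (ℓ n : ℕ) (lam : ℕ × ℕ → ℂ) (k : ℕ) : A ℓ n :=
  ∑ i ∈ Finset.Ico 1 k, lam (i, k) • a ℓ n i k



/-- ω_λ for λ ∈ ℂ^N (coordinates indexed by the hyperplanes of A_{n,ℓ}). -/
noncomputable def omegaI (ℓ n : ℕ) (lam : Idx ℓ n → ℂ) : A ℓ n :=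
  ∑ j ∈ Finset.Icc (ℓ + 1) n, ∑ i ∈ Finset.Ico 1 j,
    (if h : 1 ≤ i ∧ i < j ∧ ℓ + 1 ≤ j ∧ j ≤ n then lam ⟨(i, j), h⟩ else 0) • a ℓ n i j

/-- Left multiplication by ω_λ on A. -/
noncomputable def mulOmega (ℓ n : ℕ) (lam : Idx ℓ n → ℂ) : A ℓ n →ₗ[ℂ] A ℓ n :=
  LinearMap.mulLeft ℂ (omegaI ℓ n lam)

/-- rank μ^k(λ): the rank of left multiplication by ω_λ restricted to A^k. -/
noncomputable def rkMu (ℓ n : ℕ) (k : ℕ) (lam : Idx ℓ n → ℂ) : ℕ :=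
  Module.finrank ℂ ((Adeg ℓ n k).map (mulOmega ℓ n lam))

/-- ker μ^k(λ) = A^k ∩ ker(ω_λ∧·). -/
noncomputable def Zmod (ℓ n : ℕ) (k : ℕ) (lam : Idx ℓ n → ℂ) : Submodule ℂ (A ℓ n) :=
  Adeg ℓ n k ⊓ LinearMap.ker (mulOmega ℓ n lam)

/-- im μ^{k−1}(λ) (with μ^{−1} = 0). -/
noncomputable def Bmod (ℓ n : ℕ) (k : ℕ) (lam : Idx ℓ n → ℂ) : Submodule ℂ (A ℓ n) :=
  if k = 0 then ⊥ else (Adeg ℓ n (k - 1)).map (mulOmega ℓ n lam)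

/-- dim H^k(A,λ) = dim (ker μ^k(λ) / im μ^{k−1}(λ)). -/
noncomputable def Hdim (ℓ n : ℕ) (k : ℕ) (lam : Idx ℓ n → ℂ) : ℕ :=
  Module.finrank ℂ
    (↥(Zmod ℓ n k lam) ⧸ (Bmod ℓ n k lam).comap (Zmod ℓ n k lam).subtype)

/-- The resonant variety R_k^m(A) ⊆ ℂ^N. -/
def Rvar (ℓ n : ℕ) (k m : ℕ) : Set (Idx ℓ n → ℂ) :=
  {lam | m ≤ Hdim ℓ n k lam}

section Fiber

variable {K : Type*} [Field K] [Algebra ℂ K] {κ : Type*} [Fintype κ]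

/-- A complex matrix acting on `K`-valued vectors. -/
noncomputable def act (P : Matrix κ κ ℂ) : (κ → K) →ₗ[K] (κ → K) :=
  (P.map (algebraMap ℂ K)).mulVecLin

lemma act_apply (P : Matrix κ κ ℂ) (f : κ → K) (w : κ) :
    act P f w = ∑ v, P w v • f v := by
  simp [act, Matrix.mulVec, dotProduct, Algebra.smul_def]

lemma act_add (P Q : Matrix κ κ ℂ) (f : κ → K) : act (P + Q) f = act P f + act Q f := by
  ext w; simp [act_apply, add_smul, Finset.sum_add_distrib]

lemma act_sub (P Q : Matrix κ κ ℂ) (f : κ → K) : act (P - Q) f = act P f - act Q f := by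
  ext w; simp [act_apply, sub_smul, Finset.sum_sub_distrib]

lemma act_zero (f : κ → K) : act (0 : Matrix κ κ ℂ) f = 0 := by
  ext w; simp [act_apply]

lemma act_sum {ι : Type*} (s : Finset ι) (P : ι → Matrix κ κ ℂ) (f : κ → K) :
    act (∑ i ∈ s, P i) f = ∑ i ∈ s, act (P i) f := by
  classical
  induction s using Finset.induction_on with
  | empty => simp [act_zero]
  | insert i s hi ih => rw [Finset.sum_insert hi, Finset.sum_insert hi, act_add, ih]

lemma act_smul (z : ℂ) (P : Matrix κ κ ℂ) (f : κ → K) : act (z • P) f = z • act P f := by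
  ext w; simp [act_apply, Finset.smul_sum, mul_smul]

lemma act_act (P Q : Matrix κ κ ℂ) (f : κ → K) : act P (act Q f) = act (P * Q) f := by
  simp [act, Matrix.map_mul, Matrix.mulVec_mulVec]

lemma act_mem {R : Subalgebra ℂ K} (P : Matrix κ κ ℂ) {f : κ → K} (hf : ∀ w, f w ∈ R) (w : κ) :
    act P f w ∈ R := by
  rw [act_apply]
  exact sum_mem fun v _ => R.smul_mem (hf v) _

variable [DecidableEq κ]

lemma act_one (f : κ → K) : act (1 : Matrix κ κ ℂ) f = f := by
  ext w; simp [act_apply, Matrix.one_apply]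

lemma act_natCast (k : ℕ) (f : κ → K) : act (k : Matrix κ κ ℂ) f = (k : K) • f := by
  have h : ((k : ℕ) : Matrix κ κ ℂ) = (k : ℂ) • (1 : Matrix κ κ ℂ) := by
    rw [← Nat.smul_one_eq_cast, Nat.cast_smul_eq_nsmul]
  rw [h, act_smul, act_one]
  ext w; simp [Algebra.smul_def]

end Fiber

section Fiber

variable {K : Type*} [Field K] [Algebra ℂ K]

/-- A ring `R` of constants for `δ` together with a coordinate `t` and distinct points `c i`
of the line. -/
structure FiberData (R : Subalgebra ℂ K) (δ : Derivation ℂ K K) (t : K) (c : ℕ → K)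
    (I : Finset ℕ) : Prop where
  deriv_coord : δ t = 1
  deriv_const : ∀ r ∈ R, δ r = 0
  point_mem : ∀ i ∈ I, c i ∈ R
  inv_mem : ∀ i ∈ I, ∀ j ∈ I, (c i - c j)⁻¹ ∈ R
  point_ne : ∀ i ∈ I, ∀ j ∈ I, i ≠ j → c i ≠ c j

/-- The `R`-span of the powers `t ^ k` with `k < p` and of the polar parts `(t - c i) ^ (-s)` with
`s ≤ q`. -/
def low (R : Subalgebra ℂ K) (t : K) (c : ℕ → K) (I : Finset ℕ) (p q : ℕ) : Submodule R K :=
  Submodule.span R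
    {x | (∃ k < p, x = t ^ k) ∨ ∃ i ∈ I, ∃ s < q, x = ((t - c i)⁻¹) ^ (s + 1)}

variable {R : Subalgebra ℂ K} {δ : Derivation ℂ K K} {t : K} {c : ℕ → K} {I : Finset ℕ}

lemma low_mono {p q p' q' : ℕ} (hp : p ≤ p') (hq : q ≤ q') :
    low R t c I p q ≤ low R t c I p' q' := by
  apply Submodule.span_mono
  rintro x (⟨k, hk, rfl⟩ | ⟨i, hi, s, hs, rfl⟩)
  · exact Or.inl ⟨k, by omega, rfl⟩
  · exact Or.inr ⟨i, hi, s, by omega, rfl⟩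

lemma pow_mem_low {k p : ℕ} (q : ℕ) (hk : k < p) : t ^ k ∈ low R t c I p q :=
  Submodule.subset_span (Or.inl ⟨k, hk, rfl⟩)

lemma inv_pow_mem_low {i s q : ℕ} (p : ℕ) (hi : i ∈ I) (hs : s < q) :
    ((t - c i)⁻¹) ^ (s + 1) ∈ low R t c I p q :=
  Submodule.subset_span (Or.inr ⟨i, hi, s, hs, rfl⟩)

lemma mul_mem_low {p q : ℕ} {r x : K} (hr : r ∈ R) (hx : x ∈ low R t c I p q) :
    r * x ∈ low R t c I p q :=
  (low R t c I p q).smul_mem ⟨r, hr⟩ hx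

lemma mem_low_one_zero {x : K} : x ∈ low R t c I 1 0 ↔ x ∈ R := by
  constructor
  · intro hx
    induction hx using Submodule.span_induction with
    | mem x hx =>
      rcases hx with ⟨k, hk, rfl⟩ | ⟨i, hi, s, hs, rfl⟩
      · obtain rfl : k = 0 := by omega
        simp
      · omega
    | zero => exact R.zero_mem
    | add x y _ _ hx hy => exact R.add_mem hx hy
    | smul r x _ hx => exact R.mul_mem r.2 hx
  · intro hx
    simpa using mul_mem_low hx (pow_mem_low (R := R) (t := t) (c := c) (I := I) 0 zero_lt_one)

lemma exists_low_succ_left {p q : ℕ} {x : K} (hx : x ∈ low R t c I (p + 1) q) :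
    ∃ u ∈ R, x - t ^ p * u ∈ low R t c I p q := by
  induction hx using Submodule.span_induction with
  | mem x hx =>
    rcases hx with ⟨k, hk, rfl⟩ | ⟨i, hi, s, hs, rfl⟩
    · rcases Nat.lt_succ_iff_lt_or_eq.1 hk with h | rfl
      · exact ⟨0, R.zero_mem, by simpa using pow_mem_low q h⟩
      · exact ⟨1, R.one_mem, by simp⟩
    · exact ⟨0, R.zero_mem, by simpa using inv_pow_mem_low p hi hs⟩
  | zero => exact ⟨0, R.zero_mem, by simp⟩
  | add x y _ _ hx hy =>
    obtain ⟨u, hu, hxu⟩ := hx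
    obtain ⟨v, hv, hyv⟩ := hy
    exact ⟨u + v, R.add_mem hu hv, by convert add_mem hxu hyv using 1; ring⟩
  | smul r x _ hx =>
    obtain ⟨u, hu, hxu⟩ := hx
    refine ⟨r * u, R.mul_mem r.2 hu, ?_⟩
    convert mul_mem_low r.2 hxu using 1
    rw [Algebra.smul_def]
    change (r : K) * x - _ = _
    ring

lemma exists_low_succ_right {p q : ℕ} {x : K} (hx : x ∈ low R t c I p (q + 1)) :
    ∃ v : ℕ → K, (∀ i, v i ∈ R) ∧
      x - ∑ i ∈ I, ((t - c i)⁻¹) ^ (q + 1) * v i ∈ low R t c I p q := by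
  induction hx using Submodule.span_induction with
  | mem x hx =>
    rcases hx with ⟨k, hk, rfl⟩ | ⟨i, hi, s, hs, rfl⟩
    · exact ⟨0, fun _ => R.zero_mem, by simpa using pow_mem_low q hk⟩
    · rcases Nat.lt_succ_iff_lt_or_eq.1 hs with h | rfl
      · exact ⟨0, fun _ => R.zero_mem, by simpa using inv_pow_mem_low p hi h⟩
      · refine ⟨fun j => if j = i then 1 else 0, fun j => ?_, ?_⟩
        · dsimp only
          split_ifs
          exacts [R.one_mem, R.zero_mem]
        · simp [hi]
  | zero => exact ⟨0, fun _ => R.zero_mem, by simp⟩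
  | add x y _ _ hx hy =>
    obtain ⟨u, hu, hxu⟩ := hx
    obtain ⟨v, hv, hyv⟩ := hy
    refine ⟨u + v, fun i => R.add_mem (hu i) (hv i), ?_⟩
    convert add_mem hxu hyv using 1
    simp only [Pi.add_apply, mul_add, Finset.sum_add_distrib]
    ring
  | smul r x _ hx =>
    obtain ⟨u, hu, hxu⟩ := hx
    refine ⟨fun i => r * u i, fun i => R.mul_mem r.2 (hu i), ?_⟩
    convert mul_mem_low r.2 hxu using 1
    rw [mul_sub, Finset.mul_sum, Algebra.smul_def]
    change (r : K) * x - _ = _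
    congr 1
    exact Finset.sum_congr rfl fun i _ => by ring

lemma FiberData.sub_ne_zero (h : FiberData R δ t c I) {i : ℕ} (hi : i ∈ I) : t - c i ≠ 0 := by
  intro h0
  have h1 : δ (t - c i) = 1 := by
    rw [map_sub, h.deriv_coord, h.deriv_const _ (h.point_mem i hi), sub_zero]
  rw [h0, map_zero] at h1
  exact zero_ne_one h1

lemma FiberData.deriv_inv_pow (h : FiberData R δ t c I) {i : ℕ} (hi : i ∈ I) (s : ℕ) :
    δ (((t - c i)⁻¹) ^ s) = -(s : K) * ((t - c i)⁻¹) ^ (s + 1) := by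
  rw [Derivation.leibniz_pow, Derivation.leibniz_inv, map_sub, h.deriv_coord,
    h.deriv_const _ (h.point_mem i hi)]
  rcases s with _ | s
  · simp
  · simp only [nsmul_eq_mul, smul_eq_mul, Nat.add_sub_cancel, sub_zero, mul_one]
    ring

/-- Multiplication of a simple pole with a pole elsewhere. -/
lemma FiberData.inv_mul_inv_pow_mem (h : FiberData R δ t c I) {i j : ℕ} (hi : i ∈ I) (hj : j ∈ I)
    (hij : j ≠ i) (s : ℕ) :
    (t - c j)⁻¹ * ((t - c i)⁻¹) ^ (s + 1) ∈ low R t c I 0 (s + 1) := by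
  have hti := h.sub_ne_zero hi
  have htj := h.sub_ne_zero hj
  have hne : c j - c i ≠ 0 := _root_.sub_ne_zero.2 (h.point_ne j hj i hi hij)
  have key : ∀ y : K, (t - c j)⁻¹ * ((t - c i)⁻¹ * y)
      = (c j - c i)⁻¹ * ((t - c j)⁻¹ * y - (t - c i)⁻¹ * y) := by
    intro y
    field_simp
    ring
  induction s with
  | zero =>
    have := key 1
    rw [mul_one, mul_one] at this
    rw [zero_add, pow_one, this]
    refine mul_mem_low (h.inv_mem j hj i hi) (sub_mem ?_ ?_)
    · simpa using inv_pow_mem_low 0 hj zero_lt_one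
    · simpa using inv_pow_mem_low 0 hi zero_lt_one
  | succ s ih =>
    rw [pow_succ' _ (s + 1), key]
    refine mul_mem_low (h.inv_mem j hj i hi) (sub_mem (low_mono le_rfl (by omega) ih) ?_)
    rw [← pow_succ']
    exact inv_pow_mem_low 0 hi (by omega)

lemma FiberData.inv_mul_pow_mem (h : FiberData R δ t c I) {j : ℕ} (hj : j ∈ I) (k : ℕ) :
    (t - c j)⁻¹ * t ^ k ∈ low R t c I k 1 := by
  have htj := h.sub_ne_zero hj
  induction k with
  | zero => simpa using inv_pow_mem_low (R := R) 0 hj zero_lt_one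
  | succ k ih =>
    have : (t - c j)⁻¹ * t ^ (k + 1) = t ^ k + c j * ((t - c j)⁻¹ * t ^ k) := by
      field_simp
      ring
    rw [this]
    exact add_mem (pow_mem_low 1 (by omega))
      (mul_mem_low (h.point_mem j hj) (low_mono (by omega) le_rfl ih))

lemma FiberData.inv_mul_pow_succ_sub_mem (h : FiberData R δ t c I) {j : ℕ} (hj : j ∈ I) (k : ℕ) :
    (t - c j)⁻¹ * t ^ (k + 1) - t ^ k ∈ low R t c I k 1 := by
  have htj := h.sub_ne_zero hj
  have : (t - c j)⁻¹ * t ^ (k + 1) - t ^ k = c j * ((t - c j)⁻¹ * t ^ k) := by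
    field_simp
    ring
  rw [this]
  exact mul_mem_low (h.point_mem j hj) (h.inv_mul_pow_mem hj k)

lemma FiberData.inv_mul_mem_low (h : FiberData R δ t c I) {j : ℕ} (hj : j ∈ I) {p q : ℕ} {x : K}
    (hx : x ∈ low R t c I p q) : (t - c j)⁻¹ * x ∈ low R t c I p (q + 1) := by
  induction hx using Submodule.span_induction with
  | mem x hx =>
    rcases hx with ⟨k, hk, rfl⟩ | ⟨i, hi, s, hs, rfl⟩
    · exact low_mono (by omega) (by omega) (h.inv_mul_pow_mem hj k)
    · rcases eq_or_ne j i with rfl | hij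
      · rw [← pow_succ']
        exact inv_pow_mem_low p hj (by omega)
      · exact low_mono (by omega) (by omega) (h.inv_mul_inv_pow_mem hi hj hij s)
  | zero => simp
  | add x y _ _ hx hy => rw [mul_add]; exact add_mem hx hy
  | smul r x _ hx => rw [mul_smul_comm]; exact Submodule.smul_mem _ _ hx

lemma FiberData.coord_mul_mem_low (h : FiberData R δ t c I) {p q : ℕ} {x : K}
    (hx : x ∈ low R t c I p q) : t * x ∈ low R t c I (p + 1) q := by
  induction hx using Submodule.span_induction with
  | mem x hx =>
    rcases hx with ⟨k, hk, rfl⟩ | ⟨i, hi, s, hs, rfl⟩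
    · rw [← pow_succ']
      exact pow_mem_low q (by omega)
    · have hti := h.sub_ne_zero hi
      have : t * ((t - c i)⁻¹) ^ (s + 1)
          = ((t - c i)⁻¹) ^ s + c i * ((t - c i)⁻¹) ^ (s + 1) := by
        rw [pow_succ]
        field_simp
        ring
      rw [this]
      refine add_mem ?_ (mul_mem_low (h.point_mem i hi) (inv_pow_mem_low _ hi hs))
      rcases s with _ | s
      · simpa using pow_mem_low (R := R) (t := t) (c := c) (I := I) q (Nat.succ_pos p)
      · exact inv_pow_mem_low _ hi (by omega)
  | zero => simp
  | add x y _ _ hx hy => rw [mul_add]; exact add_mem hx hy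
  | smul r x _ hx => rw [mul_smul_comm]; exact Submodule.smul_mem _ _ hx

lemma mem_low_one : (1 : K) ∈ low R t c I 1 1 :=
  low_mono le_rfl (Nat.zero_le 1) (mem_low_one_zero.2 R.one_mem)

/-- Every element of the ring generated by `t` and the `(t - c i)⁻¹` over `R` has a partial
fraction decomposition. -/
lemma FiberData.exists_mem_low (h : FiberData R δ t c I) {S : Set K}
    (hS : ∀ x ∈ S, x ∈ R ∨ x = t ∨ ∃ i ∈ I, x = (t - c i)⁻¹) {f : K}
    (hf : f ∈ Algebra.adjoin ℂ S) : ∃ N, f ∈ low R t c I N N := by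
  suffices H : ∀ g, (∃ N, g ∈ low R t c I N N) → ∃ N, f * g ∈ low R t c I N N by
    simpa using H 1 ⟨1, mem_low_one⟩
  induction hf using Algebra.adjoin_induction with
  | mem x hx =>
    rintro g ⟨N, hg⟩
    rcases hS x hx with hx | rfl | ⟨i, hi, rfl⟩
    · exact ⟨N, mul_mem_low hx hg⟩
    · exact ⟨N + 1, low_mono le_rfl (by omega) (h.coord_mul_mem_low hg)⟩
    · exact ⟨N + 1, low_mono (by omega) le_rfl (h.inv_mul_mem_low hi hg)⟩
  | algebraMap z =>
    rintro g ⟨N, hg⟩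
    exact ⟨N, mul_mem_low (R.algebraMap_mem z) hg⟩
  | add x y _ _ hx hy =>
    intro g hg
    obtain ⟨N, hN⟩ := hx g hg
    obtain ⟨M, hM⟩ := hy g hg
    refine ⟨max N M, ?_⟩
    rw [add_mul]
    exact add_mem (low_mono (le_max_left _ _) (le_max_left _ _) hN)
      (low_mono (le_max_right _ _) (le_max_right _ _) hM)
  | mul x y _ _ hx hy =>
    intro g hg
    rw [mul_assoc]
    exact hx _ (hy g hg)

lemma low_le_of_subalgebra {S : Subalgebra ℂ K} (hR : R ≤ S) (ht : t ∈ S)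
    (hc : ∀ i ∈ I, (t - c i)⁻¹ ∈ S) {p q : ℕ} {x : K} (hx : x ∈ low R t c I p q) : x ∈ S := by
  induction hx using Submodule.span_induction with
  | mem x hx =>
    rcases hx with ⟨k, hk, rfl⟩ | ⟨i, hi, s, hs, rfl⟩
    · exact S.pow_mem ht _
    · exact S.pow_mem (hc i hi) _
  | zero => exact S.zero_mem
  | add x y _ _ hx hy => exact S.add_mem hx hy
  | smul r x _ hx => exact S.mul_mem (hR r.2) hx

/-- `t` is transcendental over the constants. -/
lemma FiberData.aeval_injective (h : FiberData R δ t c I) {f : Polynomial R}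
    (hf : Polynomial.aeval t f = 0) : f = 0 := by
  have hδ : ∀ f : Polynomial R, δ (Polynomial.aeval t f)
      = Polynomial.aeval t (Polynomial.derivative f) := by
    intro f
    induction f using Polynomial.induction_on' with
    | add f g hf hg => simp [hf, hg]
    | monomial k r =>
      rw [Polynomial.aeval_monomial, Polynomial.derivative_monomial, Polynomial.aeval_monomial,
        Derivation.leibniz, Derivation.leibniz_pow, h.deriv_coord]
      have : δ (algebraMap R K r) = 0 := h.deriv_const _ r.2
      rw [this]
      simp [mul_comm, mul_assoc]
  have : CharZero R := charZero_of_injective_algebraMap (algebraMap ℂ R).injective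
  by_contra hne
  induction hd : f.natDegree using Nat.strong_induction_on generalizing f with
  | _ d ih =>
    subst hd
    rcases Nat.eq_zero_or_pos f.natDegree with h0 | hpos
    · rw [Polynomial.eq_C_of_natDegree_eq_zero h0, Polynomial.aeval_C] at hf
      apply hne
      rw [Polynomial.eq_C_of_natDegree_eq_zero h0]
      have : f.coeff 0 = 0 := Subtype.ext hf
      rw [this, map_zero]
    · refine ih _ (Polynomial.natDegree_derivative_lt hpos.ne') (f := Polynomial.derivative f)
        ?_ ?_ rfl
      · rw [← hδ, hf, map_zero]
      · intro h'
        exact hpos.ne' (Polynomial.derivative_eq_zero.1 h')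

end Fiber

section Fiber

variable {K : Type*} [Field K] [Algebra ℂ K]
variable {R : Subalgebra ℂ K} {δ : Derivation ℂ K K} {t : K} {c : ℕ → K} {I : Finset ℕ}

open Polynomial in
/-- The common denominator of `low R t c I p M` as a polynomial, with an adjustable exponent. -/
lemma FiberData.inv_pow_mul_prod (h : FiberData R δ t c I) {c' : ℕ → R}
    (hc' : ∀ i ∈ I, (c' i : K) = c i) {j : ℕ} (hj : j ∈ I) {s M : ℕ} (hs : s ≤ M) :
    ((t - c j)⁻¹) ^ s * ∏ i ∈ I, (t - c i) ^ M
      = aeval t ((X - C (c' j)) ^ (M - s) * ∏ i ∈ I.erase j, (X - C (c' i)) ^ M) := by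
  have hj0 := h.sub_ne_zero hj
  have hc'' : ∀ i ∈ I, algebraMap R K (c' i) = c i := hc'
  rw [map_mul, map_pow, map_prod, map_sub, aeval_X, aeval_C, hc'' j hj,
    ← Finset.mul_prod_erase I _ hj, ← mul_assoc]
  congr 1
  · obtain ⟨r, rfl⟩ := Nat.exists_eq_add_of_le hs
    rw [Nat.add_sub_cancel_left, pow_add, ← mul_assoc, ← mul_pow, inv_mul_cancel₀ hj0, one_pow,
      one_mul]
  · refine Finset.prod_congr rfl fun i hi => ?_
    rw [map_pow, map_sub, aeval_X, aeval_C, hc'' i (Finset.mem_of_mem_erase hi)]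

lemma FiberData.exists_points (h : FiberData R δ t c I) :
    ∃ c' : ℕ → R, ∀ i ∈ I, (c' i : K) = c i := by
  classical
  exact ⟨fun i => if hi : i ∈ I then ⟨c i, h.point_mem i hi⟩ else 0, fun i hi => by simp [hi]⟩

open Polynomial in
lemma aeval_prod_points {c' : ℕ → R} (hc' : ∀ i ∈ I, (c' i : K) = c i) (M : ℕ) :
    aeval t (∏ i ∈ I, (X - C (c' i)) ^ M) = ∏ i ∈ I, (t - c i) ^ M := by
  rw [map_prod]
  refine Finset.prod_congr rfl fun i hi => ?_
  rw [map_pow, map_sub, aeval_X, aeval_C]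
  congr 2
  exact hc' i hi

open Polynomial in
lemma FiberData.eq_zero_of_pow_mul_mem (h : FiberData R δ t c I) {N M : ℕ} {w : K} (hw : w ∈ R)
    (hm : t ^ N * w ∈ low R t c I N M) : w = 0 := by
  obtain ⟨c', hc'⟩ := h.exists_points
  have hmonic : ∀ J : Finset ℕ, (∏ i ∈ J, (X - C (c' i)) ^ M).Monic := fun J =>
    monic_prod_of_monic _ _ fun i _ => (monic_X_sub_C _).pow M
  have hdeg : ∀ J : Finset ℕ, (∏ i ∈ J, (X - C (c' i)) ^ M).natDegree = J.card * M := fun J => by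
    rw [natDegree_prod_of_monic _ _ fun i _ => (monic_X_sub_C _).pow M]
    simp [(monic_X_sub_C _).natDegree_pow]
  have H : ∀ x ∈ low R t c I N M, ∃ f : R[X], f.degree < ((N + I.card * M : ℕ) : WithBot ℕ) ∧
      x * ∏ i ∈ I, (t - c i) ^ M = aeval t f := by
    intro x hx
    induction hx using Submodule.span_induction with
    | mem x hx =>
      rcases hx with ⟨k, hk, rfl⟩ | ⟨i, hi, s, hs, rfl⟩
      · refine ⟨X ^ k * ∏ i ∈ I, (X - C (c' i)) ^ M, ?_, ?_⟩
        · rw [degree_eq_natDegree ((monic_X_pow k).mul (hmonic I)).ne_zero,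
            (monic_X_pow k).natDegree_mul (hmonic I), natDegree_X_pow, hdeg]
          exact_mod_cast by omega
        · rw [map_mul, map_pow, aeval_X, aeval_prod_points hc']
      · refine ⟨_, ?_, h.inv_pow_mul_prod hc' hi hs⟩
        have h1 := (monic_X_sub_C (c' i)).pow (M - (s + 1))
        rw [degree_eq_natDegree (h1.mul (hmonic _)).ne_zero, h1.natDegree_mul (hmonic _), hdeg,
          (monic_X_sub_C _).natDegree_pow, natDegree_X_sub_C, Finset.card_erase_of_mem hi]
        have : 0 < I.card := Finset.card_pos.2 ⟨i, hi⟩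
        obtain ⟨r, hr⟩ := Nat.exists_eq_succ_of_ne_zero this.ne'
        rw [hr, Nat.succ_sub_one, Nat.succ_mul]
        exact_mod_cast by omega
    | zero => exact ⟨0, by rw [degree_zero]; exact WithBot.bot_lt_coe _, by simp⟩
    | add x y _ _ hx hy =>
      obtain ⟨f, hf, hxf⟩ := hx
      obtain ⟨g, hg, hyg⟩ := hy
      exact ⟨f + g, (degree_add_le f g).trans_lt (max_lt hf hg), by rw [add_mul, hxf, hyg, map_add]⟩
    | smul r x _ hx =>
      obtain ⟨f, hf, hxf⟩ := hx
      exact ⟨r • f, (degree_smul_le r f).trans_lt hf, by rw [smul_mul_assoc, hxf, map_smul]⟩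
  obtain ⟨f, hf, hxf⟩ := H _ hm
  have hz : aeval t (C (⟨w, hw⟩ : R) * (X ^ N * ∏ i ∈ I, (X - C (c' i)) ^ M) - f) = 0 := by
    rw [map_sub, ← hxf, map_mul, map_mul, aeval_C, map_pow, aeval_X, aeval_prod_points hc']
    change w * _ - _ = _
    ring
  have heq := sub_eq_zero.1 (h.aeval_injective hz)
  by_contra hw0
  have hw0' : (⟨w, hw⟩ : R) ≠ 0 := fun h0 => hw0 (congrArg Subtype.val h0)
  rw [← heq, degree_C_mul hw0', degree_eq_natDegree ((monic_X_pow N).mul (hmonic I)).ne_zero,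
    (monic_X_pow N).natDegree_mul (hmonic I), natDegree_X_pow, hdeg] at hf
  exact lt_irrefl _ hf

open Polynomial in
lemma FiberData.eq_zero_of_sum_inv_pow_mem (h : FiberData R δ t c I) {p N : ℕ} {w : ℕ → K}
    (hw : ∀ i, w i ∈ R) (hm : ∑ i ∈ I, ((t - c i)⁻¹) ^ (N + 1) * w i ∈ low R t c I p N) {i : ℕ}
    (hi : i ∈ I) : w i = 0 := by
  obtain ⟨c', hc'⟩ := h.exists_points
  have H : ∀ x ∈ low R t c I p N, ∃ f : R[X], f.eval (c' i) = 0 ∧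
      x * ∏ i ∈ I, (t - c i) ^ (N + 1) = aeval t f := by
    intro x hx
    induction hx using Submodule.span_induction with
    | mem x hx =>
      rcases hx with ⟨k, hk, rfl⟩ | ⟨j, hj, s, hs, rfl⟩
      · refine ⟨X ^ k * ∏ i ∈ I, (X - C (c' i)) ^ (N + 1), ?_, ?_⟩
        · rw [eval_mul, eval_prod, Finset.prod_eq_zero hi, mul_zero]
          simp
        · rw [map_mul, map_pow, aeval_X, aeval_prod_points hc']
      · refine ⟨_, ?_, h.inv_pow_mul_prod hc' hj (by omega)⟩
        rw [eval_mul, eval_prod]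
        rcases eq_or_ne i j with rfl | hij
        · simp [show N - s ≠ 0 by omega]
        · rw [Finset.prod_eq_zero (Finset.mem_erase.2 ⟨hij, hi⟩), mul_zero]
          simp
    | zero => exact ⟨0, by simp, by simp⟩
    | add x y _ _ hx hy =>
      obtain ⟨f, hf, hxf⟩ := hx
      obtain ⟨g, hg, hyg⟩ := hy
      exact ⟨f + g, by rw [eval_add, hf, hg, add_zero], by rw [add_mul, hxf, hyg, map_add]⟩
    | smul r x _ hx =>
      obtain ⟨f, hf, hxf⟩ := hx
      exact ⟨r • f, by rw [eval_smul, hf, smul_zero], by rw [smul_mul_assoc, hxf, map_smul]⟩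
  obtain ⟨f, hf, hxf⟩ := H _ hm
  set g : R[X] := ∑ j ∈ I, C (⟨w j, hw j⟩ : R) * ∏ k ∈ I.erase j, (X - C (c' k)) ^ (N + 1) with hg
  have hz : aeval t (g - f) = 0 := by
    rw [map_sub, ← hxf, hg, map_sum, Finset.sum_mul, sub_eq_zero]
    refine Finset.sum_congr rfl fun j hj => ?_
    have := h.inv_pow_mul_prod hc' hj (le_refl (N + 1))
    rw [mul_right_comm, this, Nat.sub_self, pow_zero, one_mul, map_mul, aeval_C, mul_comm]
    rfl
  have heq := sub_eq_zero.1 (h.aeval_injective hz)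
  rw [← heq, hg, eval_finsetSum, Finset.sum_eq_single i, eval_mul, eval_C, eval_prod] at hf
  · rcases mul_eq_zero.1 hf with h0 | h0
    · exact congrArg Subtype.val h0
    · obtain ⟨k, hk, hk0⟩ := Finset.prod_eq_zero_iff.1 h0
      rw [eval_pow, eval_sub, eval_X, eval_C] at hk0
      have hk1 := sub_eq_zero.1 (eq_zero_of_pow_eq_zero hk0)
      have hk2 := Finset.mem_erase.1 hk
      refine absurd ?_ (h.point_ne i hi k hk2.2 hk2.1.symm)
      rw [← hc' i hi, ← hc' k hk2.2, hk1]
  · intro j hj hji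
    rw [eval_mul, eval_prod, Finset.prod_eq_zero (Finset.mem_erase.2 ⟨hji.symm, hi⟩), mul_zero]
    simp
  · exact fun h' => absurd hi h'

variable {κ : Type*} [Fintype κ]

/-- The connection `∂ + ∑ (t - c i)⁻¹ Q i` along the fibre. -/
noncomputable def fib (δ : Derivation ℂ K K) (t : K) (c : ℕ → K) (I : Finset ℕ)
    (Q : ℕ → Matrix κ κ ℂ) (f : κ → K) : κ → K := fun w =>
  δ (f w) + ∑ i ∈ I, (t - c i)⁻¹ * act (Q i) f w

variable {Q : ℕ → Matrix κ κ ℂ}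

lemma fib_add (f g : κ → K) : fib δ t c I Q (f + g) = fib δ t c I Q f + fib δ t c I Q g := by
  ext w
  simp only [fib, Pi.add_apply, map_add, mul_add, Finset.sum_add_distrib]
  ring

lemma fib_sub (f g : κ → K) : fib δ t c I Q (f - g) = fib δ t c I Q f - fib δ t c I Q g := by
  rw [eq_sub_iff_add_eq, ← fib_add, sub_add_cancel]

lemma fib_sum {ι : Type*} (s : Finset ι) (f : ι → κ → K) :
    fib δ t c I Q (∑ i ∈ s, f i) = ∑ i ∈ s, fib δ t c I Q (f i) :=
  map_sum (AddMonoidHom.mk' (fib δ t c I Q) fib_add) f s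

lemma FiberData.fib_const (h : FiberData R δ t c I) {u : κ → K} (hu : ∀ w, u w ∈ R) (w : κ) :
    fib δ t c I Q u w = ∑ i ∈ I, (t - c i)⁻¹ * act (Q i) u w := by
  simp [fib, h.deriv_const _ (hu w)]

variable [DecidableEq κ]

lemma FiberData.fib_inv_pow (h : FiberData R δ t c I) {i : ℕ} (hi : i ∈ I) (s : ℕ) {u : κ → K}
    (hu : ∀ w, u w ∈ R) (w : κ) :
    fib δ t c I Q (((t - c i)⁻¹) ^ (s + 1) • u) w
      - ((t - c i)⁻¹) ^ (s + 2) * act (Q i - ((s + 1 : ℕ) : Matrix κ κ ℂ)) u w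
      ∈ low R t c I 0 (s + 1) := by
  simp only [fib, Pi.smul_apply, smul_eq_mul, map_smul, Derivation.leibniz, h.deriv_const _ (hu w),
    h.deriv_inv_pow hi, act_sub, act_natCast, Pi.sub_apply]
  rw [← Finset.add_sum_erase I _ hi]
  have : ∑ j ∈ I.erase i, (t - c j)⁻¹ * (((t - c i)⁻¹) ^ (s + 1) * act (Q j) u w)
      ∈ low R t c I 0 (s + 1) := by
    refine sum_mem fun j hj => ?_
    have hj' := Finset.mem_erase.1 hj
    rw [← mul_assoc, mul_comm]
    exact mul_mem_low (act_mem _ hu w) (h.inv_mul_inv_pow_mem hi hj'.2 hj'.1 s)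
  convert this using 1
  push_cast
  ring

lemma FiberData.fib_pow (h : FiberData R δ t c I) (k : ℕ) {u : κ → K}
    (hu : ∀ w, u w ∈ R) (w : κ) :
    fib δ t c I Q (t ^ (k + 1) • u) w
      - t ^ k * act (∑ i ∈ I, Q i + ((k + 1 : ℕ) : Matrix κ κ ℂ)) u w ∈ low R t c I k 1 := by
  simp only [fib, Pi.smul_apply, smul_eq_mul, map_smul, Derivation.leibniz, h.deriv_const _ (hu w),
    Derivation.leibniz_pow, h.deriv_coord, act_add, act_natCast, act_sum, Pi.add_apply,
    Finset.sum_apply]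
  have : ∑ j ∈ I, ((t - c j)⁻¹ * t ^ (k + 1) - t ^ k) * act (Q j) u w ∈ low R t c I k 1 := by
    refine sum_mem fun j hj => ?_
    rw [mul_comm]
    exact mul_mem_low (act_mem _ hu w) (h.inv_mul_pow_succ_sub_mem hj k)
  convert this using 1
  simp only [sub_mul, Finset.sum_sub_distrib, ← Finset.mul_sum, mul_assoc]
  simp
  ring

/-- `fib` raises pole orders and lowers degrees. -/
lemma FiberData.fib_mem_low (h : FiberData R δ t c I) {p q : ℕ} {f : κ → K}
    (hf : ∀ w, f w ∈ low R t c I (p + 1) q) (w : κ) :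
    fib δ t c I Q f w ∈ low R t c I p (q + 1) := by
  induction q generalizing f with
  | zero =>
    induction p generalizing f with
    | zero =>
      have hf' : ∀ w, f w ∈ R := fun w => mem_low_one_zero.1 (hf w)
      rw [h.fib_const hf']
      refine sum_mem fun i hi => ?_
      rw [mul_comm]
      exact mul_mem_low (act_mem _ hf' w)
        (by simpa using inv_pow_mem_low (R := R) (t := t) (c := c) 0 hi zero_lt_one)
    | succ p ih =>
      choose u hu hfu using fun w => exists_low_succ_left (hf w)
      have h1 := ih (f := f - t ^ (p + 1) • u) hfu
      rw [fib_sub] at h1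
      have h2 := h.fib_pow (Q := Q) p hu w
      have h3 : t ^ p * act (∑ i ∈ I, Q i + ((p + 1 : ℕ) : Matrix κ κ ℂ)) u w
          ∈ low R t c I (p + 1) 1 := by
        rw [mul_comm]
        exact mul_mem_low (act_mem _ hu w) (pow_mem_low _ (by omega))
      have := add_mem (add_mem (low_mono (by omega) (by omega) h1)
        (low_mono (Nat.le_succ p) le_rfl h2)) h3
      convert this using 1
      simp only [Pi.sub_apply]
      ring
  | succ q ih =>
    choose v hv hfv using fun w => exists_low_succ_right (hf w)
    have h1 := ih (f := f - ∑ i ∈ I, ((t - c i)⁻¹) ^ (q + 1) • fun w => v w i)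
      fun w => by simpa using hfv w
    rw [fib_sub, fib_sum] at h1
    have h2 : ∑ i ∈ I, fib δ t c I Q (((t - c i)⁻¹) ^ (q + 1) • fun w => v w i) w
        ∈ low R t c I p (q + 2) := by
      refine sum_mem fun i hi => ?_
      have h3 := h.fib_inv_pow (Q := Q) hi q (u := fun w => v w i) (fun w => hv w i) w
      have h4 : ((t - c i)⁻¹) ^ (q + 2) * act (Q i - ((q + 1 : ℕ) : Matrix κ κ ℂ))
          (fun w => v w i) w ∈ low R t c I p (q + 2) := by
        rw [mul_comm]
        exact mul_mem_low (act_mem _ (fun w => hv w i) w) (inv_pow_mem_low _ hi (by omega))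
      have := add_mem (low_mono (by omega) (by omega) h3) h4
      rwa [sub_add_cancel] at this
    have := add_mem (low_mono le_rfl (by omega) h1) h2
    convert this using 1
    simp

lemma act_inv_act {P : Matrix κ κ ℂ} (hP : IsUnit P) (f : κ → K) : act P (act P⁻¹ f) = f := by
  rw [act_act, Matrix.mul_nonsing_inv _ ((Matrix.isUnit_iff_isUnit_det _).1 hP), act_one]

lemma eq_zero_of_act_eq_zero {P : Matrix κ κ ℂ} (hP : IsUnit P) {f : κ → K} (hf : act P f = 0) :
    f = 0 := by
  rw [← act_one f, ← Matrix.nonsing_inv_mul _ ((Matrix.isUnit_iff_isUnit_det _).1 hP), ← act_act,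
    hf, map_zero]

/-- Nonresonance of the residues at the finite points and at infinity. -/
structure Nonres (I : Finset ℕ) (Q : ℕ → Matrix κ κ ℂ) : Prop where
  finite : ∀ i ∈ I, ∀ s : ℕ, IsUnit (Q i - ((s + 1 : ℕ) : Matrix κ κ ℂ))
  infinity : ∀ s : ℕ, IsUnit (∑ i ∈ I, Q i + ((s + 1 : ℕ) : Matrix κ κ ℂ))

/-- Every function on the fibre is, up to a derivative, a sum of simple poles. -/
lemma FiberData.exists_fib_add_poles (h : FiberData R δ t c I) (hQ : Nonres I Q) {N : ℕ}
    {f : κ → K} (hf : ∀ w, f w ∈ low R t c I N N) :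
    ∃ (g : κ → K) (v : ℕ → κ → K), (∀ w, ∃ M, g w ∈ low R t c I M M) ∧ (∀ i w, v i w ∈ R) ∧
      f = fib δ t c I Q g + ∑ i ∈ I, (t - c i)⁻¹ • v i := by
  have poles : ∀ q p (f : κ → K), (∀ w, f w ∈ low R t c I p (q + 1)) →
      ∃ g : κ → K, (∀ w, g w ∈ low R t c I 0 q) ∧
        ∀ w, (f - fib δ t c I Q g) w ∈ low R t c I p 1 := by
    intro q p
    induction q with
    | zero => exact fun f hf => ⟨0, fun w => zero_mem _, fun w => by simpa [fib] using hf w⟩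
    | succ q ih =>
      intro f hf
      choose v hv hfv using fun w => exists_low_succ_right (hf w)
      set u : ℕ → κ → K := fun i =>
        act (Q i - ((q + 1 : ℕ) : Matrix κ κ ℂ))⁻¹ (fun w => v w i) with hu
      have huR : ∀ i w, u i w ∈ R := fun i => act_mem _ fun w => hv w i
      set g : κ → K := ∑ i ∈ I, ((t - c i)⁻¹) ^ (q + 1) • u i with hg
      have hgm : ∀ w, g w ∈ low R t c I 0 (q + 1) := fun w => by
        rw [hg, Finset.sum_apply]
        refine sum_mem fun i hi => ?_
        rw [Pi.smul_apply, smul_eq_mul, mul_comm]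
        exact mul_mem_low (huR i w) (inv_pow_mem_low _ hi (by omega))
      obtain ⟨g', hg', hfg'⟩ := ih (f - fib δ t c I Q g) (fun w => by
        have h1 : ∑ i ∈ I, (fib δ t c I Q (((t - c i)⁻¹) ^ (q + 1) • u i) w
            - ((t - c i)⁻¹) ^ (q + 2) * v w i) ∈ low R t c I 0 (q + 1) := by
          refine sum_mem fun i hi => ?_
          have := h.fib_inv_pow (Q := Q) hi q (huR i) w
          rwa [hu, act_inv_act (hQ.finite i hi q)] at this
        have := sub_mem (hfv w) (low_mono (Nat.zero_le p) le_rfl h1)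
        convert this using 1
        rw [Pi.sub_apply, hg, fib_sum, Finset.sum_apply, Finset.sum_sub_distrib]
        ring)
      refine ⟨g + g', fun w => add_mem (hgm w) (low_mono le_rfl (by omega) (hg' w)), fun w => ?_⟩
      rw [fib_add, ← sub_sub]
      exact hfg' w
  have pols : ∀ p (f : κ → K), (∀ w, f w ∈ low R t c I p 1) →
      ∃ g : κ → K, (∀ w, g w ∈ low R t c I (p + 1) 0) ∧
        ∀ w, (f - fib δ t c I Q g) w ∈ low R t c I 0 1 := by
    intro p
    induction p with
    | zero => exact fun f hf => ⟨0, fun w => zero_mem _, fun w => by simpa [fib] using hf w⟩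
    | succ p ih =>
      intro f hf
      choose v hv hfv using fun w => exists_low_succ_left (hf w)
      set u : κ → K := act (∑ i ∈ I, Q i + ((p + 1 : ℕ) : Matrix κ κ ℂ))⁻¹ v with hu
      have huR : ∀ w, u w ∈ R := act_mem _ hv
      obtain ⟨g', hg', hfg'⟩ := ih (f - fib δ t c I Q (t ^ (p + 1) • u)) (fun w => by
        have h1 := h.fib_pow (Q := Q) p huR w
        rw [hu, act_inv_act (hQ.infinity p)] at h1
        have := sub_mem (hfv w) h1
        convert this using 1
        rw [Pi.sub_apply]
        ring)
      refine ⟨t ^ (p + 1) • u + g', fun w => add_mem ?_ (low_mono (by omega) le_rfl (hg' w)),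
        fun w => ?_⟩
      · rw [Pi.smul_apply, smul_eq_mul, mul_comm]
        exact mul_mem_low (huR w) (pow_mem_low _ (by omega))
      · rw [fib_add, ← sub_sub]
        exact hfg' w
  obtain ⟨g, hg, hfg⟩ := poles N N f fun w => low_mono le_rfl (by omega) (hf w)
  obtain ⟨g', hg', hfg'⟩ := pols N _ hfg
  choose v hv hfv using fun w => exists_low_succ_right (hfg' w)
  refine ⟨g + g', fun i w => v w i, fun w => ⟨N + 1, add_mem (low_mono (by omega) (by omega) (hg w))
    (low_mono le_rfl (by omega) (hg' w))⟩, fun i w => hv w i, ?_⟩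
  ext w
  have h0 : ∀ x ∈ low R t c I 0 0, x = 0 := by
    intro x hx
    have : low R t c I 0 0 = ⊥ := by
      rw [low, Submodule.span_eq_bot]
      rintro x (⟨k, hk, rfl⟩ | ⟨i, hi, s, hs, rfl⟩) <;> omega
    rw [this] at hx
    exact hx
  have := h0 _ (hfv w)
  simp only [Pi.sub_apply, zero_add, pow_one] at this
  simp only [fib_add, Pi.add_apply, Finset.sum_apply, Pi.smul_apply, smul_eq_mul]
  linear_combination this

/-- A function whose derivative has only simple poles is constant along the fibre. -/
lemma FiberData.mem_of_fib_mem (h : FiberData R δ t c I) (hQ : Nonres I Q) {N : ℕ}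
    {f : κ → K} (hf : ∀ w, f w ∈ low R t c I N N)
    (hfib : ∀ w, fib δ t c I Q f w ∈ low R t c I 0 1) (w : κ) : f w ∈ R := by
  have poles : ∀ q p, (∀ w, f w ∈ low R t c I p q) → ∀ w, f w ∈ low R t c I p 0 := by
    intro q p
    induction q with
    | zero => exact id
    | succ q ih =>
      intro hf
      apply ih
      choose v hv hfv using fun w => exists_low_succ_right (hf w)
      have h1 : ∀ w, fib δ t c I Q (f - ∑ i ∈ I, ((t - c i)⁻¹) ^ (q + 1) • fun w => v w i) w
          ∈ low R t c I p (q + 1) :=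
        h.fib_mem_low fun w => by
          refine low_mono (Nat.le_succ p) le_rfl ?_
          simpa using hfv w
      have h2 : ∀ i ∈ I, (fun w => v w i) = 0 := by
        intro i hi
        apply eq_zero_of_act_eq_zero (hQ.finite i hi q)
        ext w
        refine h.eq_zero_of_sum_inv_pow_mem (p := p) (N := q + 1)
          (w := fun i => act (Q i - ((q + 1 : ℕ) : Matrix κ κ ℂ)) (fun w => v w i) w)
          (fun i => act_mem _ (fun w => hv w i) w) ?_ hi
        have h3 : ∑ i ∈ I, (fib δ t c I Q (((t - c i)⁻¹) ^ (q + 1) • fun w => v w i) w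
            - ((t - c i)⁻¹) ^ (q + 2) * act (Q i - ((q + 1 : ℕ) : Matrix κ κ ℂ))
              (fun w => v w i) w) ∈ low R t c I p (q + 1) :=
          sum_mem fun i hi => low_mono (Nat.zero_le p) le_rfl
            (h.fib_inv_pow (Q := Q) hi q (fun w => hv w i) w)
        have := sub_mem (sub_mem (low_mono (Nat.zero_le p) (by omega) (hfib w)) (h1 w)) h3
        convert this using 1
        simp only [fib_sub, fib_sum, Pi.sub_apply, Finset.sum_apply, Finset.sum_sub_distrib]
        ring
      intro w
      have := hfv w
      rwa [Finset.sum_eq_zero, sub_zero] at this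
      intro i hi
      rw [congrFun (h2 i hi) w, Pi.zero_apply, mul_zero]
  have pols : ∀ p, (∀ w, f w ∈ low R t c I (p + 1) 0) → ∀ w, f w ∈ low R t c I 1 0 := by
    intro p
    induction p with
    | zero => exact id
    | succ p ih =>
      intro hf
      apply ih
      choose v hv hfv using fun w => exists_low_succ_left (hf w)
      have h1 : ∀ w, fib δ t c I Q (f - t ^ (p + 1) • v) w ∈ low R t c I p 1 :=
        h.fib_mem_low hfv
      have h2 : v = 0 := by
        apply eq_zero_of_act_eq_zero (hQ.infinity p)
        ext w
        refine h.eq_zero_of_pow_mul_mem (N := p) (M := 1) (act_mem _ hv w) ?_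
        have := sub_mem (sub_mem (low_mono (Nat.zero_le p) le_rfl (hfib w)) (h1 w))
          (h.fib_pow (Q := Q) p hv w)
        convert this using 1
        simp only [fib_sub, Pi.sub_apply]
        ring
      intro w
      have := hfv w
      rwa [congrFun h2 w, Pi.zero_apply, mul_zero, sub_zero] at this
  exact mem_low_one_zero.1
    (pols N (poles N (N + 1) fun w => low_mono (Nat.le_succ N) le_rfl (hf w)) w)

end Fiber

section Functions

/-- Rational functions in countably many variables. -/
def RatFn : Type := FractionRing (MvPolynomial ℕ ℂ)

noncomputable instance : Field RatFn := inferInstanceAs (Field (FractionRing (MvPolynomial ℕ ℂ)))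

noncomputable instance : Algebra (MvPolynomial ℕ ℂ) RatFn :=
  inferInstanceAs (Algebra (MvPolynomial ℕ ℂ) (FractionRing (MvPolynomial ℕ ℂ)))

noncomputable instance : Algebra ℂ RatFn :=
  inferInstanceAs (Algebra ℂ (FractionRing (MvPolynomial ℕ ℂ)))

instance : IsScalarTower ℂ (MvPolynomial ℕ ℂ) RatFn :=
  inferInstanceAs (IsScalarTower ℂ (MvPolynomial ℕ ℂ) (FractionRing (MvPolynomial ℕ ℂ)))

instance : IsFractionRing (MvPolynomial ℕ ℂ) RatFn :=
  inferInstanceAs (IsFractionRing (MvPolynomial ℕ ℂ) (FractionRing (MvPolynomial ℕ ℂ)))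

instance : CharZero RatFn := charZero_of_injective_algebraMap (algebraMap ℂ RatFn).injective

/-- The variable `X j` as a rational function. -/
noncomputable def var (j : ℕ) : RatFn := algebraMap (MvPolynomial ℕ ℂ) RatFn (MvPolynomial.X j)

/-- The first-order Taylor expansion of polynomials in the direction of `X j`. -/
noncomputable def taylorPoly (j : ℕ) : MvPolynomial ℕ ℂ →ₐ[ℂ] TrivSqZeroExt RatFn RatFn :=
  MvPolynomial.aeval fun i => TrivSqZeroExt.inl (var i) + TrivSqZeroExt.inr (if i = j then 1 else 0)

lemma fst_taylorPoly (j : ℕ) (f : MvPolynomial ℕ ℂ) :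
    (taylorPoly j f).fst = algebraMap _ RatFn f := by
  have : (TrivSqZeroExt.fstHom ℂ RatFn RatFn).comp (taylorPoly j)
      = IsScalarTower.toAlgHom ℂ (MvPolynomial ℕ ℂ) RatFn := by
    ext i
    by_cases h : i = j <;> simp [taylorPoly, var, h]
  exact DFunLike.congr_fun this f

lemma isUnit_taylorPoly (j : ℕ) (f : nonZeroDivisors (MvPolynomial ℕ ℂ)) :
    IsUnit (taylorPoly j f) := by
  rw [TrivSqZeroExt.isUnit_iff_isUnit_fst, fst_taylorPoly]
  exact IsLocalization.map_units RatFn f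

/-- The first-order Taylor expansion of rational functions in the direction of `X j`. -/
noncomputable def taylor (j : ℕ) : RatFn →ₐ[ℂ] TrivSqZeroExt RatFn RatFn :=
  IsLocalization.liftAlgHom (M := nonZeroDivisors (MvPolynomial ℕ ℂ)) (f := taylorPoly j)
    (isUnit_taylorPoly j)

lemma taylor_algebraMap (j : ℕ) (f : MvPolynomial ℕ ℂ) :
    taylor j (algebraMap _ RatFn f) = taylorPoly j f := by
  simp [taylor]

lemma fst_taylor (j : ℕ) (f : RatFn) : (taylor j f).fst = f := by
  have : (TrivSqZeroExt.fstHom ℂ RatFn RatFn).comp (taylor j) = AlgHom.id ℂ RatFn := by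
    apply IsLocalization.algHom_ext (nonZeroDivisors (MvPolynomial ℕ ℂ))
    ext i
    change (taylor j (algebraMap _ RatFn (MvPolynomial.X i))).fst
      = algebraMap _ RatFn (MvPolynomial.X i)
    rw [taylor_algebraMap, fst_taylorPoly]
  exact DFunLike.congr_fun this f

/-- The partial derivative with respect to `X j`. -/
noncomputable def pd (j : ℕ) : Derivation ℂ RatFn RatFn :=
  Derivation.mk' ((TrivSqZeroExt.sndHom RatFn RatFn).restrictScalars ℂ ∘ₗ (taylor j).toLinearMap)
    fun f g => by simp [fst_taylor, mul_comm]

lemma pd_var (i j : ℕ) : pd j (var i) = if i = j then 1 else 0 := by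
  by_cases h : i = j <;> simp [pd, var, taylor_algebraMap, taylorPoly, h]

lemma derivation_eq_zero (D : Derivation ℂ RatFn RatFn) (hD : ∀ i, D (var i) = 0) (f : RatFn) :
    D f = 0 := by
  have hp : ∀ p : MvPolynomial ℕ ℂ, D (algebraMap _ RatFn p) = 0 := by
    intro p
    induction p using MvPolynomial.induction_on with
    | C z =>
      have : algebraMap (MvPolynomial ℕ ℂ) RatFn (MvPolynomial.C z) = algebraMap ℂ RatFn z := by
        rw [IsScalarTower.algebraMap_apply ℂ (MvPolynomial ℕ ℂ) RatFn]
        rfl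
      rw [this, Derivation.map_algebraMap]
    | add p q hp hq => rw [map_add, map_add, hp, hq, add_zero]
    | mul_X p i hp =>
      rw [map_mul, Derivation.leibniz, hp]
      have := hD i
      rw [var] at this
      rw [this, smul_zero, smul_zero, add_zero]
  obtain ⟨p, q, _, rfl⟩ := IsFractionRing.div_surjective (A := MvPolynomial ℕ ℂ) f
  rw [Derivation.leibniz_div, hp, hp, smul_zero, smul_zero, sub_zero, smul_zero]

lemma pd_comm (i j : ℕ) (f : RatFn) : pd i (pd j f) = pd j (pd i f) := by
  have := derivation_eq_zero ⁅pd i, pd j⁆ (fun k => by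
    simp only [Derivation.commutator_apply, pd_var]
    split_ifs <;> simp) f
  rwa [Derivation.commutator_apply, sub_eq_zero] at this

/-- The coordinates of the fibre bundle: `j` itself for `j ≤ ℓ` and a variable otherwise. -/
noncomputable def pt (ℓ j : ℕ) : RatFn := if j ≤ ℓ then (j : RatFn) else var j

lemma pd_pt (ℓ i j : ℕ) : pd j (pt ℓ i) = if ℓ < i ∧ i = j then 1 else 0 := by
  rw [pt]
  split_ifs with h1 h2 h2
  · omega
  · simp
  · rw [pd_var, if_pos h2.2]
  · rw [pd_var, if_neg (by omega)]

lemma pt_ne {ℓ i j : ℕ} (hij : i ≠ j) : pt ℓ i ≠ pt ℓ j := by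
  intro h
  rcases le_or_gt i ℓ with hi | hi
  · rcases le_or_gt j ℓ with hj | hj
    · rw [pt, pt, if_pos hi, if_pos hj] at h
      exact hij (Nat.cast_injective h)
    · have := congrArg (pd j) h
      rw [pd_pt, pd_pt, if_neg (by omega), if_pos ⟨hj, rfl⟩] at this
      exact zero_ne_one this
  · have := congrArg (pd i) h
    rw [pd_pt, pd_pt, if_pos ⟨hi, rfl⟩, if_neg (by omega)] at this
    exact one_ne_zero this

/-- Regular functions on the complement of the arrangement in the first `m` coordinates. -/
noncomputable def reg (ℓ m : ℕ) : Subalgebra ℂ RatFn :=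
  Algebra.adjoin ℂ ({x | ∃ j, 1 ≤ j ∧ j ≤ m ∧ x = pt ℓ j} ∪
    {x | ∃ i j, 1 ≤ i ∧ i < j ∧ j ≤ m ∧ x = (pt ℓ j - pt ℓ i)⁻¹})

lemma pt_mem_reg {ℓ m j : ℕ} (hj : 1 ≤ j) (hjm : j ≤ m) : pt ℓ j ∈ reg ℓ m :=
  Algebra.subset_adjoin (Or.inl ⟨j, hj, hjm, rfl⟩)

lemma inv_mem_reg {ℓ m i j : ℕ} (hi : 1 ≤ i) (him : i ≤ m) (hj : 1 ≤ j) (hjm : j ≤ m) :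
    (pt ℓ i - pt ℓ j)⁻¹ ∈ reg ℓ m := by
  rcases lt_trichotomy i j with h | rfl | h
  · have : (pt ℓ j - pt ℓ i)⁻¹ ∈ reg ℓ m :=
      Algebra.subset_adjoin (Or.inr ⟨i, j, hi, h, hjm, rfl⟩)
    rw [← neg_sub, inv_neg]
    exact neg_mem this
  · simp
  · exact Algebra.subset_adjoin (Or.inr ⟨j, i, hj, h, him, rfl⟩)

lemma reg_mono {ℓ m m' : ℕ} (h : m ≤ m') : reg ℓ m ≤ reg ℓ m' := by
  apply Algebra.adjoin_le
  rintro x (⟨j, hj, hjm, rfl⟩ | ⟨i, j, hi, hij, hjm, rfl⟩)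
  · exact pt_mem_reg hj (by omega)
  · exact inv_mem_reg (by omega) (by omega) hi (by omega)

lemma reg_base (ℓ : ℕ) : reg ℓ ℓ = ⊥ := by
  rw [eq_bot_iff]
  have hpt : ∀ j, j ≤ ℓ → pt ℓ j = algebraMap ℂ RatFn j := fun j hj => by
    rw [pt, if_pos hj, map_natCast]
  apply Algebra.adjoin_le
  rintro x (⟨j, hj, hjm, rfl⟩ | ⟨i, j, hi, hij, hjm, rfl⟩)
  · rw [hpt j hjm]
    exact Subalgebra.algebraMap_mem _ _
  · rw [hpt j hjm, hpt i (by omega), ← map_sub, ← map_inv₀]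
    exact Subalgebra.algebraMap_mem _ _

lemma pd_eq_zero {ℓ m j : ℕ} (hj : m < j) {f : RatFn} (hf : f ∈ reg ℓ m) : pd j f = 0 := by
  have hpt : ∀ i, i ≤ m → pd j (pt ℓ i) = 0 := fun i hi => by
    rw [pd_pt, if_neg (by omega)]
  induction hf using Algebra.adjoin_induction with
  | mem x hx =>
    rcases hx with ⟨i, hi, him, rfl⟩ | ⟨i, k, hi, hik, hkm, rfl⟩
    · exact hpt i him
    · rw [Derivation.leibniz_inv, map_sub, hpt k hkm, hpt i (by omega), sub_zero, smul_zero]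
  | algebraMap z => exact Derivation.map_algebraMap _ _
  | add x y _ _ hx hy => rw [map_add, hx, hy, add_zero]
  | mul x y _ _ hx hy => rw [Derivation.leibniz, hx, hy, smul_zero, smul_zero, add_zero]

lemma pd_mem_reg {ℓ m : ℕ} (j : ℕ) {f : RatFn} (hf : f ∈ reg ℓ m) : pd j f ∈ reg ℓ m := by
  have hpt : ∀ i, pd j (pt ℓ i) ∈ reg ℓ m := fun i => by
    rw [pd_pt]
    split_ifs
    exacts [one_mem _, zero_mem _]
  induction hf using Algebra.adjoin_induction with
  | mem x hx =>
    rcases hx with ⟨i, hi, him, rfl⟩ | ⟨i, k, hi, hik, hkm, rfl⟩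
    · exact hpt i
    · rw [Derivation.leibniz_inv, smul_eq_mul, map_sub]
      exact mul_mem (neg_mem (pow_mem (inv_mem_reg (by omega) hkm hi (by omega)) 2))
        (sub_mem (hpt k) (hpt i))
  | algebraMap z => rw [Derivation.map_algebraMap]; exact zero_mem _
  | add x y _ _ hx hy => rw [map_add]; exact add_mem hx hy
  | mul x y hx' hy' hx hy =>
    rw [Derivation.leibniz]
    exact add_mem (mul_mem hx' hy) (mul_mem hy' hx)

lemma fiberData {ℓ m : ℕ} (hm : ℓ ≤ m) :
    FiberData (reg ℓ m) (pd (m + 1)) (pt ℓ (m + 1)) (pt ℓ) (Finset.Icc 1 m) where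
  deriv_coord := by rw [pd_pt, if_pos ⟨by omega, rfl⟩]
  deriv_const r hr := pd_eq_zero (Nat.lt_succ_self m) hr
  point_mem i hi := pt_mem_reg (Finset.mem_Icc.1 hi).1 (Finset.mem_Icc.1 hi).2
  inv_mem i hi j hj := inv_mem_reg (Finset.mem_Icc.1 hi).1 (Finset.mem_Icc.1 hi).2
    (Finset.mem_Icc.1 hj).1 (Finset.mem_Icc.1 hj).2
  point_ne i _ j _ hij := pt_ne hij

lemma mem_reg_succ_iff {ℓ m : ℕ} (hm : ℓ ≤ m) {f : RatFn} :
    f ∈ reg ℓ (m + 1) ↔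
      ∃ N, f ∈ low (reg ℓ m) (pt ℓ (m + 1)) (pt ℓ) (Finset.Icc 1 m) N N := by
  constructor
  · intro hf
    refine (fiberData hm).exists_mem_low ?_ hf
    rintro x (⟨j, hj, hjm, rfl⟩ | ⟨i, j, hi, hij, hjm, rfl⟩)
    · rcases Nat.lt_succ_iff_lt_or_eq.1 (Nat.lt_succ_of_le hjm) with h | rfl
      · exact Or.inl (pt_mem_reg hj (by omega))
      · exact Or.inr (Or.inl rfl)
    · rcases Nat.lt_succ_iff_lt_or_eq.1 (Nat.lt_succ_of_le hjm) with h | rfl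
      · exact Or.inl (inv_mem_reg (by omega) (by omega) hi (by omega))
      · exact Or.inr (Or.inr ⟨i, Finset.mem_Icc.2 ⟨hi, by omega⟩, rfl⟩)
  · rintro ⟨N, hN⟩
    refine low_le_of_subalgebra (reg_mono (Nat.le_succ m)) (pt_mem_reg (by omega) le_rfl) ?_ hN
    intro i hi
    exact inv_mem_reg (by omega) le_rfl (Finset.mem_Icc.1 hi).1
      ((Finset.mem_Icc.1 hi).2.trans (Nat.le_succ m))

end Functions

section Forms

variable {M M' : Type*} [AddCommGroup M] [Module RatFn M] [AddCommGroup M'] [Module RatFn M']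

/-- Differential forms with values in `M`: the coefficient of `∏ s ∈ S, dx s` for every `S`. -/
abbrev Form (M : Type*) : Type _ := Finset ℕ → M

/-- Left multiplication by `dx j`. -/
noncomputable def eps (j : ℕ) : Form M →ₗ[RatFn] Form M where
  toFun x S := if j ∈ S then (-1 : RatFn) ^ (S.filter (j < ·)).card • x (S.erase j) else 0
  map_add' x y := by ext S; dsimp only [Pi.add_apply]; split_ifs <;> simp
  map_smul' z x := by
    ext S
    dsimp only [Pi.smul_apply, RingHom.id_apply]
    split_ifs
    · rw [smul_comm]
    · simp

lemma eps_apply (j : ℕ) (x : Form M) (S : Finset ℕ) : eps j x S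
    = if j ∈ S then (-1 : RatFn) ^ (S.filter (j < ·)).card • x (S.erase j) else 0 := rfl

lemma eps_self (j : ℕ) (x : Form M) : eps j (eps j x) = 0 := by
  ext S
  simp [eps_apply]

lemma eps_anticomm (i j : ℕ) (x : Form M) : eps i (eps j x) = -eps j (eps i x) := by
  have key : ∀ i j : ℕ, i < j → ∀ S : Finset ℕ, eps i (eps j x) S = -eps j (eps i x) S := by
    intro i j hij S
    by_cases hi : i ∈ S
    · by_cases hj : j ∈ S
      · have h1 : ((S.erase i).filter (j < ·)).card = (S.filter (j < ·)).card := by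
          congr 1
          ext s
          simp only [Finset.mem_filter, Finset.mem_erase]
          exact ⟨fun h => ⟨h.1.2, h.2⟩, fun h => ⟨⟨by omega, h.1⟩, h.2⟩⟩
        have h2 : (S.filter (i < ·)).card = ((S.erase j).filter (i < ·)).card + 1 := by
          have : (S.erase j).filter (i < ·) = (S.filter (i < ·)).erase j := by
            ext s
            simp only [Finset.mem_filter, Finset.mem_erase]
            tauto
          rw [this, Finset.card_erase_add_one (Finset.mem_filter.2 ⟨hj, hij⟩)]
        simp only [eps_apply, hi, hj, Finset.mem_erase, ne_eq, hij.ne, hij.ne', not_false_eq_true,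
          true_and, if_true, h1, h2, smul_smul, Finset.erase_right_comm (a := i)]
        rw [← neg_smul]
        congr 1
        ring
      · simp [eps_apply, hj]
    · simp [eps_apply, hi]
  rcases lt_trichotomy i j with h | rfl | h
  · exact funext (key i j h)
  · simp [eps_self]
  · rw [eq_neg_iff_add_eq_zero, add_comm, ← eq_neg_iff_add_eq_zero]
    exact funext (key j i h)

/-- The sign involution. -/
noncomputable def sgn : Form M →ₗ[RatFn] Form M where
  toFun x S := (-1 : RatFn) ^ S.card • x S
  map_add' x y := by ext S; simp
  map_smul' z x := by
    ext S
    dsimp only [Pi.smul_apply, RingHom.id_apply]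
    rw [smul_comm]

lemma sgn_apply (x : Form M) (S : Finset ℕ) : sgn x S = (-1 : RatFn) ^ S.card • x S := rfl

lemma sgn_sgn (x : Form M) : sgn (sgn x) = x := by
  ext S
  rw [sgn_apply, sgn_apply, smul_smul, ← mul_pow]
  simp

lemma sgn_eps (j : ℕ) (x : Form M) : sgn (eps j x) = -eps j (sgn x) := by
  ext S
  by_cases hj : j ∈ S
  · simp only [sgn_apply, eps_apply, Pi.neg_apply, hj, if_true, smul_smul,
      ← Finset.card_erase_add_one hj]
    rw [← neg_smul]
    congr 1
    ring
  · simp [sgn_apply, eps_apply, hj]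

/-- Coefficientwise application of a linear map. -/
noncomputable def mapForm (L : M →ₗ[RatFn] M') : Form M →ₗ[RatFn] Form M' where
  toFun x S := L (x S)
  map_add' x y := by ext S; simp
  map_smul' z x := by ext S; simp

lemma mapForm_apply (L : M →ₗ[RatFn] M') (x : Form M) (S : Finset ℕ) :
    mapForm L x S = L (x S) := rfl

lemma mapForm_eps (L : M →ₗ[RatFn] M') (j : ℕ) (x : Form M) :
    mapForm L (eps j x) = eps j (mapForm L x) := by
  ext S
  simp only [mapForm_apply, eps_apply]
  split_ifs <;> simp

lemma mapForm_sgn (L : M →ₗ[RatFn] M') (x : Form M) :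
    mapForm L (sgn x) = sgn (mapForm L x) := by
  ext S
  simp [mapForm_apply, sgn_apply]

/-- `eps j` for the variables, zero for the constants. -/
noncomputable def epsVar (ℓ j : ℕ) : Form M →ₗ[RatFn] Form M := if ℓ < j then eps j else 0

lemma epsVar_self (ℓ j : ℕ) (x : Form M) : epsVar ℓ j (epsVar ℓ j x) = 0 := by
  rw [epsVar]
  split_ifs
  · exact eps_self j x
  · rfl

lemma epsVar_anticomm (ℓ i j : ℕ) (x : Form M) :
    epsVar ℓ i (epsVar ℓ j x) = -epsVar ℓ j (epsVar ℓ i x) := by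
  rw [epsVar, epsVar]
  split_ifs
  · exact eps_anticomm i j x
  all_goals simp

lemma sgn_epsVar (ℓ j : ℕ) (x : Form M) : sgn (epsVar ℓ j x) = -epsVar ℓ j (sgn x) := by
  rw [epsVar]
  split_ifs
  · exact sgn_eps j x
  · simp

lemma mapForm_epsVar (L : M →ₗ[RatFn] M') (ℓ j : ℕ) (x : Form M) :
    mapForm L (epsVar ℓ j x) = epsVar ℓ j (mapForm L x) := by
  rw [epsVar, epsVar]
  split_ifs
  · exact mapForm_eps L j x
  · simp

/-- Multiplication by the logarithmic form `d log (x i - x j)`. -/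
noncomputable def dlog (ℓ i j : ℕ) : Form M →ₗ[RatFn] Form M :=
  (pt ℓ i - pt ℓ j)⁻¹ • (epsVar ℓ i - epsVar ℓ j)

lemma dlog_apply (ℓ i j : ℕ) (x : Form M) :
    dlog ℓ i j x = (pt ℓ i - pt ℓ j)⁻¹ • (epsVar ℓ i x - epsVar ℓ j x) := rfl

lemma dlog_self (ℓ i : ℕ) (x : Form M) : dlog ℓ i i x = 0 := by simp [dlog_apply]

lemma dlog_symm (ℓ i j : ℕ) (x : Form M) : dlog ℓ i j x = dlog ℓ j i x := by
  rw [dlog_apply, dlog_apply, ← neg_sub (pt ℓ j), inv_neg, neg_smul, ← smul_neg, neg_sub]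

lemma dlog_eq_zero {ℓ i j : ℕ} (hi : i ≤ ℓ) (hj : j ≤ ℓ) (x : Form M) : dlog ℓ i j x = 0 := by
  simp [dlog_apply, epsVar, hi.not_gt, hj.not_gt]

lemma dlog_anticomm (ℓ i j k l : ℕ) (x : Form M) :
    dlog ℓ i j (dlog ℓ k l x) = -dlog ℓ k l (dlog ℓ i j x) := by
  simp only [dlog_apply, map_smul, map_sub]
  rw [epsVar_anticomm ℓ k i, epsVar_anticomm ℓ l i, epsVar_anticomm ℓ k j, epsVar_anticomm ℓ l j]
  module

lemma dlog_dlog_self (ℓ i j : ℕ) (x : Form M) : dlog ℓ i j (dlog ℓ i j x) = 0 := by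
  simp only [dlog_apply, map_smul, map_sub, epsVar_self]
  rw [epsVar_anticomm ℓ j i]
  simp

/-- The Arnold relation. -/
lemma dlog_arnold (ℓ i j k : ℕ) (x : Form M) :
    dlog ℓ j k (dlog ℓ i k x) = dlog ℓ i j (dlog ℓ i k x - dlog ℓ j k x) := by
  rcases eq_or_ne i j with rfl | hij
  · simp [dlog_dlog_self]
  rcases eq_or_ne i k with rfl | hik
  · simp only [dlog_self, map_zero, zero_sub, map_neg]
    rw [dlog_symm ℓ i j, dlog_dlog_self, neg_zero]
  rcases eq_or_ne j k with rfl | hjk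
  · simp only [dlog_self, sub_zero, dlog_dlog_self]
  have h1 := sub_ne_zero.2 (pt_ne (ℓ := ℓ) hij)
  have h2 := sub_ne_zero.2 (pt_ne (ℓ := ℓ) hik)
  have h3 := sub_ne_zero.2 (pt_ne (ℓ := ℓ) hjk)
  simp only [dlog_apply, map_smul, map_sub, epsVar_self, smul_sub]
  rw [epsVar_anticomm ℓ j i, epsVar_anticomm ℓ k i]
  match_scalars <;> field_simp <;> ring

lemma sgn_dlog (ℓ i j : ℕ) (x : Form M) : sgn (dlog ℓ i j x) = -dlog ℓ i j (sgn x) := by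
  simp only [dlog_apply, map_smul, map_sub, sgn_epsVar, ← smul_neg]
  congr 1
  abel

lemma mapForm_dlog (L : M →ₗ[RatFn] M') (ℓ i j : ℕ) (x : Form M) :
    mapForm L (dlog ℓ i j x) = dlog ℓ i j (mapForm L x) := by
  simp only [dlog_apply, map_smul, map_sub, mapForm_epsVar]

end Forms

section Differential

variable {κ : Type*}

/-- Coefficientwise partial derivative. -/
noncomputable def pdForm (j : ℕ) : Form (κ → RatFn) →ₗ[ℂ] Form (κ → RatFn) where
  toFun x S w := pd j (x S w)
  map_add' x y := by ext S w; simp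
  map_smul' z x := by ext S w; simp

lemma pdForm_apply (j : ℕ) (x : Form (κ → RatFn)) (S : Finset ℕ) (w : κ) :
    pdForm j x S w = pd j (x S w) := rfl

lemma pdForm_smul (j : ℕ) (f : RatFn) (x : Form (κ → RatFn)) :
    pdForm j (f • x) = f • pdForm j x + pd j f • x := by
  ext S w
  simp only [pdForm_apply, Pi.smul_apply, Pi.add_apply, Derivation.leibniz, smul_eq_mul]
  ring

lemma pdForm_comm (i j : ℕ) (x : Form (κ → RatFn)) :
    pdForm i (pdForm j x) = pdForm j (pdForm i x) := by
  ext S w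
  exact pd_comm i j _

lemma pdForm_eps (i j : ℕ) (x : Form (κ → RatFn)) : pdForm i (eps j x) = eps j (pdForm i x) := by
  ext S w
  simp only [pdForm_apply, eps_apply]
  split_ifs
  · simp [pdForm_apply]
  · simp

lemma pdForm_epsVar (ℓ i j : ℕ) (x : Form (κ → RatFn)) :
    pdForm i (epsVar ℓ j x) = epsVar ℓ j (pdForm i x) := by
  unfold epsVar
  split_ifs
  · exact pdForm_eps i j x
  · simp

lemma pdForm_sgn (j : ℕ) (x : Form (κ → RatFn)) : pdForm j (sgn x) = sgn (pdForm j x) := by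
  ext S w
  simp [pdForm_apply, sgn_apply]

/-- The exterior derivative in the variables `x j` with `ℓ < j ≤ n`. -/
noncomputable def extd (ℓ n : ℕ) : Form (κ → RatFn) →ₗ[ℂ] Form (κ → RatFn) :=
  ∑ j ∈ Finset.Ioc ℓ n, (eps j).restrictScalars ℂ ∘ₗ pdForm j

lemma extd_apply (ℓ n : ℕ) (x : Form (κ → RatFn)) :
    extd ℓ n x = ∑ j ∈ Finset.Ioc ℓ n, eps j (pdForm j x) := by
  simp [extd]

lemma extd_smul (ℓ n : ℕ) (f : RatFn) (x : Form (κ → RatFn)) :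
    extd ℓ n (f • x) = f • extd ℓ n x + ∑ j ∈ Finset.Ioc ℓ n, pd j f • eps j x := by
  simp only [extd_apply, pdForm_smul, map_add, map_smul, Finset.sum_add_distrib, Finset.smul_sum]

lemma extd_sgn (ℓ n : ℕ) (x : Form (κ → RatFn)) : extd ℓ n (sgn x) = -sgn (extd ℓ n x) := by
  simp only [extd_apply, pdForm_sgn, map_sum, sgn_eps, Finset.sum_neg_distrib, neg_neg]

lemma extd_epsVar (ℓ n j : ℕ) (x : Form (κ → RatFn)) :
    extd ℓ n (epsVar ℓ j x) = -epsVar ℓ j (extd ℓ n x) := by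
  rw [extd_apply, extd_apply, map_sum, ← Finset.sum_neg_distrib]
  refine Finset.sum_congr rfl fun i hi => ?_
  rw [pdForm_epsVar, epsVar]
  split_ifs
  · exact eps_anticomm _ _ _
  · simp

lemma extd_extd (ℓ n : ℕ) (x : Form (κ → RatFn)) : extd ℓ n (extd ℓ n x) = 0 := by
  have h : extd ℓ n (extd ℓ n x) = -extd ℓ n (extd ℓ n x) := by
    simp only [extd_apply, map_sum, pdForm_eps]
    conv_lhs => rw [Finset.sum_comm]
    simp only [← Finset.sum_neg_distrib]
    refine Finset.sum_congr rfl fun i _ => Finset.sum_congr rfl fun j _ => ?_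
    rw [pdForm_comm, eps_anticomm]
  have := self_eq_neg.1 h
  exact this

lemma sum_pd_inv_smul_eps {ℓ n i j : ℕ} (hi : i ≤ n) (hj : j ≤ n) (x : Form (κ → RatFn)) :
    ∑ k ∈ Finset.Ioc ℓ n, pd k ((pt ℓ i - pt ℓ j)⁻¹) • eps k x
      = -(((pt ℓ i - pt ℓ j)⁻¹) ^ 2 • (epsVar ℓ i x - epsVar ℓ j x)) := by
  have h : ∀ i ≤ n, ∑ k ∈ Finset.Ioc ℓ n, pd k (pt ℓ i) • eps k x = epsVar ℓ i x := by
    intro i hi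
    rw [epsVar]
    split_ifs with h
    · rw [Finset.sum_eq_single i]
      · simp [pd_pt, h]
      · intro k _ hk
        simp [pd_pt, hk.symm]
      · intro hi'
        exact absurd (Finset.mem_Ioc.2 ⟨h, hi⟩) hi'
    · refine Finset.sum_eq_zero fun k _ => ?_
      simp [pd_pt, h]
  rw [← h i hi, ← h j hj, ← Finset.sum_sub_distrib, Finset.smul_sum, ← Finset.sum_neg_distrib]
  refine Finset.sum_congr rfl fun k _ => ?_
  rw [Derivation.leibniz_inv, map_sub, ← sub_smul, smul_smul, ← neg_smul, smul_eq_mul, neg_mul]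

lemma extd_dlog {ℓ n i j : ℕ} (hi : i ≤ n) (hj : j ≤ n) (x : Form (κ → RatFn)) :
    extd ℓ n (dlog ℓ i j x) = -dlog ℓ i j (extd ℓ n x) := by
  rw [dlog_apply, extd_smul, sum_pd_inv_smul_eps hi hj, map_sub, extd_epsVar, extd_epsVar,
    dlog_apply]
  simp only [map_sub, epsVar_self]
  rw [epsVar_anticomm ℓ j i]
  simp only [zero_sub, sub_zero, sub_self, smul_zero, neg_zero, add_zero, ← smul_neg]
  simp only [neg_sub, sub_neg_eq_add]
  congr 1
  abel

end Differential

section Slices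

variable {K : Type*} [Field K] {κ : Type*} {m : ℕ}

/-- The component with index `k` of a vector made of `m + 1` blocks. -/
noncomputable def slice (k : ℕ) : (Fin (m + 1) × κ → K) →ₗ[K] (κ → K) where
  toFun g w := if h : k < m + 1 then g (⟨k, h⟩, w) else 0
  map_add' f g := by ext w; by_cases h : k < m + 1 <;> simp [h]
  map_smul' z g := by ext w; by_cases h : k < m + 1 <;> simp [h]

lemma slice_apply {k : ℕ} (h : k < m + 1) (g : Fin (m + 1) × κ → K) (w : κ) :
    slice k g w = g (⟨k, h⟩, w) := by simp [slice, h]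

lemma slice_ext {f g : Fin (m + 1) × κ → K} (h0 : slice 0 f = slice 0 g)
    (h : ∀ i ∈ Finset.Icc 1 m, slice i f = slice i g) : f = g := by
  ext ⟨⟨k, hk⟩, w⟩
  rcases Nat.eq_zero_or_pos k with rfl | hpos
  · simpa only [slice_apply hk] using congrFun h0 w
  · simpa only [slice_apply hk] using
      congrFun (h k (Finset.mem_Icc.2 ⟨hpos, by omega⟩)) w

variable [Algebra ℂ K] [Fintype κ]

/-- The block matrix sending the block `i` by `Q`, scaled by `c`, to all the blocks. -/
def blk (c : ℕ → ℂ) (i : ℕ) (Q : Matrix κ κ ℂ) : Matrix (Fin (m + 1) × κ) (Fin (m + 1) × κ) ℂ :=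
  fun u v => if (v.1 : ℕ) = i then c u.1 * Q u.2 v.2 else 0

lemma slice_act_blk {k : ℕ} (hk : k < m + 1) (c : ℕ → ℂ) {i : ℕ} (hi : i < m + 1)
    (Q : Matrix κ κ ℂ) (g : Fin (m + 1) × κ → K) :
    slice k (act (blk c i Q) g) = c k • act Q (slice i g) := by
  ext w
  rw [slice_apply hk, act_apply, Fintype.sum_prod_type, Pi.smul_apply, act_apply,
    Finset.sum_eq_single (⟨i, hi⟩ : Fin (m + 1))]
  · simp only [blk, if_true, slice_apply hi, Finset.smul_sum, smul_smul]
  · intro b _ hb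
    refine Finset.sum_eq_zero fun v _ => ?_
    have : (b : ℕ) ≠ i := fun h => hb (Fin.ext h)
    simp [blk, this]
  · simp

/-- The residue matrices on the fibre cohomology. -/
noncomputable def nextRes (P : ℕ → ℕ → Matrix κ κ ℂ) (m i j : ℕ) :
    Matrix (Fin (m + 1) × κ) (Fin (m + 1) × κ) ℂ :=
  ∑ k ∈ Finset.range (m + 1), blk (Pi.single k 1) k (P i j)
    + (blk (Pi.single i 1 - Pi.single j 1) i (P j (m + 1))
      - blk (Pi.single i 1 - Pi.single j 1) j (P i (m + 1)))

/-- The constant part of the connection on the fibre cohomology. -/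
noncomputable def nextConst (P : ℕ → ℕ → Matrix κ κ ℂ) (D : Matrix κ κ ℂ) (m : ℕ) :
    Matrix (Fin (m + 1) × κ) (Fin (m + 1) × κ) ℂ :=
  blk (Pi.single 0 1) 0 D + ∑ k ∈ Finset.Icc 1 m,
    ((2 : ℂ) • blk (Pi.single k 1) 0 (P k (m + 1)) - blk (Pi.single k 1) k D)

lemma slice_nextRes (P : ℕ → ℕ → Matrix κ κ ℂ) {i j k : ℕ} (hi : i < m + 1) (hj : j < m + 1)
    (hk : k < m + 1) (g : Fin (m + 1) × κ → K) :
    slice k (act (nextRes P m i j) g) = act (P i j) (slice k g)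
      + ((if k = i then 1 else 0) - (if k = j then 1 else 0) : ℂ)
        • (act (P j (m + 1)) (slice i g) - act (P i (m + 1)) (slice j g)) := by
  rw [nextRes, act_add, act_sub, act_sum, map_add, map_sub, map_sum, slice_act_blk hk _ hi,
    slice_act_blk hk _ hj, smul_sub]
  congr 1
  · rw [Finset.sum_congr rfl fun l hl => slice_act_blk hk _ (Finset.mem_range.1 hl) _ g,
      Finset.sum_eq_single k]
    · simp
    · intro l _ hl
      simp [hl.symm]
    · intro h
      exact absurd (Finset.mem_range.2 hk) h
  · simp [Pi.single_apply]

lemma slice_zero_nextConst (P : ℕ → ℕ → Matrix κ κ ℂ) (D : Matrix κ κ ℂ)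
    (g : Fin (m + 1) × κ → K) : slice 0 (act (nextConst P D m) g) = act D (slice 0 g) := by
  rw [nextConst, act_add, act_sum, map_add, map_sum, slice_act_blk m.succ_pos _ m.succ_pos,
    Finset.sum_eq_zero]
  · simp
  · intro k hk
    have hk := Finset.mem_Icc.1 hk
    rw [act_sub, act_smul, map_sub, LinearMap.map_smul_of_tower,
      slice_act_blk m.succ_pos _ m.succ_pos, slice_act_blk m.succ_pos _ (by omega)]
    have : (0 : ℕ) ≠ k := by omega
    simp [this]

lemma slice_nextConst (P : ℕ → ℕ → Matrix κ κ ℂ) (D : Matrix κ κ ℂ) {i : ℕ}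
    (hi : i ∈ Finset.Icc 1 m) (g : Fin (m + 1) × κ → K) :
    slice i (act (nextConst P D m) g)
      = (2 : ℂ) • act (P i (m + 1)) (slice 0 g) - act D (slice i g) := by
  have hi' := Finset.mem_Icc.1 hi
  have hi1 : i < m + 1 := by omega
  rw [nextConst, act_add, act_sum, map_add, map_sum, slice_act_blk hi1 _ m.succ_pos,
    Finset.sum_eq_single i]
  · have : i ≠ 0 := by omega
    rw [act_sub, act_smul, map_sub, LinearMap.map_smul_of_tower,
      slice_act_blk hi1 _ m.succ_pos, slice_act_blk hi1 _ hi1]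
    simp [this]
  · intro k hk hki
    have hk := Finset.mem_Icc.1 hk
    rw [act_sub, act_smul, map_sub, LinearMap.map_smul_of_tower,
      slice_act_blk hi1 _ m.succ_pos, slice_act_blk hi1 _ (by omega)]
    simp [hki.symm]
  · exact fun h => absurd hi h

end Slices

section Connection

variable {κ : Type*}

/-- The component with index `k` of a form with values in vectors made of blocks. -/
noncomputable abbrev sliceForm {m : ℕ} (k : ℕ) :
    Form (Fin (m + 1) × κ → RatFn) →ₗ[RatFn] Form (κ → RatFn) := mapForm (slice k)

/-- Integration of the fibre cohomology classes to forms. -/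
noncomputable def theta (ℓ m : ℕ) :
    Form (Fin (m + 1) × κ → RatFn) →ₗ[RatFn] Form (κ → RatFn) :=
  sliceForm 0 + ∑ i ∈ Finset.Icc 1 m, dlog ℓ i (m + 1) ∘ₗ sgn ∘ₗ sliceForm i

lemma theta_apply (ℓ m : ℕ) (x : Form (Fin (m + 1) × κ → RatFn)) : theta ℓ m x = sliceForm 0 x
    + ∑ i ∈ Finset.Icc 1 m, dlog ℓ i (m + 1) (sgn (sliceForm i x)) := by
  simp [theta]

lemma theta_dlog (ℓ m i j : ℕ) (x : Form (Fin (m + 1) × κ → RatFn)) :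
    theta ℓ m (dlog ℓ i j x) = dlog ℓ i j (theta ℓ m x) := by
  simp only [theta_apply, map_add, map_sum, mapForm_dlog, sgn_dlog, map_neg]
  congr 1
  refine Finset.sum_congr rfl fun k _ => ?_
  rw [dlog_anticomm, neg_neg]

lemma sliceForm_extd (ℓ n k : ℕ) {m : ℕ} (x : Form (Fin (m + 1) × κ → RatFn)) :
    sliceForm k (extd ℓ n x) = extd ℓ n (sliceForm k x) := by
  have h : ∀ j, sliceForm k (pdForm j x) = pdForm j (sliceForm k x) := by
    intro j
    ext S w
    by_cases hk : k < m + 1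
    · simp only [mapForm_apply, pdForm_apply, slice_apply hk]
    · simp [mapForm_apply, pdForm_apply, slice, hk]
  simp only [extd_apply, map_sum, mapForm_eps, h]

lemma theta_extd {ℓ n m : ℕ} (hm : m + 1 ≤ n) (x : Form (Fin (m + 1) × κ → RatFn)) :
    theta ℓ m (extd ℓ n x) = extd ℓ n (theta ℓ m x) := by
  simp only [theta_apply, map_add, map_sum, sliceForm_extd]
  congr 1
  refine Finset.sum_congr rfl fun k hk => ?_
  have hk := Finset.mem_Icc.1 hk
  rw [extd_dlog (by omega) hm, extd_sgn, map_neg, neg_neg]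

variable [Fintype κ]

/-- The logarithmic connection with residues `2 • P i j` and constant part `D`. -/
noncomputable def conn (ℓ n m : ℕ) (P : ℕ → ℕ → Matrix κ κ ℂ) (D : Matrix κ κ ℂ) :
    Form (κ → RatFn) →ₗ[ℂ] Form (κ → RatFn) :=
  extd ℓ n + ((∑ i ∈ Finset.Icc 1 m, ∑ j ∈ Finset.Icc 1 m, dlog ℓ i j ∘ₗ mapForm (act (P i j)))
    + sgn ∘ₗ mapForm (act D)).restrictScalars ℂ

lemma conn_apply (ℓ n m : ℕ) (P : ℕ → ℕ → Matrix κ κ ℂ) (D : Matrix κ κ ℂ)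
    (x : Form (κ → RatFn)) : conn ℓ n m P D x = extd ℓ n x
      + (∑ i ∈ Finset.Icc 1 m, ∑ j ∈ Finset.Icc 1 m, dlog ℓ i j (mapForm (act (P i j)) x)
        + sgn (mapForm (act D) x)) := by
  simp [conn]

lemma sliceForm_nextRes (P : ℕ → ℕ → Matrix κ κ ℂ) {m i j k : ℕ} (hi : i < m + 1)
    (hj : j < m + 1) (hk : k < m + 1) (x : Form (Fin (m + 1) × κ → RatFn)) :
    sliceForm k (mapForm (act (nextRes P m i j)) x) = mapForm (act (P i j)) (sliceForm k x)
      + ((if k = i then 1 else 0) - (if k = j then 1 else 0) : ℂ)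
        • (mapForm (act (P j (m + 1))) (sliceForm i x)
          - mapForm (act (P i (m + 1))) (sliceForm j x)) := by
  ext1 S
  exact slice_nextRes P hi hj hk (x S)

lemma sum_dlog_succ {P : ℕ → ℕ → Matrix κ κ ℂ} (hP : ∀ i j, P i j = P j i) (ℓ m : ℕ)
    (y : Form (κ → RatFn)) :
    ∑ i ∈ Finset.Icc 1 (m + 1), ∑ j ∈ Finset.Icc 1 (m + 1), dlog ℓ i j (mapForm (act (P i j)) y)
      = ∑ i ∈ Finset.Icc 1 m, ∑ j ∈ Finset.Icc 1 m, dlog ℓ i j (mapForm (act (P i j)) y)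
        + (2 : ℂ) • ∑ i ∈ Finset.Icc 1 m,
          dlog ℓ i (m + 1) (mapForm (act (P i (m + 1))) y) := by
  rw [Finset.sum_Icc_succ_top (by omega), Finset.sum_Icc_succ_top (by omega), dlog_self, add_zero,
    Finset.sum_congr rfl fun i _ => Finset.sum_Icc_succ_top (by omega) _,
    Finset.sum_add_distrib, add_assoc, two_smul]
  congr 2
  refine Finset.sum_congr rfl fun i _ => ?_
  rw [hP, dlog_symm]

/-- Integration along the fibres intertwines the connections. -/
lemma theta_conn {ℓ n m : ℕ} (hm : m + 1 ≤ n) {P : ℕ → ℕ → Matrix κ κ ℂ}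
    (hP : ∀ i j, P i j = P j i) (D : Matrix κ κ ℂ) (x : Form (Fin (m + 1) × κ → RatFn)) :
    theta ℓ m (conn ℓ n m (nextRes P m) (nextConst P D m) x)
      = conn ℓ n (m + 1) P D (theta ℓ m x) := by
  have hres : ∀ i ∈ Finset.Icc 1 m, ∀ j ∈ Finset.Icc 1 m,
      theta ℓ m (dlog ℓ i j (mapForm (act (nextRes P m i j)) x))
        = dlog ℓ i j (mapForm (act (P i j)) (theta ℓ m x))
          + (dlog ℓ j (m + 1) (dlog ℓ i (m + 1)
              (sgn (mapForm (act (P j (m + 1))) (sliceForm i x))))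
            + dlog ℓ i (m + 1) (dlog ℓ j (m + 1)
              (sgn (mapForm (act (P i (m + 1))) (sliceForm j x))))) := by
    intro i hi j hj
    have hi' := Finset.mem_Icc.1 hi
    have hj' := Finset.mem_Icc.1 hj
    have h0i : ¬ 0 = i := by omega
    have h0j : ¬ 0 = j := by omega
    have hsum : ∀ y : Form (κ → RatFn), ∑ k ∈ Finset.Icc 1 m, dlog ℓ k (m + 1)
        (sgn (((if k = i then 1 else 0) - (if k = j then 1 else 0) : ℂ) • y))
          = dlog ℓ i (m + 1) (sgn y) - dlog ℓ j (m + 1) (sgn y) := by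
      intro y
      have hone : ∀ l ∈ Finset.Icc 1 m, ∑ k ∈ Finset.Icc 1 m, dlog ℓ k (m + 1)
          (sgn ((if k = l then 1 else 0 : ℂ) • y)) = dlog ℓ l (m + 1) (sgn y) := by
        intro l hl
        rw [Finset.sum_eq_single_of_mem l hl]
        · simp
        · intro k _ hk
          simp [hk]
      simp only [sub_smul, map_sub, Finset.sum_sub_distrib, hone i hi, hone j hj]
    rw [theta_dlog, theta_apply, sliceForm_nextRes P (by omega) (by omega) (by omega), if_neg h0i,
      if_neg h0j, sub_zero, zero_smul, add_zero,
      Finset.sum_congr rfl fun k hk => by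
        rw [sliceForm_nextRes P (by omega) (by omega) (by have := Finset.mem_Icc.1 hk; omega),
          map_add, map_add],
      Finset.sum_add_distrib, hsum, theta_apply]
    have hA := dlog_arnold ℓ i j (m + 1) (sgn (mapForm (act (P j (m + 1))) (sliceForm i x)))
    have hB := dlog_arnold ℓ i j (m + 1) (sgn (mapForm (act (P i (m + 1))) (sliceForm j x)))
    rw [dlog_anticomm ℓ j (m + 1) i (m + 1)] at hB
    rw [neg_eq_iff_eq_neg] at hB
    rw [hA, hB]
    simp only [map_add, map_sub, map_sum, mapForm_dlog, mapForm_sgn]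
    abel
  have hconst : theta ℓ m (sgn (mapForm (act (nextConst P D m)) x))
      = sgn (mapForm (act D) (theta ℓ m x))
        + (2 : ℂ) • ∑ i ∈ Finset.Icc 1 m,
          dlog ℓ i (m + 1) (mapForm (act (P i (m + 1))) (sliceForm 0 x)) := by
    have h0 : sliceForm 0 (mapForm (act (nextConst P D m)) x)
        = mapForm (act D) (sliceForm 0 x) := by
      ext1 S
      exact slice_zero_nextConst P D (x S)
    have h1 : ∀ i ∈ Finset.Icc 1 m, sliceForm i (mapForm (act (nextConst P D m)) x)
        = (2 : ℂ) • mapForm (act (P i (m + 1))) (sliceForm 0 x)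
          - mapForm (act D) (sliceForm i x) := by
      intro i hi
      ext1 S
      exact slice_nextConst P D hi (x S)
    rw [theta_apply, theta_apply, mapForm_sgn, h0, map_add, map_add, add_assoc]
    congr 1
    rw [map_sum, map_sum, Finset.smul_sum, ← Finset.sum_add_distrib]
    refine Finset.sum_congr rfl fun i hi => ?_
    rw [mapForm_sgn, h1 i hi, sgn_sgn, map_sub, LinearMap.map_smul_of_tower, mapForm_dlog,
      sgn_dlog, mapForm_sgn, sgn_sgn]
    abel
  rw [conn_apply, conn_apply, map_add, map_add, theta_extd hm, map_sum, hconst, sum_dlog_succ hP,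
    Finset.sum_congr rfl fun i hi => (map_sum _ _ _).trans
      ((Finset.sum_congr rfl fun j hj => hres i hi j hj).trans Finset.sum_add_distrib),
    Finset.sum_add_distrib,
    Finset.sum_congr (s₂ := Finset.Icc 1 m) rfl fun i _ => Finset.sum_add_distrib,
    Finset.sum_add_distrib, Finset.sum_comm (f := fun i j => dlog ℓ j (m + 1) _), ← two_smul ℂ]
  have hlast : ∑ i ∈ Finset.Icc 1 m, dlog ℓ i (m + 1) (mapForm (act (P i (m + 1))) (theta ℓ m x))
      = ∑ i ∈ Finset.Icc 1 m, dlog ℓ i (m + 1) (mapForm (act (P i (m + 1))) (sliceForm 0 x))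
        + ∑ i ∈ Finset.Icc 1 m, ∑ j ∈ Finset.Icc 1 m, dlog ℓ i (m + 1) (dlog ℓ j (m + 1)
          (sgn (mapForm (act (P i (m + 1))) (sliceForm j x)))) := by
    rw [← Finset.sum_add_distrib]
    refine Finset.sum_congr rfl fun i _ => ?_
    simp only [theta_apply, map_add, map_sum, mapForm_dlog, mapForm_sgn]
  rw [hlast, smul_add]
  abel

end Connection

section RegularForms

variable {κ : Type*} {ℓ n m : ℕ}

/-- Forms in the first `m` coordinates whose coefficients are regular on the complement. -/
noncomputable def regForms (ℓ m : ℕ) (κ : Type*) : Submodule ℂ (Form (κ → RatFn)) where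
  carrier := {x | (∀ S w, x S w ∈ reg ℓ m) ∧ ∀ S, ¬ S ⊆ Finset.Ioc ℓ m → x S = 0}
  add_mem' hx hy := ⟨fun S w => add_mem (hx.1 S w) (hy.1 S w),
    fun S hS => by rw [Pi.add_apply, hx.2 S hS, hy.2 S hS, add_zero]⟩
  zero_mem' := ⟨fun S w => zero_mem _, fun S _ => rfl⟩
  smul_mem' z x hx := ⟨fun S w => (reg ℓ m).smul_mem (hx.1 S w) z,
    fun S hS => by rw [Pi.smul_apply, hx.2 S hS, smul_zero]⟩

lemma regForms_mono {m' : ℕ} (h : m ≤ m') : regForms ℓ m κ ≤ regForms ℓ m' κ :=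
  fun _ hx => ⟨fun S w => reg_mono h (hx.1 S w), fun S hS =>
    hx.2 S fun h' => hS (h'.trans (Finset.Ioc_subset_Ioc_right h))⟩

lemma smul_mem_regForms {f : RatFn} (hf : f ∈ reg ℓ m) {x : Form (κ → RatFn)}
    (hx : x ∈ regForms ℓ m κ) : f • x ∈ regForms ℓ m κ :=
  ⟨fun S w => mul_mem hf (hx.1 S w), fun S hS => by rw [Pi.smul_apply, hx.2 S hS, smul_zero]⟩

lemma neg_one_pow_smul_mem {R : Subalgebra ℂ RatFn} (k : ℕ) {f : RatFn} (hf : f ∈ R) :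
    (-1 : RatFn) ^ k * f ∈ R :=
  mul_mem (pow_mem (neg_mem (one_mem _)) _) hf

lemma sgn_mem_regForms {x : Form (κ → RatFn)} (hx : x ∈ regForms ℓ m κ) :
    sgn x ∈ regForms ℓ m κ :=
  ⟨fun S w => neg_one_pow_smul_mem _ (hx.1 S w),
    fun S hS => by rw [sgn_apply, hx.2 S hS, smul_zero]⟩

lemma eps_mem_regForms {j : ℕ} (hj : j ∈ Finset.Ioc ℓ m) {x : Form (κ → RatFn)}
    (hx : x ∈ regForms ℓ m κ) : eps j x ∈ regForms ℓ m κ := by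
  refine ⟨fun S w => ?_, fun S hS => ?_⟩
  · rw [eps_apply]
    split_ifs
    · exact neg_one_pow_smul_mem _ (hx.1 _ w)
    · exact zero_mem _
  · rw [eps_apply]
    split_ifs
    · rw [hx.2 _ fun h => hS ?_, smul_zero]
      intro s hs
      rcases eq_or_ne s j with rfl | hsj
      · exact hj
      · exact h (Finset.mem_erase.2 ⟨hsj, hs⟩)
    · rfl

lemma epsVar_mem_regForms {j : ℕ} (hj : j ≤ m) {x : Form (κ → RatFn)}
    (hx : x ∈ regForms ℓ m κ) : epsVar ℓ j x ∈ regForms ℓ m κ := by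
  rw [epsVar]
  split_ifs with h
  · exact eps_mem_regForms (Finset.mem_Ioc.2 ⟨h, hj⟩) hx
  · exact zero_mem _

lemma dlog_mem_regForms {i j : ℕ} (hi : i ∈ Finset.Icc 1 m) (hj : j ∈ Finset.Icc 1 m)
    {x : Form (κ → RatFn)} (hx : x ∈ regForms ℓ m κ) : dlog ℓ i j x ∈ regForms ℓ m κ := by
  have hi := Finset.mem_Icc.1 hi
  have hj := Finset.mem_Icc.1 hj
  exact smul_mem_regForms (inv_mem_reg hi.1 hi.2 hj.1 hj.2)
    (sub_mem (epsVar_mem_regForms hi.2 hx) (epsVar_mem_regForms hj.2 hx))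

lemma pdForm_mem_regForms (j : ℕ) {x : Form (κ → RatFn)} (hx : x ∈ regForms ℓ m κ) :
    pdForm j x ∈ regForms ℓ m κ :=
  ⟨fun S w => pd_mem_reg j (hx.1 S w), fun S hS => by
    ext w
    rw [pdForm_apply, hx.2 S hS]
    exact map_zero _⟩

lemma extd_mem_regForms (n : ℕ) {x : Form (κ → RatFn)} (hx : x ∈ regForms ℓ m κ) :
    extd ℓ n x ∈ regForms ℓ m κ := by
  rw [extd_apply]
  refine sum_mem fun j hj => ?_
  have hj := Finset.mem_Ioc.1 hj
  rcases le_or_gt j m with hjm | hjm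
  · exact eps_mem_regForms (Finset.mem_Ioc.2 ⟨hj.1, hjm⟩) (pdForm_mem_regForms j hx)
  · have : pdForm j x = 0 := by
      ext S w
      exact pd_eq_zero hjm (hx.1 S w)
    rw [this, map_zero]
    exact zero_mem _

lemma sliceForm_mem_regForms (k : ℕ) {m' : ℕ} {x : Form (Fin (m' + 1) × κ → RatFn)}
    (hx : x ∈ regForms ℓ m _) : sliceForm k x ∈ regForms ℓ m κ := by
  refine ⟨fun S w => ?_, fun S hS => ?_⟩
  · by_cases hk : k < m' + 1
    · rw [mapForm_apply, slice_apply hk]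
      exact hx.1 S _
    · simp [mapForm_apply, slice, hk, zero_mem]
  · rw [mapForm_apply, hx.2 S hS, map_zero]

lemma theta_mem_regForms {x : Form (Fin (m + 1) × κ → RatFn)} (hx : x ∈ regForms ℓ m _) :
    theta ℓ m x ∈ regForms ℓ (m + 1) κ := by
  rw [theta_apply]
  have h : ∀ k, sliceForm k x ∈ regForms ℓ (m + 1) κ := fun k =>
    regForms_mono m.le_succ (sliceForm_mem_regForms k hx)
  refine add_mem (h 0) (sum_mem fun i hi => dlog_mem_regForms ?_ ?_ (sgn_mem_regForms (h i)))
  · exact Finset.Icc_subset_Icc_right m.le_succ hi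
  · exact Finset.mem_Icc.2 ⟨by omega, le_rfl⟩

/-- Forms without `dx (m + 1)` are killed by products with the other differentials, as far as
the coefficients of `dx (m + 1)` are concerned. -/
lemma eps_apply_of_ne {j : ℕ} (hj : j ≠ m + 1) {x : Form (κ → RatFn)}
    (hx : ∀ S, m + 1 ∈ S → x S = 0) {S : Finset ℕ} (hS : m + 1 ∈ S) : eps j x S = 0 := by
  rw [eps_apply, hx _ (Finset.mem_erase.2 ⟨hj.symm, hS⟩), smul_zero, ite_self]

lemma eps_apply_insert (x : Form (κ → RatFn)) {S : Finset ℕ} (hS : S ⊆ Finset.Ioc ℓ m) :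
    eps (m + 1) x (insert (m + 1) S) = x S := by
  have hle : ∀ s ∈ S, s ≤ m := fun s hs => (Finset.mem_Ioc.1 (hS hs)).2
  rw [eps_apply, if_pos (Finset.mem_insert_self _ _), Finset.erase_insert, Finset.card_eq_zero.2]
  · simp
  · rw [Finset.filter_eq_empty_iff]
    intro s hs
    rcases Finset.mem_insert.1 hs with rfl | hs
    · omega
    · have := hle s hs
      omega
  · intro h
    have := hle _ h
    omega

lemma dlog_apply_of_le {i j : ℕ} (hi : i ≤ m) (hj : j ≤ m) {x : Form (κ → RatFn)}
    (hx : ∀ S, m + 1 ∈ S → x S = 0) {S : Finset ℕ} (hS : m + 1 ∈ S) : dlog ℓ i j x S = 0 := by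
  have h : ∀ i ≤ m, epsVar ℓ i x S = 0 := by
    intro i hi
    rw [epsVar]
    split_ifs
    · exact eps_apply_of_ne (by omega) hx hS
    · rfl
  rw [dlog_apply, Pi.smul_apply, Pi.sub_apply, h i hi, h j hj, sub_zero, smul_zero]

lemma dlog_apply_insert (hm : ℓ ≤ m) {i : ℕ} (hi : i ≤ m) {x : Form (κ → RatFn)}
    (hx : ∀ S, m + 1 ∈ S → x S = 0) {S : Finset ℕ} (hS : S ⊆ Finset.Ioc ℓ m) :
    dlog ℓ i (m + 1) x (insert (m + 1) S) = (pt ℓ (m + 1) - pt ℓ i)⁻¹ • x S := by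
  have h : epsVar ℓ i x (insert (m + 1) S) = 0 := by
    rw [epsVar]
    split_ifs
    · exact eps_apply_of_ne (by omega) hx (Finset.mem_insert_self _ _)
    · rfl
  rw [dlog_apply, Pi.smul_apply, Pi.sub_apply, h, epsVar, if_pos (by omega), eps_apply_insert x hS,
    zero_sub, smul_neg, ← neg_smul, ← inv_neg, neg_sub]

lemma eq_zero_of_mem_regForms {x : Form (κ → RatFn)} (hx : x ∈ regForms ℓ m κ) (S : Finset ℕ)
    (hS : m + 1 ∈ S) : x S = 0 :=
  hx.2 S fun h => by
    have := Finset.mem_Ioc.1 (h hS)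
    omega

lemma theta_apply_insert (hm : ℓ ≤ m) {x : Form (Fin (m + 1) × κ → RatFn)}
    (hx : x ∈ regForms ℓ m _) {S : Finset ℕ} (hS : S ⊆ Finset.Ioc ℓ m) :
    theta ℓ m x (insert (m + 1) S)
      = ∑ i ∈ Finset.Icc 1 m, (pt ℓ (m + 1) - pt ℓ i)⁻¹ • sgn (sliceForm i x) S := by
  rw [theta_apply, Pi.add_apply, Finset.sum_apply, eq_zero_of_mem_regForms
    (sliceForm_mem_regForms 0 hx) _ (Finset.mem_insert_self _ _), zero_add]
  refine Finset.sum_congr rfl fun i hi => ?_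
  exact dlog_apply_insert hm (Finset.mem_Icc.1 hi).2
    (eq_zero_of_mem_regForms (sgn_mem_regForms (sliceForm_mem_regForms i hx))) hS

lemma eq_zero_of_theta_eq_zero (hm : ℓ ≤ m) {x : Form (Fin (m + 1) × κ → RatFn)}
    (hx : x ∈ regForms ℓ m _) (h : theta ℓ m x = 0) : x = 0 := by
  have hi : ∀ i ∈ Finset.Icc 1 m, sliceForm i x = 0 := by
    intro i hi
    rw [← sgn_sgn (sliceForm i x)]
    have : sgn (sliceForm i x) = 0 := by
      ext S w
      by_cases hS : S ⊆ Finset.Ioc ℓ m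
      · have h0 := congrFun (theta_apply_insert hm hx hS) w
        rw [h] at h0
        refine (fiberData hm).eq_zero_of_sum_inv_pow_mem (p := 0) (N := 0)
          (w := fun i => sgn (sliceForm i x) S w)
          (fun i => (sgn_mem_regForms (sliceForm_mem_regForms i hx)).1 S w) ?_ hi
        have h1 : ∑ i ∈ Finset.Icc 1 m, ((pt ℓ (m + 1) - pt ℓ i)⁻¹) ^ (0 + 1)
            * sgn (sliceForm i x) S w = 0 := by
          simpa using h0.symm
        rw [h1]
        exact zero_mem _
      · rw [(sgn_mem_regForms (sliceForm_mem_regForms i hx)).2 S hS]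
        rfl
    rw [this, map_zero]
  have h0 : sliceForm 0 x = 0 := by
    rw [theta_apply, Finset.sum_eq_zero fun i hi' => by rw [hi i hi', map_zero, map_zero],
      add_zero] at h
    exact h
  ext1 S
  refine slice_ext ?_ fun i hi' => ?_
  · exact (congrFun h0 S).trans (map_zero _).symm
  · exact (congrFun (hi i hi') S).trans (map_zero _).symm

variable [Fintype κ]

lemma mapForm_act_mem_regForms (P : Matrix κ κ ℂ) {x : Form (κ → RatFn)}
    (hx : x ∈ regForms ℓ m κ) : mapForm (act P) x ∈ regForms ℓ m κ :=
  ⟨fun S => act_mem P (hx.1 S), fun S hS => by rw [mapForm_apply, hx.2 S hS, map_zero]⟩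

lemma conn_mem_regForms (n : ℕ) (P : ℕ → ℕ → Matrix κ κ ℂ) (D : Matrix κ κ ℂ)
    {x : Form (κ → RatFn)} (hx : x ∈ regForms ℓ m κ) : conn ℓ n m P D x ∈ regForms ℓ m κ := by
  rw [conn_apply]
  refine add_mem (extd_mem_regForms n hx) (add_mem (sum_mem fun i hi => sum_mem fun j hj => ?_) ?_)
  · exact dlog_mem_regForms hi hj (mapForm_act_mem_regForms _ hx)
  · exact sgn_mem_regForms (mapForm_act_mem_regForms _ hx)

/-- The fibre component of the connection. -/
lemma conn_apply_insert (hm : ℓ ≤ m) (hmn : m + 1 ≤ n) {P : ℕ → ℕ → Matrix κ κ ℂ}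
    (hP : ∀ i j, P i j = P j i) (D : Matrix κ κ ℂ) {x : Form (κ → RatFn)}
    (hx : ∀ S, m + 1 ∈ S → x S = 0) {S : Finset ℕ} (hS : S ⊆ Finset.Ioc ℓ m) :
    conn ℓ n (m + 1) P D x (insert (m + 1) S) = fib (pd (m + 1)) (pt ℓ (m + 1)) (pt ℓ)
      (Finset.Icc 1 m) (fun i => (2 : ℂ) • P i (m + 1)) (x S) := by
  have hM := Finset.mem_insert_self (m + 1) S
  have hact : ∀ Q : Matrix κ κ ℂ, ∀ S, m + 1 ∈ S → mapForm (act Q) x S = 0 := fun Q S hS => by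
    rw [mapForm_apply, hx S hS, map_zero]
  have hd : extd ℓ n x (insert (m + 1) S) = pdForm (m + 1) x S := by
    rw [extd_apply, Finset.sum_apply, Finset.sum_eq_single (m + 1)]
    · exact eps_apply_insert _ hS
    · intro j _ hj
      refine eps_apply_of_ne hj (fun T hT => ?_) hM
      ext w
      rw [pdForm_apply, hx T hT]
      exact map_zero _
    · intro h
      exact absurd (Finset.mem_Ioc.2 ⟨by omega, hmn⟩) h
  rw [conn_apply, sum_dlog_succ hP, Pi.add_apply, Pi.add_apply, Pi.add_apply, hd, sgn_apply,
    hact D _ hM, smul_zero, add_zero, Finset.sum_apply, Finset.sum_eq_zero, zero_add, Pi.smul_apply,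
    Finset.sum_apply]
  · rw [Finset.sum_congr rfl fun i hi => dlog_apply_insert hm (Finset.mem_Icc.1 hi).2 (hact _) hS]
    ext w
    simp only [Pi.add_apply, fib, pdForm_apply, Pi.smul_apply, Finset.sum_apply, Finset.smul_sum,
      act_smul, mapForm_apply, smul_eq_mul, mul_smul_comm]
  · intro i hi
    rw [Finset.sum_apply]
    exact Finset.sum_eq_zero fun j hj =>
      dlog_apply_of_le (Finset.mem_Icc.1 hi).2 (Finset.mem_Icc.1 hj).2 (hact _) hM

/-- A form whose differential comes from the base comes from the base up to an exact form. -/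
theorem exists_sub_conn_eq_theta (hm : ℓ ≤ m) (hmn : m + 1 ≤ n) [DecidableEq κ]
    {P : ℕ → ℕ → Matrix κ κ ℂ}
    (hP : ∀ i j, P i j = P j i) (D : Matrix κ κ ℂ)
    (hQ : Nonres (Finset.Icc 1 m) fun i => (2 : ℂ) • P i (m + 1))
    (hsq : ∀ y ∈ regForms ℓ (m + 1) κ,
      conn ℓ n (m + 1) P D (conn ℓ n (m + 1) P D y) = 0)
    {x : Form (κ → RatFn)} (hx : x ∈ regForms ℓ (m + 1) κ)
    (hdx : ∃ z ∈ regForms ℓ m _, conn ℓ n (m + 1) P D x = theta ℓ m z) :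
    ∃ y ∈ regForms ℓ (m + 1) κ, ∃ z ∈ regForms ℓ m _,
      x - conn ℓ n (m + 1) P D y = theta ℓ m z := by
  have hlow : ∀ f : κ → RatFn, (∀ w, f w ∈ reg ℓ (m + 1)) → ∃ N, ∀ w,
      f w ∈ low (reg ℓ m) (pt ℓ (m + 1)) (pt ℓ) (Finset.Icc 1 m) N N := by
    intro f hf
    choose N hN using fun w => (mem_reg_succ_iff hm).1 (hf w)
    exact ⟨Finset.univ.sup N, fun w => low_mono (Finset.le_sup (Finset.mem_univ w))
      (Finset.le_sup (Finset.mem_univ w)) (hN w)⟩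
  have hex : ∀ S, ∃ (g : κ → RatFn) (v : ℕ → κ → RatFn), (∀ w, g w ∈ reg ℓ (m + 1)) ∧
      (∀ i w, v i w ∈ reg ℓ m) ∧ x (insert (m + 1) S) = fib (pd (m + 1)) (pt ℓ (m + 1)) (pt ℓ)
        (Finset.Icc 1 m) (fun i => (2 : ℂ) • P i (m + 1)) g
          + ∑ i ∈ Finset.Icc 1 m, (pt ℓ (m + 1) - pt ℓ i)⁻¹ • v i := by
    intro S
    obtain ⟨N, hN⟩ := hlow _ (hx.1 (insert (m + 1) S))
    obtain ⟨g, v, hg, hv, h⟩ := (fiberData hm).exists_fib_add_poles hQ hN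
    exact ⟨g, v, fun w => (mem_reg_succ_iff hm).2 (hg w), hv, h⟩
  choose g v hg hv hgv using hex
  have hlt : ∀ S, S ⊆ Finset.Ioc ℓ m → m + 1 ∉ S := fun S hS h => by
    have := Finset.mem_Ioc.1 (hS h)
    omega
  set y : Form (κ → RatFn) := fun S => if S ⊆ Finset.Ioc ℓ m then g S else 0 with hy
  set V : ℕ → Form (κ → RatFn) := fun i S => if S ⊆ Finset.Ioc ℓ m then v S i else 0 with hV
  have hymem : y ∈ regForms ℓ (m + 1) κ := by
    refine ⟨fun S w => ?_, fun S hS => if_neg fun h =>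
      hS (h.trans (Finset.Ioc_subset_Ioc_right m.le_succ))⟩
    simp only [hy]
    split_ifs
    exacts [hg S w, zero_mem _]
  have hVmem : ∀ i, V i ∈ regForms ℓ m κ := by
    refine fun i => ⟨fun S w => ?_, fun S hS => if_neg hS⟩
    simp only [hV]
    split_ifs
    exacts [hv S i w, zero_mem _]
  let G : Form (κ → RatFn) → Form (Fin (m + 1) × κ → RatFn) := fun u S p =>
    if (p.1 : ℕ) = 0 then u S p.2 else sgn (V p.1) S p.2
  have hG0 : ∀ u, sliceForm 0 (G u) = u := by
    intro u
    ext S w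
    simp [mapForm_apply, slice, G]
  have hGi : ∀ u, ∀ i ∈ Finset.Icc 1 m, sliceForm i (G u) = sgn (V i) := by
    intro u i hi
    have hi := Finset.mem_Icc.1 hi
    ext S w
    rw [mapForm_apply, slice_apply (by omega)]
    exact if_neg (by dsimp only; omega)
  have hGmem : ∀ u ∈ regForms ℓ m κ, G u ∈ regForms ℓ m _ := by
    intro u hu
    refine ⟨fun S p => ?_, fun S hS => ?_⟩
    · dsimp only [G]
      split_ifs
      exacts [hu.1 S _, (sgn_mem_regForms (hVmem _)).1 S _]
    · ext p
      dsimp only [G]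
      rw [hu.2 S hS, (sgn_mem_regForms (hVmem _)).2 S hS]
      simp
  have hGth : ∀ u, theta ℓ m (G u) = u + theta ℓ m (G 0) := by
    intro u
    rw [theta_apply, theta_apply, hG0, hG0, zero_add]
    congr 1
    exact Finset.sum_congr rfl fun i hi => by rw [hGi u i hi, hGi 0 i hi]
  have hG0mem := hGmem 0 (zero_mem _)
  set x' := x - conn ℓ n (m + 1) P D y - theta ℓ m (G 0) with hx'
  have hx'mem : x' ∈ regForms ℓ (m + 1) κ :=
    sub_mem (sub_mem hx (conn_mem_regForms n P D hymem)) (theta_mem_regForms hG0mem)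
  have hx'0 : ∀ S, m + 1 ∈ S → x' S = 0 := by
    intro S hS
    by_cases h : S ⊆ Finset.Ioc ℓ (m + 1)
    · have hT : S.erase (m + 1) ⊆ Finset.Ioc ℓ m := by
        intro s hs
        have h1 := Finset.mem_erase.1 hs
        have h2 := Finset.mem_Ioc.1 (h h1.2)
        exact Finset.mem_Ioc.2 ⟨h2.1, by omega⟩
      rw [← Finset.insert_erase hS, hx', Pi.sub_apply, Pi.sub_apply, hgv,
        conn_apply_insert hm hmn hP D (fun T hT' => if_neg fun h' => hlt T h' hT') hT,
        theta_apply_insert hm hG0mem hT]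
      have hsum : ∀ i ∈ Finset.Icc 1 m, (pt ℓ (m + 1) - pt ℓ i)⁻¹
          • sgn (sliceForm i (G 0)) (S.erase (m + 1))
            = (pt ℓ (m + 1) - pt ℓ i)⁻¹ • v (S.erase (m + 1)) i := by
        intro i hi
        rw [hGi 0 i hi, sgn_sgn]
        simp only [hV, if_pos hT]
      rw [Finset.sum_congr rfl hsum]
      simp only [if_pos hT, add_sub_cancel_left, sub_self]
    · exact hx'mem.2 S h
  have hdx' : ∃ z ∈ regForms ℓ m _, conn ℓ n (m + 1) P D x' = theta ℓ m z := by
    obtain ⟨z, hz, hxz⟩ := hdx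
    refine ⟨z - conn ℓ n m (nextRes P m) (nextConst P D m) (G 0),
      sub_mem hz (conn_mem_regForms n _ _ hG0mem), ?_⟩
    rw [hx', map_sub, map_sub, hsq y hymem, sub_zero, hxz, map_sub, theta_conn hmn hP]
  have hx'low : x' ∈ regForms ℓ m κ := by
    refine ⟨fun S w => ?_, fun S hS => ?_⟩
    · by_cases hS : S ⊆ Finset.Ioc ℓ m
      · obtain ⟨N, hN⟩ := hlow _ (hx'mem.1 S)
        obtain ⟨z, hz, hxz⟩ := hdx'
        refine (fiberData hm).mem_of_fib_mem hQ hN (fun w => ?_) w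
        rw [← conn_apply_insert hm hmn hP D hx'0 hS, hxz, theta_apply_insert hm hz hS,
          Finset.sum_apply]
        refine sum_mem fun i hi => ?_
        rw [Pi.smul_apply, smul_eq_mul, mul_comm]
        refine mul_mem_low ((sgn_mem_regForms (sliceForm_mem_regForms i hz)).1 S w) ?_
        simpa using inv_pow_mem_low (R := reg ℓ m) (t := pt ℓ (m + 1)) (c := pt ℓ) 0 hi zero_lt_one
      · by_cases hM : m + 1 ∈ S
        · rw [hx'0 S hM]
          exact zero_mem _
        · rw [hx'mem.2 S fun h => hS fun s hs => ?_]
          · exact zero_mem _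
          · have h1 := Finset.mem_Ioc.1 (h hs)
            have : s ≠ m + 1 := fun h' => hM (h' ▸ hs)
            exact Finset.mem_Ioc.2 ⟨h1.1, by omega⟩
    · by_cases hM : m + 1 ∈ S
      · exact hx'0 S hM
      · refine hx'mem.2 S fun h => hS fun s hs => ?_
        have h1 := Finset.mem_Ioc.1 (h hs)
        have : s ≠ m + 1 := fun h' => hM (h' ▸ hs)
        exact Finset.mem_Ioc.2 ⟨h1.1, by omega⟩
  refine ⟨y, hymem, G x', hGmem x' hx'low, ?_⟩
  rw [hGth, hx', sub_add_cancel]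

end RegularForms

section Nonresonance

variable {κ : Type*}

/-- The total residue along the stratum where the points indexed by `J` collide. -/
def totRes (P : ℕ → ℕ → Matrix κ κ ℂ) (J : Finset ℕ) : Matrix κ κ ℂ :=
  ∑ i ∈ J, ∑ j ∈ J, P i j

/-- No difference of two nested total residues has a nonzero integer as an eigenvalue. -/
def Nonresonant [Fintype κ] (m : ℕ) (P : ℕ → ℕ → Matrix κ κ ℂ) : Prop :=
  ∀ J J' : Finset ℕ, J ⊆ J' → J' ⊆ Finset.Icc 1 m → ∀ p : ℤ, p ≠ 0 → ∀ g : κ → ℂ,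
    act (totRes P J') g - act (totRes P J) g = (p : ℂ) • g → g = 0

variable {P : ℕ → ℕ → Matrix κ κ ℂ} {m : ℕ}

lemma totRes_insert (hP : ∀ i j, P i j = P j i) (hP0 : ∀ i, P i i = 0) {J : Finset ℕ} {k : ℕ}
    (hk : k ∉ J) : totRes P (insert k J) = totRes P J + (2 : ℂ) • ∑ j ∈ J, P j k := by
  simp only [totRes, Finset.sum_insert hk, hP0, Finset.sum_add_distrib, hP k, two_smul]
  abel

lemma nextRes_symm [Fintype κ] (hP : ∀ i j, P i j = P j i) (i j : ℕ) :
    nextRes P m i j = nextRes P m j i := by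
  rw [nextRes, nextRes, hP j i]
  congr 1
  ext u v
  simp only [blk, Matrix.sub_apply, Pi.sub_apply]
  split_ifs <;> ring

lemma nextRes_self (hP0 : ∀ i, P i i = 0) (i : ℕ) : nextRes P m i i = 0 := by
  rw [nextRes, hP0, sub_self, add_zero]
  refine Finset.sum_eq_zero fun k _ => ?_
  ext u v
  simp [blk]

variable [Fintype κ]

lemma Nonresonant.isUnit [DecidableEq κ] (hN : Nonresonant m P) {J J' : Finset ℕ} (hJ : J ⊆ J')
    (hJ' : J' ⊆ Finset.Icc 1 m) {p : ℤ} (hp : p ≠ 0) :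
    IsUnit (totRes P J' - totRes P J - (p : Matrix κ κ ℂ)) := by
  rw [← Matrix.mulVec_injective_iff_isUnit, ← Matrix.coe_mulVecLin, injective_iff_map_eq_zero]
  intro g hg
  refine hN J J' hJ hJ' p hp g ?_
  rw [Matrix.mulVecLin_apply, Matrix.sub_mulVec, Matrix.sub_mulVec, Matrix.intCast_mulVec,
    sub_eq_zero] at hg
  simp only [act, Matrix.mulVecLin_apply]
  exact hg

lemma Nonresonant.fiber [DecidableEq κ] (hP : ∀ i j, P i j = P j i) (hP0 : ∀ i, P i i = 0)
    (hN : Nonresonant (m + 1) P) : Nonres (Finset.Icc 1 m) fun i => (2 : ℂ) • P i (m + 1) where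
  finite i hi s := by
    have hi := Finset.mem_Icc.1 hi
    have h := hN.isUnit (J := ∅) (J' := {i, m + 1}) (Finset.empty_subset _) (by
      intro k hk
      simp only [Finset.mem_insert, Finset.mem_singleton] at hk
      exact Finset.mem_Icc.2 ⟨by omega, by omega⟩) (p := (s + 1 : ℕ)) (by omega)
    rw [Finset.pair_comm, totRes_insert hP hP0 (by simp only [Finset.mem_singleton]; omega)] at h
    simpa [totRes, hP0] using h
  infinity s := by
    have h := hN.isUnit (J := Finset.Icc 1 m) (J' := insert (m + 1) (Finset.Icc 1 m))
      (Finset.subset_insert _ _) (by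
      intro k hk
      rcases Finset.mem_insert.1 hk with rfl | hk
      · exact Finset.mem_Icc.2 ⟨by omega, le_rfl⟩
      · exact Finset.Icc_subset_Icc_right m.le_succ hk) (p := -(s + 1 : ℕ)) (by omega)
    rw [totRes_insert hP hP0 (by simp)] at h
    simpa [Finset.smul_sum, sub_eq_add_neg, add_comm] using h

lemma slice_totRes {J : Finset ℕ} (hJ : J ⊆ Finset.Icc 1 m) {k : ℕ} (hk : k < m + 1)
    (g : Fin (m + 1) × κ → ℂ) : slice k (act (totRes (nextRes P m) J) g)
      = act (totRes P J) (slice k g) + if k ∈ J then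
        (2 : ℂ) • (act (∑ j ∈ J, P j (m + 1)) (slice k g)
          - act (P k (m + 1)) (∑ j ∈ J, slice j g)) else 0 := by
  have hlt : ∀ i ∈ J, i < m + 1 := fun i hi => by
    have := Finset.mem_Icc.1 (hJ hi)
    omega
  have h1 : ∀ i ∈ J, ∀ j ∈ J, slice k (act (nextRes P m i j) g) = act (P i j) (slice k g)
      + ((if i = k then act (P j (m + 1)) (slice k g) - act (P k (m + 1)) (slice j g) else 0)
        + (if j = k then act (P i (m + 1)) (slice k g) - act (P k (m + 1)) (slice i g)
          else 0)) := by
    intro i hi j hj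
    rw [slice_nextRes P (hlt i hi) (hlt j hj) hk, sub_smul]
    congr 1
    rw [sub_eq_add_neg]
    congr 1
    · by_cases h : i = k
      · subst h; simp
      · rw [if_neg h, if_neg (Ne.symm h), zero_smul]
    · by_cases h : j = k
      · subst h; simp
      · rw [if_neg h, if_neg (Ne.symm h), zero_smul, neg_zero]
  have h2 : act (∑ j ∈ J, P j (m + 1)) (slice k g) - act (P k (m + 1)) (∑ j ∈ J, slice j g)
      = ∑ j ∈ J, (act (P j (m + 1)) (slice k g) - act (P k (m + 1)) (slice j g)) := by
    rw [act_sum, map_sum, Finset.sum_sub_distrib]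
  rw [totRes, act_sum, map_sum, Finset.sum_congr rfl fun i hi => by
    rw [act_sum, map_sum, Finset.sum_congr rfl fun j hj => h1 i hi j hj, Finset.sum_add_distrib,
      Finset.sum_add_distrib, ← act_sum], Finset.sum_add_distrib, ← act_sum, ← totRes,
    Finset.sum_add_distrib, h2]
  congr 1
  rw [Finset.sum_comm]
  simp only [Finset.sum_ite_eq']
  split_ifs with hkJ
  · rw [two_smul]
  · simp

/-- Nonresonance passes to the fibre cohomology. -/
theorem Nonresonant.next (hP : ∀ i j, P i j = P j i) (hP0 : ∀ i, P i i = 0)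
    (hN : Nonresonant (m + 1) P) : Nonresonant m (nextRes P m) := by
  intro J J' hJ hJ' p hp g hg
  have hMJ : m + 1 ∉ J := fun h => by
    have := Finset.mem_Icc.1 (hJ' (hJ h))
    omega
  have hMJ' : m + 1 ∉ J' := fun h => by
    have := Finset.mem_Icc.1 (hJ' h)
    omega
  have hsub : insert (m + 1) J' ⊆ Finset.Icc 1 (m + 1) := by
    intro k hk
    rcases Finset.mem_insert.1 hk with rfl | hk
    · exact Finset.mem_Icc.2 ⟨by omega, le_rfl⟩
    · exact Finset.Icc_subset_Icc_right m.le_succ (hJ' hk)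
  have hJ'sub := (Finset.subset_insert (m + 1) J').trans hsub
  have hslice : ∀ k < m + 1, slice k (act (totRes (nextRes P m) J') g)
      - slice k (act (totRes (nextRes P m) J) g) = (p : ℂ) • slice k g := fun k _ => by
    rw [← map_sub, hg, map_smul]
  have hout : ∀ k < m + 1, k ∉ J' → slice k g = 0 := by
    intro k hk hkJ'
    have h := hslice k hk
    rw [slice_totRes hJ' hk, slice_totRes (hJ.trans hJ') hk, if_neg hkJ',
      if_neg fun h => hkJ' (hJ h), add_zero, add_zero] at h
    exact hN J J' hJ hJ'sub p hp _ h
  have hlt : ∀ k ∈ J', k < m + 1 := fun k hk => by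
    have := Finset.mem_Icc.1 (hJ' hk)
    omega
  have hsum : ∀ J : Finset ℕ, ∑ k ∈ J, (2 : ℂ) • (act (∑ j ∈ J, P j (m + 1)) (slice k g)
      - act (P k (m + 1)) (∑ j ∈ J, slice j g)) = 0 := by
    intro J
    rw [← Finset.smul_sum, Finset.sum_sub_distrib, ← map_sum, ← act_sum, sub_self, smul_zero]
  have hs : ∑ k ∈ J', slice k g = 0 := by
    refine hN J J' hJ hJ'sub p hp _ ?_
    have h := Finset.sum_congr (rfl : J' = J') fun k hk => hslice k (hlt k hk)
    rw [Finset.sum_congr rfl fun k hk => by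
        rw [slice_totRes hJ' (hlt k hk), slice_totRes (hJ.trans hJ') (hlt k hk)],
      Finset.sum_sub_distrib, Finset.sum_add_distrib, Finset.sum_add_distrib,
      Finset.sum_congr (s₂ := J') rfl fun k hk => if_pos hk, hsum J', Finset.sum_ite_mem,
      Finset.inter_eq_right.2 hJ, hsum J, add_zero, add_zero, ← map_sum, ← map_sum,
      ← Finset.smul_sum] at h
    exact h
  have htop : ∀ J : Finset ℕ, m + 1 ∉ J → ∀ f : κ → ℂ, act (totRes P (insert (m + 1) J)) f
      = act (totRes P J) f + (2 : ℂ) • act (∑ j ∈ J, P j (m + 1)) f := by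
    intro J hJ f
    rw [totRes_insert hP hP0 hJ, act_add, act_smul]
  have hmid : ∀ k ∈ J', k ∉ J → slice k g = 0 := by
    intro k hk hkJ
    have h := hslice k (hlt k hk)
    rw [slice_totRes hJ' (hlt k hk), slice_totRes (hJ.trans hJ') (hlt k hk), if_pos hk, if_neg hkJ,
      hs, map_zero, sub_zero, add_zero, ← htop J' hMJ'] at h
    exact hN J _ (hJ.trans (Finset.subset_insert _ _)) hsub p hp _ h
  have hs' : ∑ k ∈ J, slice k g = 0 := by
    rw [Finset.sum_subset hJ fun k hk hkJ => hmid k hk hkJ, hs]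
  have hin : ∀ k ∈ J, slice k g = 0 := by
    intro k hk
    have h := hslice k (hlt k (hJ hk))
    rw [slice_totRes hJ' (hlt k (hJ hk)), slice_totRes (hJ.trans hJ') (hlt k (hJ hk)),
      if_pos (hJ hk), if_pos hk, hs, hs', map_zero, sub_zero, sub_zero, ← htop J' hMJ',
      ← htop J hMJ] at h
    exact hN _ _ (Finset.insert_subset_insert _ hJ) hsub p hp _ h
  have hall : ∀ k < m + 1, slice k g = 0 := fun k hk => by
    by_cases h1 : k ∈ J
    · exact hin k h1
    · by_cases h2 : k ∈ J'
      · exact hmid k h2 h1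
      · exact hout k hk h2
  refine slice_ext ?_ fun k hk => ?_
  · rw [hall 0 m.succ_pos, map_zero]
  · rw [hall k (by have := Finset.mem_Icc.1 hk; omega), map_zero]

end Nonresonance

section OrlikSolomon

variable {ℓ n : ℕ}

lemma gen_eq_zero {i j : ℕ} (h : ¬(1 ≤ i ∧ i < j ∧ ℓ + 1 ≤ j ∧ j ≤ n)) : gen ℓ n i j = 0 :=
  dif_neg h

lemma a_eq_zero {i j : ℕ} (h : j ≤ ℓ) : a ℓ n i j = 0 := by
  rw [a, gen_eq_zero (by omega), map_zero]

lemma gen_anticomm (i j k l : ℕ) : gen ℓ n i j * gen ℓ n k l = -(gen ℓ n k l * gen ℓ n i j) := by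
  rw [eq_neg_iff_add_eq_zero]
  by_cases h : 1 ≤ i ∧ i < j ∧ ℓ + 1 ≤ j ∧ j ≤ n
  · by_cases h' : 1 ≤ k ∧ k < l ∧ ℓ + 1 ≤ l ∧ l ≤ n
    · rw [gen, gen, dif_pos h, dif_pos h', ExteriorAlgebra.ι_add_mul_swap]
    · simp [gen_eq_zero h']
  · simp [gen_eq_zero h]

lemma a_anticomm (i j k l : ℕ) : a ℓ n i j * a ℓ n k l = -(a ℓ n k l * a ℓ n i j) := by
  rw [a, a, ← map_mul, gen_anticomm, map_neg, map_mul]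

lemma eq_zero_of_eq_neg {M : Type*} [AddCommGroup M] [Module ℂ M] {x : M} (h : x = -x) : x = 0 := by
  rw [eq_neg_iff_add_eq_zero, ← two_smul ℂ] at h
  exact (smul_eq_zero_iff_right two_ne_zero).1 h

lemma a_mul_self (i j : ℕ) : a ℓ n i j * a ℓ n i j = 0 :=
  eq_zero_of_eq_neg (a_anticomm i j i j)

lemma projA_eq_zero {x : E ℓ n} (h : rel ℓ n x 0) : projA ℓ n x = 0 := by
  rw [projA, RingQuot.mkAlgHom_rel ℂ h, map_zero]

lemma a_arnold {i j k : ℕ} (hi : 1 ≤ i) (hij : i < j) (hjk : j < k) (hk : k ≤ n) :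
    a ℓ n i j * a ℓ n i k - a ℓ n i j * a ℓ n j k + a ℓ n i k * a ℓ n j k = 0 := by
  by_cases hj : ℓ + 1 ≤ j
  · have := projA_eq_zero (ℓ := ℓ) (n := n) ⟨rfl, Or.inl ⟨i, j, k, hi, hij, hjk, hk, hj, rfl⟩⟩
    rwa [map_add, map_sub, map_mul, map_mul, map_mul] at this
  · rw [a_eq_zero (show j ≤ ℓ by omega), zero_mul, zero_mul, sub_zero, zero_add]
    by_cases hkl : ℓ < k
    · have := projA_eq_zero (ℓ := ℓ) (n := n)
        ⟨rfl, Or.inr ⟨i, j, k, hi, hij, by omega, hkl, hk, rfl⟩⟩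
      rwa [map_mul] at this
    · rw [a_eq_zero (show k ≤ ℓ by omega), zero_mul]

lemma eq_top_of_one_mem {T : Submodule ℂ (A ℓ n)} (h1 : 1 ∈ T)
    (hT : ∀ i j, 1 ≤ i → i < j → j ≤ n → ∀ t ∈ T, a ℓ n i j * t ∈ T) : T = ⊤ := by
  have h : ∀ x : E ℓ n, ∀ t ∈ T, projA ℓ n x * t ∈ T := by
    intro x
    induction x using ExteriorAlgebra.induction with
    | algebraMap z =>
      intro t ht
      rw [AlgHom.commutes, ← Algebra.smul_def]
      exact T.smul_mem z ht
    | ι v =>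
      intro t ht
      induction v using Finsupp.induction_linear with
      | zero => simp
      | add u v hu hv =>
        rw [map_add, map_add, add_mul]
        exact T.add_mem hu hv
      | single p z =>
        rw [← Finsupp.smul_single_one, map_smul, map_smul, smul_mul_assoc]
        refine T.smul_mem z ?_
        have := hT p.1.1 p.1.2 p.2.1 p.2.2.1 p.2.2.2.2 t ht
        rw [a, gen, dif_pos p.2] at this
        exact this
    | mul x y hx hy =>
      intro t ht
      rw [map_mul, mul_assoc]
      exact hx _ (hy t ht)
    | add x y hx hy =>
      intro t ht
      rw [map_add, add_mul]
      exact T.add_mem (hx t ht) (hy t ht)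
  refine Submodule.eq_top_iff'.2 fun x => ?_
  obtain ⟨x, rfl⟩ := RingQuot.mkAlgHom_surjective ℂ (rel ℓ n) x
  have := h x 1 h1
  rwa [mul_one] at this

/-- Scalar differential forms. -/
abbrev ScalarForm : Type := Form (Unit → RatFn)

/-- The action of the degree-one part of the exterior algebra by logarithmic one-forms. -/
noncomputable def dlogLin (ℓ n : ℕ) : (Idx ℓ n →₀ ℂ) →ₗ[ℂ] Module.End RatFn ScalarForm :=
  Finsupp.linearCombination ℂ fun p => dlog ℓ p.1.1 p.1.2

lemma dlogLin_anticomm (u v : Idx ℓ n →₀ ℂ) :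
    dlogLin ℓ n u * dlogLin ℓ n v = -(dlogLin ℓ n v * dlogLin ℓ n u) := by
  induction u using Finsupp.induction_linear with
  | zero => simp
  | add u u' hu hu' => rw [map_add, add_mul, hu, hu', mul_add, neg_add]
  | single p z =>
    induction v using Finsupp.induction_linear with
    | zero => simp
    | add u u' hu hu' => rw [map_add, mul_add, hu, hu', add_mul, neg_add]
    | single q w =>
      simp only [dlogLin, Finsupp.linearCombination_single, smul_mul_smul_comm, mul_comm w z,
        ← smul_neg]
      congr 1
      exact LinearMap.ext fun x => dlog_anticomm _ _ _ _ _ x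

lemma dlogLin_mul_self (v : Idx ℓ n →₀ ℂ) : dlogLin ℓ n v * dlogLin ℓ n v = 0 :=
  eq_zero_of_eq_neg (dlogLin_anticomm v v)

/-- The action of the exterior algebra on scalar forms. -/
noncomputable def extAction (ℓ n : ℕ) : E ℓ n →ₐ[ℂ] Module.End RatFn ScalarForm :=
  ExteriorAlgebra.lift ℂ ⟨dlogLin ℓ n, dlogLin_mul_self⟩

lemma extAction_gen {i j : ℕ} (hi : 1 ≤ i) (hij : i < j) (hj : j ≤ n) :
    extAction ℓ n (gen ℓ n i j) = dlog ℓ i j := by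
  by_cases h : ℓ + 1 ≤ j
  · rw [gen, dif_pos ⟨hi, hij, h, hj⟩, extAction, ExteriorAlgebra.lift_ι_apply]
    exact (Finsupp.linearCombination_single ℂ _ _).trans (one_smul _ _)
  · rw [gen, dif_neg (by omega), map_zero]
    exact LinearMap.ext fun x => (dlog_eq_zero (by omega) (by omega) x).symm

lemma extAction_rel {x y : E ℓ n} (h : rel ℓ n x y) : extAction ℓ n x = extAction ℓ n y := by
  have arnold : ∀ i j k x, dlog ℓ i j (dlog ℓ i k x) - dlog ℓ i j (dlog ℓ j k x)
      + dlog ℓ i k (dlog ℓ j k x) = (0 : ScalarForm) := by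
    intro i j k x
    rw [dlog_anticomm ℓ i k j k, dlog_arnold ℓ i j k, map_sub, add_neg_cancel]
  obtain ⟨rfl, ⟨i, j, k, hi, hij, hjk, hk, hj, rfl⟩ | ⟨i, j, k, hi, hij, hj, hjk, hk, rfl⟩⟩ := h
  · simp only [map_add, map_sub, map_mul, map_zero, extAction_gen hi hij (hjk.le.trans hk),
      extAction_gen hi (hij.trans hjk) hk, extAction_gen (hi.trans hij.le) hjk hk]
    exact LinearMap.ext fun x => arnold i j k x
  · simp only [map_mul, map_zero, extAction_gen hi (hij.trans_le (hj.trans hjk.le)) hk,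
      extAction_gen (hi.trans hij.le) (hj.trans_lt hjk) hk]
    refine LinearMap.ext fun x => ?_
    have := arnold i j k x
    rwa [dlog_eq_zero (by omega) hj, dlog_eq_zero (by omega) hj, sub_zero, zero_add] at this

/-- The action of the Orlik-Solomon algebra on scalar forms. -/
noncomputable def action (ℓ n : ℕ) : A ℓ n →ₐ[ℂ] Module.End RatFn ScalarForm :=
  RingQuot.liftAlgHom ℂ ⟨extAction ℓ n, fun _ _ => extAction_rel⟩

lemma action_projA (x : E ℓ n) : action ℓ n (projA ℓ n x) = extAction ℓ n x :=
  RingQuot.liftAlgHom_mkAlgHom_apply _ _ _ _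

lemma action_a {i j : ℕ} (hi : 1 ≤ i) (hij : i < j) (hj : j ≤ n) :
    action ℓ n (a ℓ n i j) = dlog ℓ i j := by
  rw [a, action_projA, extAction_gen hi hij hj]

/-- Constant forms of degree zero. -/
noncomputable def constForm {κ : Type*} : (κ → ℂ) →ₗ[ℂ] Form (κ → RatFn) where
  toFun w S := if S = ∅ then fun v => algebraMap ℂ RatFn (w v) else 0
  map_add' x y := by
    ext S v
    by_cases h : S = ∅ <;> simp [h]
  map_smul' z x := by
    ext S v
    by_cases h : S = ∅ <;> simp [h, Algebra.smul_def]

lemma constForm_apply {κ : Type*} (w : κ → ℂ) (S : Finset ℕ) : constForm w S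
    = if S = ∅ then fun v => algebraMap ℂ RatFn (w v) else 0 := rfl

lemma constForm_injective {κ : Type*} : Function.Injective (constForm (κ := κ)) := by
  intro v w h
  ext k
  have := congrFun (congrFun h ∅) k
  simpa [constForm_apply] using this

lemma constForm_mem_regForms {κ : Type*} (m : ℕ) (w : κ → ℂ) :
    constForm w ∈ regForms ℓ m κ := by
  refine ⟨fun S v => ?_, fun S hS => ?_⟩
  · rw [constForm_apply]
    split_ifs
    · exact (reg ℓ m).algebraMap_mem _
    · exact zero_mem _
  · rw [constForm_apply, if_neg]
    rintro rfl
    exact hS (Finset.empty_subset _)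

lemma exists_eq_constForm {κ : Type*} {x : Form (κ → RatFn)} (hx : x ∈ regForms ℓ ℓ κ) :
    ∃ w, x = constForm w := by
  have h : ∀ v, ∃ z, algebraMap ℂ RatFn z = x ∅ v := fun v => by
    have := hx.1 ∅ v
    rwa [reg_base, Algebra.mem_bot] at this
  choose w hw using h
  refine ⟨w, funext fun S => ?_⟩
  rw [constForm_apply]
  split_ifs with h
  · rw [h]
    exact funext fun v => (hw v).symm
  · refine hx.2 S fun h' => h ?_
    rwa [Finset.Ioc_self, Finset.subset_empty] at h'

lemma sgn_constForm {κ : Type*} (w : κ → ℂ) : sgn (constForm w) = constForm w := by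
  ext S v
  by_cases h : S = ∅ <;> simp [sgn_apply, constForm_apply, h]

lemma sliceForm_constForm {κ : Type*} {m : ℕ} (k : ℕ) (w : Fin (m + 1) × κ → ℂ) :
    sliceForm k (constForm w) = constForm (slice k w) := by
  ext S v
  by_cases h : S = ∅
  · by_cases hk : k < m + 1 <;> simp [mapForm_apply, constForm_apply, slice, h, hk]
  · simp [mapForm_apply, constForm_apply, h]

lemma theta_constForm {κ : Type*} {m : ℕ} (w : Fin (m + 1) × κ → ℂ) : theta ℓ m (constForm w)
    = constForm (slice 0 w) + ∑ i ∈ Finset.Icc 1 m, dlog ℓ i (m + 1) (constForm (slice i w)) := by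
  simp only [theta_apply, sliceForm_constForm, sgn_constForm]

/-- The Orlik-Solomon algebra as an algebra of logarithmic forms. -/
noncomputable def logForm (ℓ n : ℕ) : A ℓ n →ₗ[ℂ] ScalarForm :=
  (LinearMap.applyₗ (constForm (1 : Unit → ℂ)) ∘ₗ
    (LinearMap.restrictScalarsₗ ℂ RatFn ScalarForm ScalarForm ℂ)) ∘ₗ (action ℓ n).toLinearMap

lemma logForm_apply (x : A ℓ n) : logForm ℓ n x = action ℓ n x (constForm 1) := rfl

lemma logForm_a_mul {i j : ℕ} (hi : 1 ≤ i) (hij : i < j) (hj : j ≤ n) (x : A ℓ n) :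
    logForm ℓ n (a ℓ n i j * x) = dlog ℓ i j (logForm ℓ n x) := by
  rw [logForm_apply, map_mul, action_a hi hij hj, logForm_apply, Module.End.mul_apply]

lemma logForm_algebraMap (w : Unit → ℂ) :
    logForm ℓ n (algebraMap ℂ (A ℓ n) (w ())) = constForm w := by
  rw [logForm_apply, AlgHom.commutes, Module.algebraMap_end_apply, ← map_smul]
  congr 1
  ext
  simp

end OrlikSolomon

section Reduction

variable {ℓ n : ℕ}

/-- The scalar residue matrices of a weight function. -/
def scalarRes (c : ℕ → ℕ → ℂ) (i j : ℕ) : Matrix Unit Unit ℂ := fun _ _ => c i j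

lemma act_scalarRes (c : ℕ → ℕ → ℂ) (i j : ℕ) (f : Unit → RatFn) :
    act (scalarRes c i j) f = c i j • f := by
  ext
  simp [act_apply, scalarRes]

lemma mapForm_act_scalarRes (c : ℕ → ℕ → ℂ) (i j : ℕ) (x : ScalarForm) :
    mapForm (act (scalarRes c i j)) x = c i j • x :=
  funext fun S => act_scalarRes c i j (x S)

/-- Multiplication by the logarithmic one-form of a weight function. -/
noncomputable def logMul (ℓ n : ℕ) (c : ℕ → ℕ → ℂ) : ScalarForm →ₗ[RatFn] ScalarForm :=
  ∑ i ∈ Finset.Icc 1 n, ∑ j ∈ Finset.Icc 1 n, c i j • dlog ℓ i j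

lemma logMul_apply (c : ℕ → ℕ → ℂ) (x : ScalarForm) : logMul ℓ n c x
    = ∑ i ∈ Finset.Icc 1 n, ∑ j ∈ Finset.Icc 1 n, c i j • dlog ℓ i j x := by
  simp [logMul]

lemma logMul_dlog (c : ℕ → ℕ → ℂ) (k l : ℕ) (x : ScalarForm) :
    logMul ℓ n c (dlog ℓ k l x) = -dlog ℓ k l (logMul ℓ n c x) := by
  simp only [logMul_apply, map_sum, ← Finset.sum_neg_distrib]
  refine Finset.sum_congr rfl fun i _ => Finset.sum_congr rfl fun j _ => ?_
  rw [dlog_anticomm, smul_neg, LinearMap.map_smul_of_tower]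

lemma logMul_logMul (c : ℕ → ℕ → ℂ) (x : ScalarForm) : logMul ℓ n c (logMul ℓ n c x) = 0 := by
  apply eq_zero_of_eq_neg
  conv_lhs => rw [logMul_apply c x]
  conv_rhs => rw [logMul_apply]
  simp only [map_sum, ← Finset.sum_neg_distrib]
  refine Finset.sum_congr rfl fun i _ => Finset.sum_congr rfl fun j _ => ?_
  rw [LinearMap.map_smul_of_tower, logMul_dlog, smul_neg]

lemma extd_logMul (c : ℕ → ℕ → ℂ) (x : ScalarForm) :
    extd ℓ n (logMul ℓ n c x) = -logMul ℓ n c (extd ℓ n x) := by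
  simp only [logMul_apply, map_sum, ← Finset.sum_neg_distrib]
  refine Finset.sum_congr rfl fun i hi => Finset.sum_congr rfl fun j hj => ?_
  rw [map_smul, extd_dlog (Finset.mem_Icc.1 hi).2 (Finset.mem_Icc.1 hj).2, smul_neg]

/-- The twisted exterior derivative of a weight function. -/
noncomputable def nabla (ℓ n : ℕ) (c : ℕ → ℕ → ℂ) : ScalarForm →ₗ[ℂ] ScalarForm :=
  extd ℓ n + (logMul ℓ n c).restrictScalars ℂ

lemma nabla_apply (c : ℕ → ℕ → ℂ) (x : ScalarForm) :
    nabla ℓ n c x = extd ℓ n x + logMul ℓ n c x := rfl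

lemma conn_scalarRes (c : ℕ → ℕ → ℂ) (x : ScalarForm) :
    conn ℓ n n (scalarRes c) 0 x = nabla ℓ n c x := by
  have h0 : sgn (mapForm (act (0 : Matrix Unit Unit ℂ)) x) = 0 := by
    have : mapForm (act (0 : Matrix Unit Unit ℂ)) x = 0 :=
      funext fun S => act_zero (x S)
    rw [this, map_zero]
  simp only [conn_apply, nabla_apply, logMul_apply, mapForm_act_scalarRes, h0, add_zero,
    LinearMap.map_smul_of_tower]

lemma nabla_nabla (c : ℕ → ℕ → ℂ) (x : ScalarForm) : nabla ℓ n c (nabla ℓ n c x) = 0 := by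
  simp only [nabla_apply, map_add, extd_extd, extd_logMul, logMul_logMul]
  abel

/-- The twisted de Rham complex in `n - ℓ` variables, reduced to `m - ℓ` variables by
integration along fibres. -/
structure Reduction (ℓ n m : ℕ) (c : ℕ → ℕ → ℂ) (κ : Type) [Fintype κ] where
  /-- The residues of the reduced connection. -/
  res : ℕ → ℕ → Matrix κ κ ℂ
  /-- The constant part of the reduced connection. -/
  const : Matrix κ κ ℂ
  /-- The inclusion of the reduced complex. -/
  incl : Form (κ → RatFn) →ₗ[RatFn] ScalarForm
  /-- The constants of the reduced complex in the Orlik-Solomon algebra. -/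
  elt : (κ → ℂ) →ₗ[ℂ] A ℓ n
  res_symm : ∀ i j, res i j = res j i
  res_self : ∀ i, res i i = 0
  nonresonant : Nonresonant m res
  incl_conn : ∀ x, incl (conn ℓ n m res const x) = nabla ℓ n c (incl x)
  incl_dlog : ∀ i j x, incl (dlog ℓ i j x) = dlog ℓ i j (incl x)
  incl_mem : ∀ x ∈ regForms ℓ m κ, incl x ∈ regForms ℓ n Unit
  eq_zero_of_incl : ∀ x ∈ regForms ℓ m κ, incl x = 0 → x = 0
  exists_sub : ∀ x ∈ regForms ℓ n Unit, (∃ z ∈ regForms ℓ m κ, nabla ℓ n c x = incl z) →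
    ∃ y ∈ regForms ℓ n Unit, ∃ z ∈ regForms ℓ m κ, x - nabla ℓ n c y = incl z
  logForm_elt : ∀ w, logForm ℓ n (elt w) = incl (constForm w)
  eq_top : ∀ T : Submodule ℂ (A ℓ n), (∀ w, elt w ∈ T) →
    (∀ i j, 1 ≤ i → i < j → j ≤ m → ∀ t ∈ T, a ℓ n i j * t ∈ T) → T = ⊤

/-- The reduction that changes nothing. -/
noncomputable def Reduction.start {c : ℕ → ℕ → ℂ} (hc : ∀ i j, c i j = c j i)
    (hc0 : ∀ i, c i i = 0) (hN : Nonresonant n (scalarRes c)) : Reduction ℓ n n c Unit where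
  res := scalarRes c
  const := 0
  incl := LinearMap.id
  elt := Algebra.linearMap ℂ (A ℓ n) ∘ₗ LinearMap.proj ()
  res_symm i j := by
    ext
    exact hc i j
  res_self i := by
    ext
    exact hc0 i
  nonresonant := hN
  incl_conn x := conn_scalarRes c x
  incl_dlog i j x := rfl
  incl_mem x hx := hx
  eq_zero_of_incl x _ h := h
  exists_sub x hx _ := ⟨0, zero_mem _, x, hx, by simp⟩
  logForm_elt w := logForm_algebraMap w
  eq_top T h1 hT := eq_top_of_one_mem (by simpa using h1 1) hT

lemma span_step {m : ℕ} {κ : Type} (hm : m + 1 ≤ n) {φ : (κ → ℂ) →ₗ[ℂ] A ℓ n}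
    (hφ : ∀ T : Submodule ℂ (A ℓ n), (∀ w, φ w ∈ T) →
      (∀ i j, 1 ≤ i → i < j → j ≤ m + 1 → ∀ t ∈ T, a ℓ n i j * t ∈ T) → T = ⊤)
    {T : Submodule ℂ (A ℓ n)} (h0 : ∀ w, φ w ∈ T)
    (h1 : ∀ i, 1 ≤ i → i ≤ m → ∀ w, a ℓ n i (m + 1) * φ w ∈ T)
    (hT : ∀ i j, 1 ≤ i → i < j → j ≤ m → ∀ t ∈ T, a ℓ n i j * t ∈ T) : T = ⊤ := by
  let U : Submodule ℂ (A ℓ n) := T ⊓ ⨅ i ∈ Finset.Icc 1 m,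
    T.comap (LinearMap.mulLeft ℂ (a ℓ n i (m + 1)))
  have hU : ∀ t, t ∈ U ↔ t ∈ T ∧ ∀ i, 1 ≤ i → i ≤ m → a ℓ n i (m + 1) * t ∈ T := by
    intro t
    simp [U]
  have hlt : ∀ k i, 1 ≤ k → k < i → i ≤ m → ∀ t ∈ U,
      a ℓ n k (m + 1) * (a ℓ n i (m + 1) * t) ∈ T := by
    intro k i hk hki hi t ht
    have ht := (hU t).1 ht
    have h := congrArg (· * t) (a_arnold (ℓ := ℓ) hk hki (Nat.lt_succ_of_le hi) hm)
    simp only [add_mul, sub_mul, mul_assoc, zero_mul] at h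
    rw [eq_neg_of_add_eq_zero_right h]
    exact T.neg_mem (T.sub_mem (hT k i hk hki hi _ (ht.2 k hk (by omega)))
      (hT k i hk hki hi _ (ht.2 i (by omega) hi)))
  have : U = ⊤ := by
    refine hφ U (fun w => (hU _).2 ⟨h0 w, fun i hi him => h1 i hi him w⟩) ?_
    intro i j hi hij hj t ht
    have ht' := (hU t).1 ht
    rcases hj.lt_or_eq with hj | rfl
    · refine (hU _).2 ⟨hT i j hi hij (by omega) t ht'.1, fun k hk hkm => ?_⟩
      rw [← mul_assoc, a_anticomm, neg_mul, mul_assoc]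
      exact T.neg_mem (hT i j hi hij (by omega) _ (ht'.2 k hk hkm))
    · refine (hU _).2 ⟨ht'.2 i hi (by omega), fun k hk hkm => ?_⟩
      rcases lt_trichotomy k i with hki | rfl | hki
      · exact hlt k i hk hki (by omega) t ht
      · rw [← mul_assoc, a_mul_self, zero_mul]
        exact zero_mem _
      · rw [← mul_assoc, a_anticomm, neg_mul, mul_assoc]
        exact T.neg_mem (hlt i k hi hki hkm t ht)
  rw [eq_top_iff, ← this]
  exact inf_le_left

/-- Integration along one more fibre. -/
noncomputable def Reduction.next {m : ℕ} {c : ℕ → ℕ → ℂ} {κ : Type} [Fintype κ] [DecidableEq κ]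
    (hm : ℓ ≤ m) (hmn : m + 1 ≤ n) (r : Reduction ℓ n (m + 1) c κ) :
    Reduction ℓ n m c (Fin (m + 1) × κ) where
  res := nextRes r.res m
  const := nextConst r.res r.const m
  incl := r.incl ∘ₗ theta ℓ m
  elt := r.elt ∘ₗ slice 0
    + ∑ i ∈ Finset.Icc 1 m, LinearMap.mulLeft ℂ (a ℓ n i (m + 1)) ∘ₗ r.elt ∘ₗ slice i
  res_symm := nextRes_symm r.res_symm
  res_self := nextRes_self r.res_self
  nonresonant := r.nonresonant.next r.res_symm r.res_self
  incl_conn x := by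
    rw [LinearMap.comp_apply, theta_conn hmn r.res_symm, r.incl_conn, LinearMap.comp_apply]
  incl_dlog i j x := by
    rw [LinearMap.comp_apply, theta_dlog, r.incl_dlog, LinearMap.comp_apply]
  incl_mem x hx := r.incl_mem _ (theta_mem_regForms hx)
  eq_zero_of_incl x hx h := eq_zero_of_theta_eq_zero hm hx
    (r.eq_zero_of_incl _ (theta_mem_regForms hx) h)
  exists_sub x hx := by
    rintro ⟨z, hz, hxz⟩
    rw [LinearMap.comp_apply] at hxz
    obtain ⟨y, hy, x₁, hx₁, hxy⟩ := r.exists_sub x hx ⟨_, theta_mem_regForms hz, hxz⟩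
    have hinj : ∀ u ∈ regForms ℓ (m + 1) κ, ∀ v ∈ regForms ℓ (m + 1) κ,
        r.incl u = r.incl v → u = v := fun u hu v hv h => by
      rw [← sub_eq_zero] at h ⊢
      rw [← map_sub] at h
      exact r.eq_zero_of_incl _ (sub_mem hu hv) h
    have hsq : ∀ u ∈ regForms ℓ (m + 1) κ, conn ℓ n (m + 1) r.res r.const
        (conn ℓ n (m + 1) r.res r.const u) = 0 := by
      intro u hu
      refine r.eq_zero_of_incl _ (conn_mem_regForms n _ _ (conn_mem_regForms n _ _ hu)) ?_
      rw [r.incl_conn, r.incl_conn, nabla_nabla]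
    have hdx : conn ℓ n (m + 1) r.res r.const x₁ = theta ℓ m z := by
      refine hinj _ (conn_mem_regForms n _ _ hx₁) _ (theta_mem_regForms hz) ?_
      rw [r.incl_conn, ← hxy, map_sub, nabla_nabla, sub_zero, hxz]
    obtain ⟨y₁, hy₁, z₁, hz₁, h⟩ := exists_sub_conn_eq_theta hm hmn r.res_symm r.const
      (r.nonresonant.fiber r.res_symm r.res_self) hsq hx₁ ⟨z, hz, hdx⟩
    refine ⟨y + r.incl y₁, add_mem hy (r.incl_mem _ hy₁), z₁, hz₁, ?_⟩
    rw [LinearMap.comp_apply, ← h, map_sub, ← hxy, r.incl_conn, map_add, sub_sub]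
  logForm_elt w := by
    have h : ∀ i ∈ Finset.Icc 1 m, logForm ℓ n (a ℓ n i (m + 1) * r.elt (slice i w))
        = r.incl (dlog ℓ i (m + 1) (constForm (slice i w))) := fun i hi => by
      have hi := Finset.mem_Icc.1 hi
      rw [logForm_a_mul hi.1 (by omega) hmn, r.logForm_elt, r.incl_dlog]
    rw [LinearMap.comp_apply, theta_constForm, map_add, map_sum, ← r.logForm_elt,
      ← Finset.sum_congr rfl h, ← map_sum, ← map_add]
    simp
  eq_top T hw hT := by
    have key : ∀ (f : ℕ → κ → ℂ), r.elt (f 0)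
        + ∑ i ∈ Finset.Icc 1 m, a ℓ n i (m + 1) * r.elt (f i) ∈ T := by
      intro f
      have hs : ∀ k < m + 1, slice k (fun p : Fin (m + 1) × κ => f p.1 p.2) = f k := by
        intro k hk
        ext v
        rw [slice_apply hk]
      have := hw fun p => f p.1 p.2
      simp only [LinearMap.add_apply, LinearMap.sum_apply, LinearMap.comp_apply,
        LinearMap.mulLeft_apply, hs 0 m.succ_pos] at this
      rwa [Finset.sum_congr rfl fun i hi => by
        rw [hs i (by have := Finset.mem_Icc.1 hi; omega)]] at this
    refine span_step hmn r.eq_top (fun w => ?_) (fun i hi him w => ?_) hT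
    · have := key (Pi.single 0 w)
      rwa [Finset.sum_eq_zero, add_zero, Pi.single_eq_same] at this
      intro i hi
      have := Finset.mem_Icc.1 hi
      rw [Pi.single_eq_of_ne (by omega), map_zero, mul_zero]
    · have := key (Pi.single i w)
      rwa [Pi.single_eq_of_ne (by omega), map_zero, zero_add, Finset.sum_eq_single i,
        Pi.single_eq_same] at this
      · intro j _ hj
        rw [Pi.single_eq_of_ne hj, map_zero, mul_zero]
      · intro h
        exact absurd (Finset.mem_Icc.2 ⟨hi, him⟩) h

theorem exists_reduction {c : ℕ → ℕ → ℂ} (hc : ∀ i j, c i j = c j i) (hc0 : ∀ i, c i i = 0)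
    (hN : Nonresonant n (scalarRes c)) (hn : ℓ ≤ n) :
    ∃ (κ : Type) (_ : Fintype κ), Nonempty (Reduction ℓ n ℓ c κ) := by
  have : ∃ (κ : Type) (_ : Fintype κ) (_ : DecidableEq κ), Nonempty (Reduction ℓ n ℓ c κ) := by
    refine Nat.decreasingInduction' (P := fun m => ∃ (κ : Type) (_ : Fintype κ)
      (_ : DecidableEq κ), Nonempty (Reduction ℓ n m c κ)) ?_ hn
      ⟨Unit, inferInstance, inferInstance, ⟨Reduction.start hc hc0 hN⟩⟩
    rintro m hm hℓ ⟨κ, _, _, ⟨r⟩⟩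
    exact ⟨Fin (m + 1) × κ, inferInstance, inferInstance, ⟨r.next hℓ hm⟩⟩
  obtain ⟨κ, i, _, h⟩ := this
  exact ⟨κ, i, h⟩

lemma Reduction.elt_surjective {c : ℕ → ℕ → ℂ} {κ : Type} [Fintype κ]
    (r : Reduction ℓ n ℓ c κ) : Function.Surjective r.elt := by
  rw [← LinearMap.range_eq_top]
  refine r.eq_top _ (fun w => LinearMap.mem_range_self _ w) fun i j _ _ hj t _ => ?_
  rw [a_eq_zero hj, zero_mul]
  exact zero_mem _

lemma Reduction.logForm_injective {c : ℕ → ℕ → ℂ} {κ : Type} [Fintype κ]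
    (r : Reduction ℓ n ℓ c κ) : Function.Injective (logForm ℓ n) := by
  rw [injective_iff_map_eq_zero]
  intro x hx
  obtain ⟨w, rfl⟩ := r.elt_surjective x
  rw [r.logForm_elt] at hx
  have := r.eq_zero_of_incl _ (constForm_mem_regForms ℓ w) hx
  rw [constForm_injective (this.trans (map_zero _).symm), map_zero]

lemma Reduction.logForm_mem {c : ℕ → ℕ → ℂ} {κ : Type} [Fintype κ]
    (r : Reduction ℓ n ℓ c κ) (x : A ℓ n) : logForm ℓ n x ∈ regForms ℓ n Unit := by
  obtain ⟨w, rfl⟩ := r.elt_surjective x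
  rw [r.logForm_elt]
  exact r.incl_mem _ (constForm_mem_regForms ℓ w)

/-- A form whose differential lies in the Orlik-Solomon algebra does so up to an exact form. -/
theorem Reduction.exists_logForm {c : ℕ → ℕ → ℂ} {κ : Type} [Fintype κ]
    (r : Reduction ℓ n ℓ c κ) {x : ScalarForm} (hx : x ∈ regForms ℓ n Unit) {b : A ℓ n}
    (hb : nabla ℓ n c x = logForm ℓ n b) :
    ∃ y ∈ regForms ℓ n Unit, ∃ b', x - nabla ℓ n c y = logForm ℓ n b' := by
  obtain ⟨w, rfl⟩ := r.elt_surjective b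
  obtain ⟨y, hy, z, hz, h⟩ := r.exists_sub x hx
    ⟨_, constForm_mem_regForms ℓ w, hb.trans (r.logForm_elt w)⟩
  obtain ⟨w', rfl⟩ := exists_eq_constForm hz
  exact ⟨y, hy, r.elt w', h.trans (r.logForm_elt w').symm⟩

end Reduction

section Weights

variable {ℓ n : ℕ}

/-- The weight of a pair of indices, zero for pairs which are not hyperplanes. -/
noncomputable def wt (lam : Idx ℓ n → ℂ) (i j : ℕ) : ℂ :=
  if h : 1 ≤ i ∧ i < j ∧ ℓ + 1 ≤ j ∧ j ≤ n then lam ⟨(i, j), h⟩ else 0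

/-- The symmetrised weights. -/
noncomputable def symWt (lam : Idx ℓ n → ℂ) (i j : ℕ) : ℂ := (wt lam i j + wt lam j i) / 2

lemma wt_eq_zero (lam : Idx ℓ n → ℂ) {i j : ℕ} (h : ¬(1 ≤ i ∧ i < j ∧ ℓ + 1 ≤ j ∧ j ≤ n)) :
    wt lam i j = 0 := dif_neg h

lemma symWt_symm (lam : Idx ℓ n → ℂ) (i j : ℕ) : symWt lam i j = symWt lam j i := by
  rw [symWt, symWt, add_comm]

lemma symWt_self (lam : Idx ℓ n → ℂ) (i : ℕ) : symWt lam i i = 0 := by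
  rw [symWt, wt_eq_zero lam (by omega), add_zero, zero_div]

lemma omegaI_eq (lam : Idx ℓ n → ℂ) : omegaI ℓ n lam
    = ∑ j ∈ Finset.Icc (ℓ + 1) n, ∑ i ∈ Finset.Ico 1 j, wt lam i j • a ℓ n i j := rfl

lemma logMul_symWt (lam : Idx ℓ n → ℂ) (x : ScalarForm) :
    logMul ℓ n (symWt lam) x = action ℓ n (omegaI ℓ n lam) x := by
  have h1 : logMul ℓ n (symWt lam) x
      = ∑ j ∈ Finset.Icc 1 n, ∑ i ∈ Finset.Icc 1 n, wt lam i j • dlog ℓ i j x := by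
    have h : ∀ i j, symWt lam i j • dlog ℓ i j x = (2⁻¹ : ℂ) • (wt lam i j • dlog ℓ i j x)
        + (2⁻¹ : ℂ) • (wt lam j i • dlog ℓ j i x) := by
      intro i j
      rw [dlog_symm ℓ j i, smul_smul, smul_smul, ← add_smul, symWt]
      congr 1
      ring
    simp only [logMul_apply, h, Finset.sum_add_distrib, ← Finset.smul_sum]
    rw [Finset.sum_comm, ← smul_add, ← two_smul ℂ, smul_smul]
    norm_num
  rw [h1, omegaI_eq, map_sum, LinearMap.sum_apply]
  symm
  refine Finset.sum_subset_zero_on_sdiff (Finset.Icc_subset_Icc_left (by omega)) ?_ ?_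
  · intro j hj
    simp only [Finset.mem_sdiff, Finset.mem_Icc] at hj
    exact Finset.sum_eq_zero fun i _ => by rw [wt_eq_zero lam (by omega), zero_smul]
  · intro j hj
    have hj := Finset.mem_Icc.1 hj
    rw [map_sum, LinearMap.sum_apply]
    refine Finset.sum_subset_zero_on_sdiff ?_ ?_ ?_
    · intro i hi
      have := Finset.mem_Ico.1 hi
      exact Finset.mem_Icc.2 ⟨by omega, by omega⟩
    · intro i hi
      simp only [Finset.mem_sdiff, Finset.mem_Icc, Finset.mem_Ico] at hi
      rw [wt_eq_zero lam (by omega), zero_smul]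
    · intro i hi
      have hi := Finset.mem_Ico.1 hi
      rw [map_smul, action_a hi.1 hi.2 hj.2, LinearMap.smul_apply]

lemma extd_logForm (b : A ℓ n) : extd ℓ n (logForm ℓ n b) = 0 := by
  have h : LinearMap.ker (extd ℓ n ∘ₗ logForm ℓ n) = ⊤ := by
    refine eq_top_of_one_mem ?_ fun i j hi hij hj t ht => ?_
    · rw [LinearMap.mem_ker, LinearMap.comp_apply, logForm_apply, map_one, Module.End.one_apply,
        extd_apply]
      refine Finset.sum_eq_zero fun j _ => ?_
      have : pdForm j (constForm (1 : Unit → ℂ)) = 0 := by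
        ext S v
        rw [pdForm_apply, constForm_apply]
        split_ifs
        · exact Derivation.map_algebraMap _ _
        · exact map_zero _
      rw [this, map_zero]
    · rw [LinearMap.mem_ker, LinearMap.comp_apply] at ht ⊢
      rw [logForm_a_mul hi hij hj, extd_dlog (hij.le.trans hj) hj, ht, map_zero, neg_zero]
  exact LinearMap.congr_fun (LinearMap.ker_eq_top.1 h) b

lemma nabla_logForm (lam : Idx ℓ n → ℂ) (b : A ℓ n) :
    nabla ℓ n (symWt lam) (logForm ℓ n b) = logForm ℓ n (omegaI ℓ n lam * b) := by
  rw [nabla_apply, extd_logForm, zero_add, logMul_symWt, logForm_apply, logForm_apply, map_mul,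
    Module.End.mul_apply]

end Weights

section Degree

variable {ℓ n : ℕ}

/-- The homogeneous component of degree `q` of a form. -/
noncomputable def degProj (q : ℕ) : ScalarForm →ₗ[RatFn] ScalarForm where
  toFun x S := if S.card = q then x S else 0
  map_add' x y := by
    ext S : 1
    by_cases h : S.card = q <;> simp [h]
  map_smul' z x := by
    ext S : 1
    by_cases h : S.card = q <;> simp [h]

lemma degProj_apply (q : ℕ) (x : ScalarForm) (S : Finset ℕ) :
    degProj q x S = if S.card = q then x S else 0 := rfl

lemma degProj_degProj (q : ℕ) (x : ScalarForm) : degProj q (degProj q x) = degProj q x := by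
  ext S : 1
  simp only [degProj_apply]
  split_ifs <;> rfl

lemma degProj_mem_regForms {m : ℕ} (q : ℕ) {x : ScalarForm} (hx : x ∈ regForms ℓ m Unit) :
    degProj q x ∈ regForms ℓ m Unit := by
  refine ⟨fun S w => ?_, fun S hS => ?_⟩
  · rw [degProj_apply]
    split_ifs
    · exact hx.1 S w
    · exact zero_mem _
  · rw [degProj_apply, hx.2 S hS, ite_self]

/-- A map of forms raising degrees by one. -/
def RaisesDegree (f : ScalarForm → ScalarForm) : Prop :=
  (∀ x, degProj 0 (f x) = 0) ∧ ∀ q x, degProj (q + 1) (f x) = f (degProj q x)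

lemma RaisesDegree.zero : RaisesDegree fun _ => 0 :=
  ⟨fun _ => map_zero _, fun _ _ => map_zero _⟩

lemma RaisesDegree.add {f g : ScalarForm → ScalarForm} (hf : RaisesDegree f)
    (hg : RaisesDegree g) : RaisesDegree fun x => f x + g x :=
  ⟨fun x => by rw [map_add, hf.1, hg.1, add_zero], fun q x => by rw [map_add, hf.2, hg.2]⟩

lemma RaisesDegree.smul {f : ScalarForm → ScalarForm} (hf : RaisesDegree f) (z : RatFn) :
    RaisesDegree fun x => z • f x :=
  ⟨fun x => by rw [map_smul, hf.1, smul_zero], fun q x => by rw [map_smul, hf.2]⟩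

lemma RaisesDegree.smul_complex {f : ScalarForm → ScalarForm} (hf : RaisesDegree f) (z : ℂ) :
    RaisesDegree fun x => z • f x :=
  ⟨fun x => by rw [LinearMap.map_smul_of_tower, hf.1, smul_zero],
    fun q x => by rw [LinearMap.map_smul_of_tower, hf.2]⟩

lemma RaisesDegree.sum {ι : Type*} {f : ι → ScalarForm → ScalarForm} (s : Finset ι)
    (hf : ∀ i ∈ s, RaisesDegree (f i)) : RaisesDegree fun x => ∑ i ∈ s, f i x :=
  ⟨fun x => by rw [map_sum]; exact Finset.sum_eq_zero fun i hi => (hf i hi).1 x,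
    fun q x => by rw [map_sum]; exact Finset.sum_congr rfl fun i hi => (hf i hi).2 q x⟩

lemma raisesDegree_eps (j : ℕ) : RaisesDegree (eps j) := by
  refine ⟨fun x => ?_, fun q x => ?_⟩
  · ext S : 1
    rw [degProj_apply, eps_apply]
    split_ifs with h h'
    · rw [Finset.card_eq_zero.1 h] at h'
      exact absurd h' (Finset.notMem_empty j)
    · rfl
    · rfl
  · ext S : 1
    rw [degProj_apply, eps_apply, eps_apply]
    by_cases h : j ∈ S
    · rw [if_pos h, if_pos h, degProj_apply, Finset.card_erase_of_mem h]
      have := Finset.card_pos.2 ⟨j, h⟩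
      by_cases hq : S.card = q + 1
      · rw [if_pos hq, if_pos (by omega)]
      · rw [if_neg hq, if_neg (by omega), smul_zero]
    · rw [if_neg h, if_neg h, ite_self]

lemma raisesDegree_dlog (i j : ℕ) : RaisesDegree (dlog ℓ i j) := by
  have h : ∀ k, RaisesDegree (epsVar ℓ k) := by
    intro k
    by_cases hk : ℓ < k
    · simpa only [epsVar, if_pos hk] using raisesDegree_eps k
    · rw [epsVar, if_neg hk]
      exact RaisesDegree.zero
  have : (dlog ℓ i j : ScalarForm → ScalarForm)
      = fun x => (pt ℓ i - pt ℓ j)⁻¹ • (epsVar ℓ i x + (-1 : RatFn) • epsVar ℓ j x) := by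
    ext x : 1
    rw [dlog_apply, neg_one_smul, ← sub_eq_add_neg]
  rw [this]
  exact ((h i).add ((h j).smul _)).smul _

lemma raisesDegree_nabla (c : ℕ → ℕ → ℂ) : RaisesDegree (nabla ℓ n c) := by
  have : (nabla ℓ n c : ScalarForm → ScalarForm) = fun x =>
      ∑ j ∈ Finset.Ioc ℓ n, eps j (pdForm j x)
        + ∑ i ∈ Finset.Icc 1 n, ∑ j ∈ Finset.Icc 1 n, c i j • dlog ℓ i j x := by
    ext x : 1
    rw [nabla_apply, extd_apply, logMul_apply]
  rw [this]
  refine (RaisesDegree.sum _ fun j _ => ⟨fun x => (raisesDegree_eps j).1 _, fun q x => ?_⟩).add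
    (RaisesDegree.sum _ fun i _ => RaisesDegree.sum _ fun j _ =>
      (raisesDegree_dlog i j).smul_complex _)
  rw [(raisesDegree_eps j).2]
  congr 1
  ext S w
  simp only [pdForm_apply, degProj_apply]
  split_ifs
  · rfl
  · exact (map_zero _).symm

lemma raisesDegree_dlogLin (v : Idx ℓ n →₀ ℂ) : RaisesDegree (dlogLin ℓ n v) := by
  induction v using Finsupp.induction_linear with
  | zero =>
    rw [map_zero]
    exact RaisesDegree.zero
  | add u v hu hv =>
    rw [map_add]
    exact hu.add hv
  | single p z =>
    rw [dlogLin, Finsupp.linearCombination_single]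
    exact (raisesDegree_dlog _ _).smul_complex z

lemma degProj_constForm (w : Unit → ℂ) (q : ℕ) :
    degProj q (constForm w) = if q = 0 then constForm w else 0 := by
  ext S : 1
  rw [degProj_apply, constForm_apply]
  by_cases hS : S = ∅
  · subst hS
    by_cases hq : q = 0
    · subst hq
      simp [constForm_apply]
    · rw [if_neg hq, Finset.card_empty, if_neg (Ne.symm hq)]
      rfl
  · rw [if_neg hS, ite_self]
    split_ifs
    · rw [constForm_apply, if_neg hS]
    · rfl

lemma degProj_logForm {q : ℕ} {b : A ℓ n} (hb : b ∈ Adeg ℓ n q) :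
    degProj q (logForm ℓ n b) = logForm ℓ n b := by
  obtain ⟨e, he, rfl⟩ := hb
  induction q generalizing e with
  | zero =>
    rw [SetLike.mem_coe, Edeg, pow_zero, Submodule.mem_one] at he
    obtain ⟨z, rfl⟩ := he
    rw [AlgHom.toLinearMap_apply, AlgHom.commutes, logForm_algebraMap fun _ => z,
      degProj_constForm, if_pos rfl]
  | succ q ih =>
    rw [SetLike.mem_coe, Edeg, pow_succ'] at he
    induction he using Submodule.mul_induction_on' with
    | mem_mul_mem x hx y hy =>
      obtain ⟨v, rfl⟩ := hx
      have h : logForm ℓ n (projA ℓ n (ExteriorAlgebra.ι ℂ v * y))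
          = dlogLin ℓ n v (logForm ℓ n (projA ℓ n y)) := by
        rw [logForm_apply, logForm_apply, map_mul, map_mul, Module.End.mul_apply, action_projA,
          extAction, ExteriorAlgebra.lift_ι_apply]
      rw [AlgHom.toLinearMap_apply, h, (raisesDegree_dlogLin v).2]
      congr 1
      exact ih y hy
    | add x _ y _ hx hy => rw [map_add, map_add, map_add, hx, hy]

lemma one_mem_Adeg_zero : (1 : A ℓ n) ∈ Adeg ℓ n 0 := by
  refine ⟨1, ?_, map_one (projA ℓ n)⟩
  rw [Edeg, pow_zero]
  exact Submodule.one_le.1 le_rfl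

lemma a_mul_mem_Adeg {q : ℕ} (i j : ℕ) {b : A ℓ n} (hb : b ∈ Adeg ℓ n q) :
    a ℓ n i j * b ∈ Adeg ℓ n (q + 1) := by
  obtain ⟨e, he, rfl⟩ := hb
  refine ⟨gen ℓ n i j * e, ?_, map_mul (projA ℓ n) _ _⟩
  rw [Edeg, pow_succ']
  refine Submodule.mul_mem_mul ?_ he
  rw [gen]
  split_ifs
  · exact LinearMap.mem_range_self _ _
  · exact zero_mem _

lemma omegaI_mul_mem_Adeg {q : ℕ} (lam : Idx ℓ n → ℂ) {b : A ℓ n} (hb : b ∈ Adeg ℓ n q) :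
    omegaI ℓ n lam * b ∈ Adeg ℓ n (q + 1) := by
  rw [omegaI_eq, Finset.sum_mul]
  refine Submodule.sum_mem _ fun j _ => ?_
  rw [Finset.sum_mul]
  refine Submodule.sum_mem _ fun i _ => ?_
  rw [smul_mul_assoc]
  exact Submodule.smul_mem _ _ (a_mul_mem_Adeg i j hb)

lemma exists_logForm_eq_degProj (q : ℕ) (b : A ℓ n) :
    ∃ b' ∈ Adeg ℓ n q, logForm ℓ n b' = degProj q (logForm ℓ n b) := by
  let T : Submodule ℂ (A ℓ n) := ⨅ q, ((Adeg ℓ n q).map (logForm ℓ n)).comap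
    ((degProj q).restrictScalars ℂ ∘ₗ logForm ℓ n)
  have hT : ∀ b, b ∈ T ↔ ∀ q, ∃ b' ∈ Adeg ℓ n q, logForm ℓ n b' = degProj q (logForm ℓ n b) := by
    intro b
    simp [T]
  have : T = ⊤ := by
    refine eq_top_of_one_mem ((hT _).2 fun q => ?_) fun i j hi hij hj t ht => (hT _).2 fun q => ?_
    · have h1 : logForm ℓ n 1 = constForm 1 := by
        rw [logForm_apply, map_one, Module.End.one_apply]
      rw [h1, degProj_constForm]
      split_ifs with hq
      · subst hq
        exact ⟨1, one_mem_Adeg_zero, h1⟩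
      · exact ⟨0, zero_mem _, map_zero _⟩
    · rw [logForm_a_mul hi hij hj]
      cases q with
      | zero => exact ⟨0, zero_mem _, by rw [map_zero, (raisesDegree_dlog i j).1]⟩
      | succ q =>
        obtain ⟨b', hb', h⟩ := (hT t).1 ht q
        exact ⟨a ℓ n i j * b', a_mul_mem_Adeg i j hb', by
          rw [logForm_a_mul hi hij hj, h, (raisesDegree_dlog i j).2]⟩
  exact (hT b).1 (this ▸ Submodule.mem_top) q

end Degree

section Comparison

/-- A map inducing an isomorphism of subquotients preserves their dimension. -/
lemma finrank_subquotient_eq {V W : Type*} [AddCommGroup V] [Module ℂ V] [AddCommGroup W]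
    [Module ℂ W] {Z B : Submodule ℂ V} {Z' B' : Submodule ℂ W} (f : V →ₗ[ℂ] W)
    (hZ : ∀ z ∈ Z, f z ∈ Z') (hB : ∀ z ∈ Z, (f z ∈ B' ↔ z ∈ B))
    (hs : ∀ z' ∈ Z', ∃ z ∈ Z, z' - f z ∈ B') :
    Module.finrank ℂ (Z ⧸ B.comap Z.subtype) = Module.finrank ℂ (Z' ⧸ B'.comap Z'.subtype) := by
  let g : Z →ₗ[ℂ] Z' := f.restrict hZ
  have hg : B.comap Z.subtype = (B'.comap Z'.subtype).comap g := by
    ext z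
    exact (hB z z.2).symm
  refine (LinearEquiv.ofBijective
    (Submodule.mapQ (B.comap Z.subtype) (B'.comap Z'.subtype) g hg.le) ⟨?_, ?_⟩).finrank_eq
  · rw [← LinearMap.ker_eq_bot, Submodule.ker_mapQ, ← hg, Submodule.mkQ_map_self]
  · intro z'
    obtain ⟨z', rfl⟩ := Submodule.Quotient.mk_surjective _ z'
    obtain ⟨z, hz, h⟩ := hs z' z'.2
    refine ⟨Submodule.Quotient.mk ⟨z, hz⟩, ?_⟩
    rw [Submodule.mapQ_apply, eq_comm, Submodule.Quotient.eq]
    exact h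

variable {ℓ n : ℕ}

/-- The closed regular forms of degree `k`. -/
noncomputable def formCocycles (ℓ n k : ℕ) (c : ℕ → ℕ → ℂ) : Submodule ℂ ScalarForm :=
  (regForms ℓ n Unit ⊓ LinearMap.eqLocus ((degProj k).restrictScalars ℂ) LinearMap.id)
    ⊓ LinearMap.ker (nabla ℓ n c)

/-- The differentials of regular forms of degree `k - 1`. -/
noncomputable def formCoboundaries (ℓ n k : ℕ) (c : ℕ → ℕ → ℂ) : Submodule ℂ ScalarForm :=
  if k = 0 then ⊥ else (regForms ℓ n Unit ⊓
    LinearMap.eqLocus ((degProj (k - 1)).restrictScalars ℂ) LinearMap.id).map (nabla ℓ n c)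

/-- The dimension of the twisted de Rham cohomology in degree `k`. -/
noncomputable def formHdim (ℓ n k : ℕ) (c : ℕ → ℕ → ℂ) : ℕ :=
  Module.finrank ℂ (formCocycles ℓ n k c ⧸
    (formCoboundaries ℓ n k c).comap (formCocycles ℓ n k c).subtype)

lemma mem_formCocycles {k : ℕ} {c : ℕ → ℕ → ℂ} {x : ScalarForm} : x ∈ formCocycles ℓ n k c ↔
    x ∈ regForms ℓ n Unit ∧ degProj k x = x ∧ nabla ℓ n c x = 0 := by
  simp [formCocycles, and_assoc]

lemma mem_formCoboundaries_zero {c : ℕ → ℕ → ℂ} {x : ScalarForm} :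
    x ∈ formCoboundaries ℓ n 0 c ↔ x = 0 := by
  simp [formCoboundaries]

lemma mem_formCoboundaries_succ {q : ℕ} {c : ℕ → ℕ → ℂ} {x : ScalarForm} :
    x ∈ formCoboundaries ℓ n (q + 1) c ↔
      ∃ y ∈ regForms ℓ n Unit, degProj q y = y ∧ nabla ℓ n c y = x := by
  simp [formCoboundaries, and_assoc]

lemma mem_Zmod {k : ℕ} {lam : Idx ℓ n → ℂ} {b : A ℓ n} :
    b ∈ Zmod ℓ n k lam ↔ b ∈ Adeg ℓ n k ∧ omegaI ℓ n lam * b = 0 := Iff.rfl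

lemma mem_Bmod_zero {lam : Idx ℓ n → ℂ} {b : A ℓ n} : b ∈ Bmod ℓ n 0 lam ↔ b = 0 := Iff.rfl

lemma mem_Bmod_succ {q : ℕ} {lam : Idx ℓ n → ℂ} {b : A ℓ n} :
    b ∈ Bmod ℓ n (q + 1) lam ↔ ∃ y ∈ Adeg ℓ n q, omegaI ℓ n lam * y = b := Iff.rfl

/-- For nonresonant weights the Orlik-Solomon algebra computes the twisted de Rham
cohomology. -/
theorem Hdim_eq_formHdim (hn : ℓ ≤ n) (k : ℕ) (lam : Idx ℓ n → ℂ)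
    (hN : Nonresonant n (scalarRes (symWt lam))) :
    Hdim ℓ n k lam = formHdim ℓ n k (symWt lam) := by
  obtain ⟨κ, _, ⟨r⟩⟩ := exists_reduction (symWt_symm lam) (symWt_self lam) hN hn
  have hinj := r.logForm_injective
  have hnab := raisesDegree_nabla (ℓ := ℓ) (n := n) (symWt lam)
  refine finrank_subquotient_eq (logForm ℓ n) ?_ ?_ ?_
  · rintro z ⟨hz, h⟩
    refine mem_formCocycles.2 ⟨r.logForm_mem z, degProj_logForm hz, ?_⟩
    rw [nabla_logForm, show omegaI ℓ n lam * z = 0 from h, map_zero]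
  · intro z hz
    have hz := mem_Zmod.1 hz
    cases k with
    | zero => rw [mem_formCoboundaries_zero, mem_Bmod_zero, map_eq_zero_iff _ hinj]
    | succ q =>
      rw [mem_formCoboundaries_succ, mem_Bmod_succ]
      constructor
      · rintro ⟨x, hx, hxq, h⟩
        obtain ⟨y, hy, b, hb⟩ := r.exists_logForm hx h
        obtain ⟨b', hb', h'⟩ := exists_logForm_eq_degProj q b
        refine ⟨b', hb', hinj ?_⟩
        rw [← nabla_logForm, h', ← hnab.2, ← hb, map_sub, nabla_nabla, sub_zero, h,
          degProj_logForm hz.1]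
      · rintro ⟨y, hy, rfl⟩
        exact ⟨logForm ℓ n y, r.logForm_mem y, degProj_logForm hy, nabla_logForm lam y⟩
  · intro x hx
    obtain ⟨hx, hxk, h⟩ := mem_formCocycles.1 hx
    obtain ⟨y, hy, b, hb⟩ := r.exists_logForm hx (h.trans (map_zero (logForm ℓ n)).symm)
    obtain ⟨b', hb', h'⟩ := exists_logForm_eq_degProj k b
    have hsub : x - logForm ℓ n b' = degProj k (nabla ℓ n (symWt lam) y) := by
      rw [h', ← hb, map_sub, hxk, sub_sub_cancel]
    have hdeg : degProj k (nabla ℓ n (symWt lam) y) ∈ formCoboundaries ℓ n k (symWt lam) := by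
      cases k with
      | zero => rw [hnab.1]; exact zero_mem _
      | succ q =>
        rw [hnab.2]
        exact mem_formCoboundaries_succ.2 ⟨_, degProj_mem_regForms q hy, degProj_degProj q y, rfl⟩
    refine ⟨b', mem_Zmod.2 ⟨hb', hinj ?_⟩, hsub ▸ hdeg⟩
    have : nabla ℓ n (symWt lam) (degProj k (nabla ℓ n (symWt lam) y)) = 0 := by
      rw [← hnab.2, nabla_nabla, map_zero]
    rw [← nabla_logForm, map_zero, ← sub_sub_cancel x (logForm ℓ n b'), hsub, map_sub, h, this,
      sub_zero]

/-- Multiplication by a unit shifts the weights by an integer. -/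
lemma formHdim_eq_of_unit (k : ℕ) {c c' : ℕ → ℕ → ℂ} {u : RatFn} (hu : u ≠ 0)
    (hmem : u ∈ reg ℓ n) (hmem' : u⁻¹ ∈ reg ℓ n)
    (h : ∀ x, nabla ℓ n c (u • x) = u • nabla ℓ n c' x) :
    formHdim ℓ n k c' = formHdim ℓ n k c := by
  have h' : ∀ x, u⁻¹ • nabla ℓ n c x = nabla ℓ n c' (u⁻¹ • x) := by
    intro x
    have := h (u⁻¹ • x)
    rw [smul_inv_smul₀ hu] at this
    rw [this, inv_smul_smul₀ hu]
  refine finrank_subquotient_eq ((LinearMap.lsmul RatFn ScalarForm u).restrictScalars ℂ) ?_ ?_ ?_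
  · intro x hx
    obtain ⟨hx, hxk, hd⟩ := mem_formCocycles.1 hx
    refine mem_formCocycles.2 ⟨smul_mem_regForms hmem hx, ?_, ?_⟩
    · simp [hxk]
    · simp [h, hd]
  · intro x hx
    cases k with
    | zero => simp [mem_formCoboundaries_zero, hu]
    | succ q =>
      simp only [mem_formCoboundaries_succ, LinearMap.restrictScalars_apply, LinearMap.lsmul_apply]
      constructor
      · rintro ⟨y, hy, hyq, hxy⟩
        exact ⟨u⁻¹ • y, smul_mem_regForms hmem' hy, by rw [map_smul, hyq], by
          rw [← h', hxy, inv_smul_smul₀ hu]⟩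
      · rintro ⟨y, hy, hyq, rfl⟩
        exact ⟨u • y, smul_mem_regForms hmem hy, by rw [map_smul, hyq], h y⟩
  · intro x hx
    obtain ⟨hx, hxk, hd⟩ := mem_formCocycles.1 hx
    refine ⟨u⁻¹ • x, mem_formCocycles.2 ⟨smul_mem_regForms hmem' hx, ?_, ?_⟩, ?_⟩
    · rw [map_smul, hxk]
    · rw [← h', hd, smul_zero]
    · rw [LinearMap.restrictScalars_apply, LinearMap.lsmul_apply, smul_inv_smul₀ hu, sub_self]
      exact zero_mem _

lemma sum_pd_pt_smul_eps {i : ℕ} (hi : i ≤ n) (x : ScalarForm) :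
    ∑ k ∈ Finset.Ioc ℓ n, pd k (pt ℓ i) • eps k x = epsVar ℓ i x := by
  by_cases h : ℓ < i
  · rw [Finset.sum_eq_single i]
    · rw [pd_pt, if_pos ⟨h, rfl⟩, one_smul, epsVar, if_pos h]
    · intro k _ hk
      rw [pd_pt, if_neg (fun h => hk h.2.symm), zero_smul]
    · exact fun h' => absurd (Finset.mem_Ioc.2 ⟨h, hi⟩) h'
  · rw [epsVar, if_neg h, LinearMap.zero_apply]
    exact Finset.sum_eq_zero fun k _ => by rw [pd_pt, if_neg (fun h' => h h'.1), zero_smul]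

lemma nabla_sub_smul {c c' : ℕ → ℕ → ℂ} {i j : ℕ} (hi : i ≤ n) (hj : j ≤ n) (hij : i ≠ j)
    (h : ∀ x, logMul ℓ n c' x = logMul ℓ n c x + dlog ℓ i j x) (x : ScalarForm) :
    nabla ℓ n c ((pt ℓ i - pt ℓ j) • x) = (pt ℓ i - pt ℓ j) • nabla ℓ n c' x := by
  have hd : epsVar ℓ i x = pt ℓ i • dlog ℓ i j x - pt ℓ j • dlog ℓ i j x + epsVar ℓ j x := by
    rw [← sub_smul, dlog_apply, smul_inv_smul₀ (sub_ne_zero.2 (pt_ne hij)), sub_add_cancel]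
  simp only [nabla_apply, extd_smul, map_sub, sub_smul,
    sum_pd_pt_smul_eps hi, sum_pd_pt_smul_eps hj, map_smul, h]
  rw [hd]
  simp only [smul_add]
  abel

instance : DecidableEq (Idx ℓ n) :=
  inferInstanceAs (DecidableEq
    {p : ℕ × ℕ // 1 ≤ p.1 ∧ p.1 < p.2 ∧ ℓ + 1 ≤ p.2 ∧ p.2 ≤ n})

noncomputable instance : Fintype (Idx ℓ n) :=
  Fintype.ofInjective (fun p : Idx ℓ n => ((⟨p.1.1, by have := p.2; omega⟩,
    ⟨p.1.2, by have := p.2; omega⟩) : Fin (n + 1) × Fin (n + 1))) fun p q h => by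
      simp only [Prod.mk.injEq, Fin.mk.injEq] at h
      exact Subtype.ext (Prod.ext h.1 h.2)

lemma wt_add (lam mu : Idx ℓ n → ℂ) (i j : ℕ) : wt (lam + mu) i j = wt lam i j + wt mu i j := by
  by_cases h : 1 ≤ i ∧ i < j ∧ ℓ + 1 ≤ j ∧ j ≤ n
  · rw [wt, wt, wt, dif_pos h, dif_pos h, dif_pos h]
    rfl
  · rw [wt_eq_zero _ h, wt_eq_zero _ h, wt_eq_zero _ h, add_zero]

lemma wt_smul (z : ℂ) (lam : Idx ℓ n → ℂ) (i j : ℕ) : wt (z • lam) i j = z * wt lam i j := by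
  by_cases h : 1 ≤ i ∧ i < j ∧ ℓ + 1 ≤ j ∧ j ≤ n
  · rw [wt, wt, dif_pos h, dif_pos h]
    rfl
  · rw [wt_eq_zero _ h, wt_eq_zero _ h, mul_zero]

lemma wt_single (p : Idx ℓ n) (i j : ℕ) :
    wt (Pi.single p 1) i j = if i = p.1.1 ∧ j = p.1.2 then 1 else 0 := by
  by_cases h : 1 ≤ i ∧ i < j ∧ ℓ + 1 ≤ j ∧ j ≤ n
  · rw [wt, dif_pos h]
    let q : Idx ℓ n := ⟨(i, j), h⟩
    have hq : q = p ↔ i = p.1.1 ∧ j = p.1.2 := Subtype.ext_iff.trans Prod.ext_iff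
    exact (Pi.single_apply (M := ℂ) p 1 q).trans (if_congr hq rfl rfl)
  · rw [wt_eq_zero _ h, if_neg]
    rintro ⟨rfl, rfl⟩
    exact h p.2

lemma omegaI_add (lam mu : Idx ℓ n → ℂ) :
    omegaI ℓ n (lam + mu) = omegaI ℓ n lam + omegaI ℓ n mu := by
  simp only [omegaI_eq, wt_add, add_smul, Finset.sum_add_distrib]

lemma omegaI_smul (z : ℂ) (lam : Idx ℓ n → ℂ) : omegaI ℓ n (z • lam) = z • omegaI ℓ n lam := by
  simp only [omegaI_eq, wt_smul, mul_smul, Finset.smul_sum]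

lemma omegaI_single (p : Idx ℓ n) : omegaI ℓ n (Pi.single p 1) = a ℓ n p.1.1 p.1.2 := by
  obtain ⟨h1, h2, h3, h4⟩ := p.2
  rw [omegaI_eq, Finset.sum_eq_single_of_mem p.1.2 (Finset.mem_Icc.2 ⟨h3, h4⟩),
    Finset.sum_eq_single_of_mem p.1.1 (Finset.mem_Ico.2 ⟨h1, h2⟩), wt_single, if_pos ⟨rfl, rfl⟩,
    one_smul]
  · intro i _ hi
    rw [wt_single, if_neg fun h => hi h.1, zero_smul]
  · intro j _ hj
    exact Finset.sum_eq_zero fun i _ => by rw [wt_single, if_neg fun h => hj h.2, zero_smul]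

lemma formHdim_add_single (k : ℕ) (lam : Idx ℓ n → ℂ) (p : Idx ℓ n) :
    formHdim ℓ n k (symWt (lam + Pi.single p 1)) = formHdim ℓ n k (symWt lam) := by
  obtain ⟨h1, h2, h3, h4⟩ := p.2
  have hi := pt_mem_reg (ℓ := ℓ) h1 (h2.le.trans h4)
  have hj := pt_mem_reg (ℓ := ℓ) (h1.trans h2.le) h4
  refine formHdim_eq_of_unit k (sub_ne_zero.2 (pt_ne (ℓ := ℓ) h2.ne)) (sub_mem hi hj)
    (inv_mem_reg h1 (h2.le.trans h4) (h1.trans h2.le) h4)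
    (nabla_sub_smul (h2.le.trans h4) h4 h2.ne fun x => ?_)
  rw [logMul_symWt, logMul_symWt, omegaI_add, map_add, omegaI_single, action_a h1 h2 h4,
    LinearMap.add_apply]

/-- Integral shifts of the weights. -/
def integralShift (γ : Idx ℓ n → ℤ) : Idx ℓ n → ℂ := fun p => γ p

lemma formHdim_add_integralShift (k : ℕ) (lam : Idx ℓ n → ℂ) (γ : Idx ℓ n → ℤ) :
    formHdim ℓ n k (symWt (lam + integralShift γ)) = formHdim ℓ n k (symWt lam) := by
  let G : AddSubgroup (Idx ℓ n → ℤ) :=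
    { carrier := {γ | ∀ lam, formHdim ℓ n k (symWt (lam + integralShift γ))
        = formHdim ℓ n k (symWt lam)}
      zero_mem' := fun lam => by
        congr 2
        ext p
        simp [integralShift]
      add_mem' := fun {γ δ} hγ hδ lam => by
        rw [← hγ lam, ← hδ (lam + integralShift γ)]
        congr 2
        ext p
        simp [integralShift, add_assoc]
      neg_mem' := fun {γ} hγ lam => by
        rw [← hγ (lam + integralShift (-γ))]
        congr 2
        ext p
        simp [integralShift] }
  have hG : γ ∈ G := by
    rw [pi_eq_sum_univ' γ]
    refine AddSubgroup.sum_mem _ fun p _ => AddSubgroup.zsmul_mem _ (fun lam => ?_) _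
    rw [← formHdim_add_single k lam p]
    congr 3
    ext q
    simp only [integralShift, Pi.single_apply]
    split_ifs <;> simp
  exact hG lam

/-- Weights which differ by integers and are both nonresonant have the same resonance. -/
theorem Hdim_eq_of_nonresonant (hn : ℓ ≤ n) (k : ℕ) (lam : Idx ℓ n → ℂ) (γ : Idx ℓ n → ℤ)
    (h : Nonresonant n (scalarRes (symWt lam)))
    (h' : Nonresonant n (scalarRes (symWt (lam + integralShift γ)))) :
    Hdim ℓ n k (lam + integralShift γ) = Hdim ℓ n k lam := by
  rw [Hdim_eq_formHdim hn k _ h, Hdim_eq_formHdim hn k _ h', formHdim_add_integralShift]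

end Comparison

section LinearAlgebra

/-- The rank of an affine family of linear maps drops at only finitely many parameters. -/
lemma finite_setOf_finrank_map_lt {V W : Type*} [AddCommGroup V] [Module ℂ V] [AddCommGroup W]
    [Module ℂ W] [FiniteDimensional ℂ W] (D : Submodule ℂ V) (f g : V →ₗ[ℂ] W) (s₀ : ℂ) :
    {s : ℂ | Module.finrank ℂ (D.map (f + s • g))
      < Module.finrank ℂ (D.map (f + s₀ • g))}.Finite := by
  classical
  set r := Module.finrank ℂ (D.map (f + s₀ • g)) with hr
  let b := Module.finBasisOfFinrankEq ℂ (D.map (f + s₀ • g)) hr.symm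
  choose v hv hvb using fun i => (Submodule.mem_map).1 (b i).2
  have hli : LinearIndependent ℂ fun i => (f + s₀ • g) (v i) := by
    simp only [hvb]
    exact b.linearIndependent.map' (D.map (f + s₀ • g)).subtype (Submodule.ker_subtype _)
  obtain ⟨φ, hφ⟩ := LinearMap.exists_leftInverse_of_injective
    (Fintype.linearCombination ℂ fun i => (f + s₀ • g) (v i))
    (LinearMap.ker_eq_bot.2 
      (linearIndependent_iff_injective_fintypeLinearCombination.1 hli))
  let M : Matrix (Fin r) (Fin r) (Polynomial ℂ) := fun i j =>
    Polynomial.C (φ (f (v i)) j) + Polynomial.X * Polynomial.C (φ (g (v i)) j)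
  have hM : ∀ s, M.map (Polynomial.evalRingHom s) = fun i => φ ((f + s • g) (v i)) := by
    intro s
    ext i j
    rw [Matrix.map_apply]
    simp [M, -Polynomial.X_mul_C]
  have hM₀ : M.map (Polynomial.evalRingHom s₀) = 1 := by
    rw [hM]
    ext i j
    have := congrFun (LinearMap.congr_fun hφ (Pi.single i 1)) j
    simpa [Fintype.linearCombination_apply_single, Matrix.one_apply, Pi.single_apply,
      eq_comm] using this
  have hdet : M.det ≠ 0 := by
    intro h
    have := RingHom.map_det (Polynomial.evalRingHom s₀) M
    rw [h, map_zero, RingHom.mapMatrix_apply, hM₀, Matrix.det_one] at this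
    exact zero_ne_one this
  refine (M.det.roots.toFinset.finite_toSet).subset fun s hs => ?_
  by_contra hroot
  have hs' : (M.map (Polynomial.evalRingHom s)).det ≠ 0 := by
    rw [← RingHom.mapMatrix_apply, ← RingHom.map_det]
    intro h
    exact hroot (by simpa [hdet] using h)
  have hrows := Matrix.linearIndependent_rows_of_det_ne_zero hs'
  rw [hM] at hrows
  have hli' : LinearIndependent ℂ fun i => (f + s • g) (v i) :=
    LinearIndependent.of_comp φ hrows
  have hli'' : LinearIndependent ℂ fun i =>
      (⟨(f + s • g) (v i), Submodule.mem_map_of_mem (hv i)⟩ : D.map (f + s • g)) :=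
    LinearIndependent.of_comp (D.map (f + s • g)).subtype hli'
  have := hli''.fintype_card_le_finrank
  rw [Fintype.card_fin] at this
  exact absurd hs (not_lt.2 this)

/-- Complex solutions of integral linear equations are spanned by integral solutions. -/
lemma mem_span_integral_of_integral_equations {σ ι : Type*} [Fintype ι] (M : σ → ι → ℤ)
    {v : ι → ℂ} (hv : ∀ s, ∑ p, (M s p : ℂ) * v p = 0) :
    v ∈ Submodule.span ℂ
      ((fun γ : ι → ℤ => fun p => (γ p : ℂ)) '' {γ | ∀ s, ∑ p, M s p * γ p = 0}) := by
  classical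
  let b := Module.Basis.ofVectorSpace ℚ ℂ
  let B := Finset.univ.biUnion fun p => (b.repr (v p)).support
  have hsum : v = ∑ i ∈ B, b i • fun p => (b.repr (v p) i : ℂ) := by
    ext p
    have h1 : v p = ∑ i ∈ (b.repr (v p)).support, b.repr (v p) i • b i := by
      conv_lhs => rw [← b.linearCombination_repr (v p), Finsupp.linearCombination_apply]
      rfl
    rw [h1, Finset.sum_apply, ← h1]
    rw [← Finset.sum_subset (Finset.subset_biUnion_of_mem
      (fun p => (b.repr (v p)).support) (Finset.mem_univ p))]
    · conv_lhs => rw [h1]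
      exact Finset.sum_congr rfl fun i _ => by
        rw [Pi.smul_apply, smul_eq_mul, Rat.smul_def, mul_comm]
    · intro i _ hi
      rw [Pi.smul_apply, Finsupp.notMem_support_iff.1 hi, Rat.cast_zero, smul_zero]
  rw [hsum]
  refine Submodule.sum_mem _ fun i _ => Submodule.smul_mem _ _ ?_
  let w := fun p => b.repr (v p)
  have hq : ∀ s, ∑ p, (M s p : ℚ) * w p i = 0 := by
    intro s
    have h : ∑ p, (M s p : ℂ) * v p = ∑ p, (M s p : ℚ) • v p :=
      Finset.sum_congr rfl fun p _ => by rw [Rat.smul_def, Rat.cast_intCast]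
    have := DFunLike.congr_fun (congrArg b.repr (h.symm.trans (hv s))) i
    simpa [map_sum, Finsupp.finsetSum_apply] using this
  obtain ⟨d, hd⟩ := IsLocalization.exist_integer_multiples_of_finite (nonZeroDivisors ℤ)
    fun p => w p i
  choose γ hγ using hd
  have hd0 : (d : ℤ) ≠ 0 := nonZeroDivisors.coe_ne_zero d
  have hγ' : ∀ p, (γ p : ℚ) = (d : ℤ) * w p i := fun p => by
    simpa [Submonoid.smul_def] using hγ p
  have hγq : (fun p => (w p i : ℂ)) = ((d : ℤ) : ℂ)⁻¹ • fun p => (γ p : ℂ) := by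
    ext p
    rw [Pi.smul_apply, smul_eq_mul, eq_inv_mul_iff_mul_eq₀ (Int.cast_ne_zero.2 hd0)]
    exact_mod_cast (hγ' p).symm
  change (fun p => (w p i : ℂ)) ∈ _
  rw [hγq]
  refine Submodule.smul_mem _ _ (Submodule.subset_span ⟨γ, fun s => ?_, rfl⟩)
  have : ∑ p, (M s p : ℚ) * γ p = 0 := by
    simp only [hγ', mul_left_comm _ ((d : ℤ) : ℚ)]
    rw [← Finset.mul_sum, hq s, mul_zero]
  exact_mod_cast this

end LinearAlgebra

section Arrangement

variable {ℓ n : ℕ}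

lemma finiteDimensional_A (hn : ℓ ≤ n) : FiniteDimensional ℂ (A ℓ n) := by
  obtain ⟨κ, _, ⟨r⟩⟩ := exists_reduction (ℓ := ℓ) (n := n) (c := 0) (fun _ _ => rfl)
    (fun _ => rfl) (fun J J' _ _ p hp g h => by
      have h0 : scalarRes 0 = 0 := rfl
      simp only [totRes, h0, Pi.zero_apply, Finset.sum_const_zero, sub_self] at h
      exact (smul_eq_zero.1 h.symm).resolve_left (Int.cast_ne_zero.2 hp)) hn
  exact Module.Finite.of_surjective r.elt r.elt_surjective

/-- The coefficients of the difference of the total weights of two sets of points. -/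
def resCoeff (S : Finset ℕ × Finset ℕ) (p : Idx ℓ n) : ℤ :=
  (if p.1.1 ∈ S.2 ∧ p.1.2 ∈ S.2 then 1 else 0) - if p.1.1 ∈ S.1 ∧ p.1.2 ∈ S.1 then 1 else 0

/-- The linear form given by the difference of the total weights of two sets of points. -/
noncomputable def resForm (ℓ n : ℕ) (S : Finset ℕ × Finset ℕ) : (Idx ℓ n → ℂ) →ₗ[ℂ] ℂ :=
  Fintype.linearCombination ℂ fun p => (resCoeff S p : ℂ)

lemma resForm_apply (S : Finset ℕ × Finset ℕ) (lam : Idx ℓ n → ℂ) :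
    resForm ℓ n S lam = ∑ p, (resCoeff S p : ℂ) * lam p := by
  simp [resForm, Fintype.linearCombination_apply, mul_comm]

lemma resForm_integralShift (S : Finset ℕ × Finset ℕ) (γ : Idx ℓ n → ℤ) :
    resForm ℓ n S (integralShift γ) = ((∑ p, resCoeff S p * γ p : ℤ) : ℂ) := by
  rw [resForm_apply]
  push_cast
  rfl

lemma sum_wt (lam : Idx ℓ n → ℂ) (J : Finset ℕ) : ∑ i ∈ J, ∑ j ∈ J, wt lam i j
    = ∑ p : Idx ℓ n, (if p.1.1 ∈ J ∧ p.1.2 ∈ J then 1 else 0) * lam p := by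
  have h : ∀ i j, wt lam i j
      = ∑ p : Idx ℓ n, if i = p.1.1 ∧ j = p.1.2 then lam p else 0 := by
    intro i j
    by_cases h : 1 ≤ i ∧ i < j ∧ ℓ + 1 ≤ j ∧ j ≤ n
    · let q : Idx ℓ n := ⟨(i, j), h⟩
      rw [Finset.sum_eq_single q (fun p _ hp => if_neg fun h' => hp
        (Subtype.ext (Prod.ext h'.1.symm h'.2.symm))) fun h => absurd (Finset.mem_univ _) h,
        if_pos ⟨rfl, rfl⟩, wt, dif_pos h]
    · rw [wt_eq_zero _ h]
      refine (Finset.sum_eq_zero fun p _ => if_neg ?_).symm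
      rintro ⟨rfl, rfl⟩
      exact h p.2
  simp only [h]
  rw [Finset.sum_congr rfl fun i _ => Finset.sum_comm, Finset.sum_comm]
  refine Finset.sum_congr rfl fun p _ => ?_
  simp only [ite_and, Finset.sum_ite_eq', Finset.sum_ite_irrel, Finset.sum_const_zero]
  split_ifs <;> simp

lemma sum_symWt (lam : Idx ℓ n → ℂ) (J : Finset ℕ) : ∑ i ∈ J, ∑ j ∈ J, symWt lam i j
    = ∑ i ∈ J, ∑ j ∈ J, wt lam i j := by
  simp only [symWt, ← Finset.sum_div, Finset.sum_add_distrib]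
  rw [Finset.sum_comm (f := fun i j => wt lam j i), add_self_div_two]

lemma resForm_eq (J J' : Finset ℕ) (lam : Idx ℓ n → ℂ) : resForm ℓ n (J, J') lam
    = ∑ i ∈ J', ∑ j ∈ J', symWt lam i j - ∑ i ∈ J, ∑ j ∈ J, symWt lam i j := by
  rw [sum_symWt, sum_symWt, sum_wt, sum_wt, resForm_apply, ← Finset.sum_sub_distrib]
  simp [resCoeff, sub_mul]

lemma act_totRes_scalarRes (c : ℕ → ℕ → ℂ) (J : Finset ℕ) (g : Unit → ℂ) :
    act (totRes (scalarRes c) J) g = (∑ i ∈ J, ∑ j ∈ J, c i j) • g := by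
  ext
  simp [act_apply, totRes, scalarRes, Matrix.sum_apply]

lemma nonresonant_of_resForm (lam : Idx ℓ n → ℂ)
    (h : ∀ S ∈ (Finset.Icc 1 n).powerset ×ˢ (Finset.Icc 1 n).powerset, ∀ p : ℤ,
      resForm ℓ n S lam = p → p = 0) : Nonresonant n (scalarRes (symWt lam)) := by
  intro J J' hJ hJ' p hp g hg
  rw [act_totRes_scalarRes, act_totRes_scalarRes, ← sub_smul, ← resForm_eq, ← sub_eq_zero,
    ← sub_smul] at hg
  refine (smul_eq_zero.1 hg).resolve_left fun h' => hp (h (J, J') ?_ p (sub_eq_zero.1 h'))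
  exact Finset.mem_product.2
    ⟨Finset.mem_powerset.2 (hJ.trans hJ'), Finset.mem_powerset.2 hJ'⟩

lemma mulOmega_add (lam mu : Idx ℓ n → ℂ) :
    mulOmega ℓ n (lam + mu) = mulOmega ℓ n lam + mulOmega ℓ n mu := by
  ext x
  simp [mulOmega, omegaI_add, add_mul]

lemma mulOmega_smul (z : ℂ) (lam : Idx ℓ n → ℂ) :
    mulOmega ℓ n (z • lam) = z • mulOmega ℓ n lam := by
  ext x
  simp [mulOmega, omegaI_smul]

/-- The resonant varieties are cones. -/
lemma Hdim_smul (k : ℕ) {z : ℂ} (hz : z ≠ 0) (lam : Idx ℓ n → ℂ) :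
    Hdim ℓ n k (z • lam) = Hdim ℓ n k lam := by
  have hZ : Zmod ℓ n k (z • lam) = Zmod ℓ n k lam := by
    rw [Zmod, Zmod, mulOmega_smul, LinearMap.ker_smul _ _ hz]
  have hB : Bmod ℓ n k (z • lam) = Bmod ℓ n k lam := by
    rw [Bmod, Bmod, mulOmega_smul, Submodule.map_smul _ _ _ hz]
  rw [Hdim, Hdim, hZ, hB]

lemma Bmod_eq_map (k : ℕ) (lam : Idx ℓ n → ℂ) :
    Bmod ℓ n k lam = (if k = 0 then ⊥ else Adeg ℓ n (k - 1)).map (mulOmega ℓ n lam) := by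
  rw [Bmod]
  split_ifs
  · rw [Submodule.map_bot]
  · rfl

lemma omegaI_mul_omegaI (lam : Idx ℓ n → ℂ) : omegaI ℓ n lam * omegaI ℓ n lam = 0 := by
  have h : ∀ x : A ℓ n, (∀ i j, a ℓ n i j * x = -(x * a ℓ n i j)) →
      omegaI ℓ n lam * x = -(x * omegaI ℓ n lam) := by
    intro x hx
    simp only [omegaI_eq, Finset.sum_mul, Finset.mul_sum, smul_mul_assoc, mul_smul_comm, hx,
      smul_neg, Finset.sum_neg_distrib]
  refine eq_zero_of_eq_neg (h _ fun i j => ?_)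
  rw [h _ fun _ _ => a_anticomm _ _ _ _, neg_neg]

lemma Bmod_le_Zmod (k : ℕ) (lam : Idx ℓ n → ℂ) : Bmod ℓ n k lam ≤ Zmod ℓ n k lam := by
  intro x hx
  cases k with
  | zero => rw [mem_Bmod_zero.1 hx]; exact zero_mem _
  | succ q =>
    obtain ⟨y, hy, rfl⟩ := mem_Bmod_succ.1 hx
    refine mem_Zmod.2 ⟨omegaI_mul_mem_Adeg lam hy, ?_⟩
    rw [← mul_assoc, omegaI_mul_omegaI, zero_mul]

/-- The dimension of the cohomology in terms of ranks. -/
lemma Hdim_add_finrank [FiniteDimensional ℂ (A ℓ n)] (k : ℕ) (lam : Idx ℓ n → ℂ) :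
    Hdim ℓ n k lam + Module.finrank ℂ (Bmod ℓ n k lam)
      + Module.finrank ℂ ((Adeg ℓ n k).map (mulOmega ℓ n lam))
      = Module.finrank ℂ (Adeg ℓ n k) := by
  have h1 := Submodule.finrank_quotient_add_finrank
    ((Bmod ℓ n k lam).comap (Zmod ℓ n k lam).subtype)
  have h2 := (Submodule.comapSubtypeEquivOfLe (Bmod_le_Zmod k lam)).finrank_eq
  have h3 := ((mulOmega ℓ n lam).domRestrict (Adeg ℓ n k)).finrank_range_add_finrank_ker
  have h4 : Module.finrank ℂ (LinearMap.ker ((mulOmega ℓ n lam).domRestrict (Adeg ℓ n k)))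
      = Module.finrank ℂ (Zmod ℓ n k lam) := by
    rw [LinearMap.ker_domRestrict, Zmod]
    exact (Submodule.equivSubtypeMap _ _).finrank_eq.trans
      (by rw [Submodule.map_comap_subtype])
  rw [LinearMap.range_domRestrict] at h3
  rw [Hdim]
  omega

/-- Resonance at all integral points of a line propagates to the whole line. -/
lemma mem_Rvar_of_forall_int (hn : ℓ ≤ n) {k m : ℕ} {x y : Idx ℓ n → ℂ}
    (h : ∀ t : ℤ, x + (t : ℂ) • y ∈ Rvar ℓ n k m) (s : ℂ) : x + s • y ∈ Rvar ℓ n k m := by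
  have := finiteDimensional_A hn
  have hmul : ∀ t : ℂ, mulOmega ℓ n (x + t • y) = mulOmega ℓ n x + t • mulOmega ℓ n y :=
    fun t => by rw [mulOmega_add, mulOmega_smul]
  have hfin := (finite_setOf_finrank_map_lt (Adeg ℓ n k) (mulOmega ℓ n x) (mulOmega ℓ n y) s).union
    (finite_setOf_finrank_map_lt (if k = 0 then ⊥ else Adeg ℓ n (k - 1)) (mulOmega ℓ n x)
      (mulOmega ℓ n y) s)
  obtain ⟨_, ⟨t, rfl⟩, ht⟩ := ((Set.infinite_range_of_injective
    (Int.cast_injective (α := ℂ))).sdiff hfin).nonempty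
  simp only [Set.mem_union, Set.mem_ofPred_eq, not_or, not_lt] at ht
  rw [← hmul, ← hmul, ← Bmod_eq_map, ← Bmod_eq_map] at ht
  have h1 := Hdim_add_finrank k (x + s • y)
  have h2 := Hdim_add_finrank k (x + (t : ℂ) • y)
  have h3 : m ≤ Hdim ℓ n k (x + (t : ℂ) • y) := h t
  change m ≤ Hdim ℓ n k (x + s • y)
  omega

/-- The common kernel of a set of resonance forms. -/
noncomputable def resSpace (ℓ n : ℕ) (𝒮 : Finset (Finset ℕ × Finset ℕ)) :
    Submodule ℂ (Idx ℓ n → ℂ) :=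
  ⨅ S ∈ 𝒮, LinearMap.ker (resForm ℓ n S)

lemma mem_resSpace {𝒮 : Finset (Finset ℕ × Finset ℕ)} {v : Idx ℓ n → ℂ} :
    v ∈ resSpace ℓ n 𝒮 ↔ ∀ S ∈ 𝒮, resForm ℓ n S v = 0 := by
  simp [resSpace]

/-- The integral points of the common kernel of a set of resonance forms. -/
noncomputable def resLattice (ℓ n : ℕ) (𝒮 : Finset (Finset ℕ × Finset ℕ)) :
    Set (Idx ℓ n → ℤ) :=
  {γ | integralShift γ ∈ resSpace ℓ n 𝒮}

lemma mem_resLattice {𝒮 : Finset (Finset ℕ × Finset ℕ)} {γ : Idx ℓ n → ℤ} :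
    γ ∈ resLattice ℓ n 𝒮 ↔ integralShift γ ∈ resSpace ℓ n 𝒮 := Iff.rfl

lemma resSpace_le_span (𝒮 : Finset (Finset ℕ × Finset ℕ)) :
    resSpace ℓ n 𝒮 ≤ Submodule.span ℂ (integralShift '' resLattice ℓ n 𝒮) := by
  intro v hv
  refine Submodule.span_mono (Set.image_mono fun γ hγ => ?_)
    (mem_span_integral_of_integral_equations (fun S : 𝒮 => resCoeff S.1) fun S => ?_)
  · refine mem_resSpace.2 fun S hS => ?_
    rw [resForm_integralShift, hγ ⟨S, hS⟩, Int.cast_zero]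
  · rw [← resForm_apply]
    exact mem_resSpace.1 hv _ S.2

/-- A resonant variety containing all lattice translates of a point contains all translates of
that point by the span of the lattice. -/
lemma add_mem_Rvar_of_mem_resSpace (hn : ℓ ≤ n) {k m : ℕ} {𝒮 : Finset (Finset ℕ × Finset ℕ)}
    {x : Idx ℓ n → ℂ} (h : ∀ γ ∈ resLattice ℓ n 𝒮, x + integralShift γ ∈ Rvar ℓ n k m)
    {v : Idx ℓ n → ℂ} (hv : v ∈ resSpace ℓ n 𝒮) : x + v ∈ Rvar ℓ n k m := by
  have key : ∀ w, (∀ γ ∈ resLattice ℓ n 𝒮, x + w + integralShift γ ∈ Rvar ℓ n k m) →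
      ∀ γ ∈ resLattice ℓ n 𝒮, x + (w + v) + integralShift γ ∈ Rvar ℓ n k m := by
    refine Submodule.closure_induction ?_ ?_ ?_ (resSpace_le_span 𝒮 hv)
    · exact fun w hw => by rwa [add_zero]
    · intro v v' _ _ hv hv' w hw γ hγ
      rw [← add_assoc w]
      exact hv' _ (hv _ hw) γ hγ
    · rintro s _ ⟨δ, hδ, rfl⟩ w hw γ hγ
      rw [← add_assoc, add_right_comm]
      refine mem_Rvar_of_forall_int hn (fun t => ?_) s
      have ht : integralShift (γ + t • δ) = integralShift γ + (t : ℂ) • integralShift δ := by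
        ext p
        simp [integralShift]
      rw [add_assoc, ← ht]
      refine hw _ ?_
      rw [mem_resLattice, ht]
      exact add_mem hγ (Submodule.smul_mem _ _ hδ)
  have h0 : integralShift (0 : Idx ℓ n → ℤ) = 0 := by
    ext p
    simp [integralShift]
  have := key 0 (by simpa using h) 0 (by
    rw [mem_resLattice, h0]
    exact zero_mem _)
  simpa [h0] using this

/-- The pairs of sets of points whose resonance form vanishes at the given weights. -/
noncomputable def vanishingPairs (lam : Idx ℓ n → ℂ) : Finset (Finset ℕ × Finset ℕ) :=
  open Classical in
  ((Finset.Icc 1 n).powerset ×ˢ (Finset.Icc 1 n).powerset).filter fun S => resForm ℓ n S lam = 0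

lemma mem_resSpace_vanishingPairs (lam : Idx ℓ n → ℂ) :
    lam ∈ resSpace ℓ n (vanishingPairs lam) :=
  mem_resSpace.2 fun _ hS => (Finset.mem_filter.1 hS).2

/-- A resonant variety contains, with each point, the common kernel of all resonance forms
vanishing at that point. -/
theorem resSpace_vanishingPairs_subset (hn : ℓ ≤ n) {k m : ℕ} {lam : Idx ℓ n → ℂ}
    (hlam : lam ∈ Rvar ℓ n k m) :
    (resSpace ℓ n (vanishingPairs lam) : Set (Idx ℓ n → ℂ)) ⊆ Rvar ℓ n k m := by
  classical
  set P := (Finset.Icc 1 n).powerset ×ˢ (Finset.Icc 1 n).powerset with hP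
  let C : ℝ := 1 + ∑ S ∈ P, ‖resForm ℓ n S lam‖
  have hC : 0 < C := by positivity
  let z : ℂ := ((C⁻¹ : ℝ) : ℂ)
  have hz : z ≠ 0 := Complex.ofReal_ne_zero.2 (inv_ne_zero hC.ne')
  have hsmall : ∀ S ∈ P, ‖resForm ℓ n S (z • lam)‖ < 1 := by
    intro S hS
    have h : ‖resForm ℓ n S lam‖ ≤ ∑ S ∈ P, ‖resForm ℓ n S lam‖ :=
      Finset.single_le_sum (f := fun S => ‖resForm ℓ n S lam‖) (fun _ _ => norm_nonneg _) hS
    rw [map_smul, norm_smul, Complex.norm_real, Real.norm_of_nonneg (inv_nonneg.2 hC.le),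
      inv_mul_lt_one₀ hC]
    exact lt_of_le_of_lt h (lt_one_add _)
  have hint : ∀ S ∈ P, ∀ p : ℤ, resForm ℓ n S (z • lam) = p → p = 0 := by
    intro S hS p hp
    have := hsmall S hS
    rw [hp, Complex.norm_intCast] at this
    exact Int.abs_lt_one_iff.1 (by exact_mod_cast this)
  have hmem := mem_resSpace_vanishingPairs lam
  have hx : ∀ γ ∈ resLattice ℓ n (vanishingPairs lam),
      z • lam + integralShift γ ∈ Rvar ℓ n k m := by
    intro γ hγ
    change m ≤ Hdim ℓ n k _
    rw [Hdim_eq_of_nonresonant hn k _ γ (nonresonant_of_resForm _ hint)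
      (nonresonant_of_resForm _ fun S hS p hp => ?_), Hdim_smul k hz]
    · exact hlam
    · rw [map_add] at hp
      have h0 : resForm ℓ n S (z • lam) = 0 := by
        rw [resForm_integralShift] at hp
        have h := eq_sub_of_add_eq hp
        rw [← Int.cast_sub] at h
        rw [h, hint S hS _ h, Int.cast_zero]
      have hS' : S ∈ vanishingPairs lam := Finset.mem_filter.2
        ⟨hS, by simpa [hz] using h0⟩
      rw [h0, mem_resSpace.1 hγ S hS', add_zero] at hp
      exact_mod_cast hp.symm
  intro v hv
  have := add_mem_Rvar_of_mem_resSpace hn hx (sub_mem hv (Submodule.smul_mem _ z hmem))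
  rwa [add_sub_cancel] at this

end Arrangement

/-- R_k^m(A) is the union of an arrangement of linear subspaces of ℂ^N. -/
theorem statement15 (ℓ n : ℕ) (hℓ : 1 ≤ ℓ) (hn : ℓ < n) (k m : ℕ) (hm : 1 ≤ m) :
    ∃ (r : ℕ) (V : Fin r → Submodule ℂ (Idx ℓ n → ℂ)),
      Rvar ℓ n k m = ⋃ t : Fin r, (V t : Set (Idx ℓ n → ℂ)) := by
  classical
  let F := ((Finset.Icc 1 n).powerset ×ˢ (Finset.Icc 1 n).powerset).powerset.filter fun 𝒮 =>
    (resSpace ℓ n 𝒮 : Set (Idx ℓ n → ℂ)) ⊆ Rvar ℓ n k m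
  refine ⟨F.card, fun t => resSpace ℓ n (F.equivFin.symm t), Set.Subset.antisymm ?_ ?_⟩
  · intro lam hlam
    have hF : vanishingPairs lam ∈ F := Finset.mem_filter.2
      ⟨Finset.mem_powerset.2 (Finset.filter_subset _ _),
        resSpace_vanishingPairs_subset hn.le hlam⟩
    refine Set.mem_iUnion.2 ⟨F.equivFin ⟨_, hF⟩, ?_⟩
    simp only [Equiv.symm_apply_apply]
    exact mem_resSpace_vanishingPairs lam
  · exact Set.iUnion_subset fun t => (Finset.mem_filter.1 (F.equivFin.symm t).2).2

end OSDisc
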